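/- Let F(U,V) = aU³ + bU²V + cUV² + dV³ be a binary cubic form with integer coefficients that is irreducible over ℚ. Then the number of pairs (u,v) ∈ ℤ² with F(u,v) = 1 or F(u,v) = −1, counted up to the identification of (u,v) with (−u,−v), is at most 10. -/

import Mathlib

/-- The value of the binary cubic form `aU³ + bU²V + cUV² + dV³` at a pair. -/
def cubicFormVal (a b c d : ℤ) (p : ℤ × ℤ) : ℤ :=
  a * p.1 ^ 3 + b * p.1 ^ 2 * p.2 + c * p.1 * p.2 ^ 2 + d * p.2 ^ 3

/-- Solutions of the Thue equation `F(U,V) = ±1`. -/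
abbrev CubicThueSol (a b c d : ℤ) : Type :=
  {p : ℤ × ℤ // cubicFormVal a b c d p = 1 ∨ cubicFormVal a b c d p = -1}

/-- Identification of a solution `(u,v)` with `(-u,-v)`. -/
def pmRelCubic (a b c d : ℤ) (p q : CubicThueSol a b c d) : Prop :=
  (p : ℤ × ℤ) = (q : ℤ × ℤ) ∨ (p : ℤ × ℤ) = -(q : ℤ × ℤ)

/-- A binary cubic form with integer coefficients. -/
structure BinaryCubic where
  /-- coefficient of `x³` -/
  a : ℤ
  /-- coefficient of `x²y` -/
  b : ℤ
  /-- coefficient of `xy²` -/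
  c : ℤ
  /-- coefficient of `y³` -/
  d : ℤ

namespace BinaryCubic

/-- Value of a binary cubic form. -/
def val (f : BinaryCubic) (x y : ℤ) : ℤ :=
  f.a * x ^ 3 + f.b * x ^ 2 * y + f.c * x * y ^ 2 + f.d * y ^ 3

/-- Discriminant of a binary cubic form. -/
def disc (f : BinaryCubic) : ℤ :=
  f.b ^ 2 * f.c ^ 2 - 4 * f.a * f.c ^ 3 - 4 * f.b ^ 3 * f.d - 27 * f.a ^ 2 * f.d ^ 2 +
    18 * f.a * f.b * f.c * f.d

/-- Substitution `(x, y) ↦ (p x + q y, r x + s y)` in a binary cubic form. -/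
def subst (f : BinaryCubic) (p q r s : ℤ) : BinaryCubic where
  a := f.a * p ^ 3 + f.b * p ^ 2 * r + f.c * p * r ^ 2 + f.d * r ^ 3
  b := 3 * f.a * p ^ 2 * q + f.b * (p ^ 2 * s + 2 * p * q * r) + f.c * (q * r ^ 2 + 2 * p * r * s) +
    3 * f.d * r ^ 2 * s
  c := 3 * f.a * p * q ^ 2 + f.b * (q ^ 2 * r + 2 * p * q * s) + f.c * (p * s ^ 2 + 2 * q * r * s) +
    3 * f.d * r * s ^ 2
  d := f.a * q ^ 3 + f.b * q ^ 2 * s + f.c * q * s ^ 2 + f.d * s ^ 3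

theorem val_subst (f : BinaryCubic) (p q r s x y : ℤ) :
    (f.subst p q r s).val x y = f.val (p * x + q * y) (r * x + s * y) := by
  simp only [val, subst]; ring

theorem disc_subst (f : BinaryCubic) (p q r s : ℤ) :
    (f.subst p q r s).disc = (p * s - q * r) ^ 6 * f.disc := by
  simp only [disc, subst]; ring

/-- The form has no nontrivial integral zero. -/
def Anisotropic (f : BinaryCubic) : Prop := ∀ x y, f.val x y = 0 → x = 0 ∧ y = 0

theorem Anisotropic.subst {f : BinaryCubic} (hf : f.Anisotropic) {p q r s : ℤ}
    (h : p * s - q * r ≠ 0) : (f.subst p q r s).Anisotropic := by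
  intro x y hxy
  rw [val_subst] at hxy
  obtain ⟨h1, h2⟩ := hf _ _ hxy
  constructor
  · apply (mul_eq_zero.mp (?_ : (p * s - q * r) * x = 0)).resolve_left h
    linear_combination s * h1 - q * h2
  · apply (mul_eq_zero.mp (?_ : (p * s - q * r) * y = 0)).resolve_left h
    linear_combination p * h2 - r * h1

theorem Anisotropic.disc_ne_zero {f : BinaryCubic} (hf : f.Anisotropic) : f.disc ≠ 0 := by
  intro h0
  have h1 : f.val (-(f.b * f.c - 9 * f.a * f.d)) (2 * (f.b ^ 2 - 3 * f.a * f.c)) = 0 := by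
    have : f.val (-(f.b * f.c - 9 * f.a * f.d)) (2 * (f.b ^ 2 - 3 * f.a * f.c)) =
        f.disc * (27 * f.a ^ 2 * f.d + 2 * f.b ^ 3 - 9 * f.a * f.b * f.c) * (-1) := by
      simp only [val, disc]; ring
    rw [this, h0]; ring
  obtain ⟨hB, hA⟩ := hf _ _ h1
  have h2 : f.val (-f.b) (3 * f.a) = 0 := by
    have hB' : f.b * f.c = 9 * f.a * f.d := by linarith
    have hA' : f.b ^ 2 = 3 * f.a * f.c := by linarith
    simp only [val]
    linear_combination (2 * f.a * f.b) * hA' + (-3 * f.a ^ 2) * hB'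
  obtain ⟨hb, ha⟩ := hf _ _ h2
  have := hf 1 0 (by simp only [val]; linarith)
  simp at this

/-- A finite set of solutions of `f(x, y) = ±1`, pairwise distinct up to sign. -/
def IsSolSet (f : BinaryCubic) (S : Finset (ℤ × ℤ)) : Prop :=
  (∀ p ∈ S, f.val p.1 p.2 = 1 ∨ f.val p.1 p.2 = -1) ∧
    ∀ p ∈ S, ∀ q ∈ S, p ≠ q → p.1 * q.2 - p.2 * q.1 ≠ 0

/-- There are at most `N` solutions of `f(x, y) = ±1` up to sign. -/
def SolBound (f : BinaryCubic) (N : ℕ) : Prop := ∀ S, f.IsSolSet S → S.card ≤ N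

theorem IsSolSet.mono {f : BinaryCubic} {S T : Finset (ℤ × ℤ)} (h : f.IsSolSet S) (hT : T ⊆ S) :
    f.IsSolSet T :=
  ⟨fun p hp => h.1 p (hT hp), fun p hp q hq => h.2 p (hT hp) q (hT hq)⟩

theorem IsSolSet.exists_subst {f : BinaryCubic} {S : Finset (ℤ × ℤ)} (hS : f.IsSolSet S)
    {p q r s : ℤ} (h : p * s - q * r = 1 ∨ p * s - q * r = -1) :
    (f.subst p q r s).IsSolSet (S.image fun v =>
      ((p * s - q * r) * (s * v.1 - q * v.2), (p * s - q * r) * (p * v.2 - r * v.1))) ∧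
    (S.image fun v => ((p * s - q * r) * (s * v.1 - q * v.2),
      (p * s - q * r) * (p * v.2 - r * v.1))).card = S.card := by
  have hsq : (p * s - q * r) ^ 2 = 1 := by rcases h with h | h <;> rw [h] <;> norm_num
  have hinj : Function.Injective fun v : ℤ × ℤ => ((p * s - q * r) * (s * v.1 - q * v.2),
      (p * s - q * r) * (p * v.2 - r * v.1)) := by
    intro v w hvw
    simp only [Prod.mk.injEq] at hvw
    obtain ⟨h1, h2⟩ := hvw
    ext
    · linear_combination p * h1 + q * h2 + (w.1 - v.1) * hsq
    · linear_combination r * h1 + s * h2 + (w.2 - v.2) * hsq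
  refine ⟨⟨?_, ?_⟩, Finset.card_image_of_injective _ hinj⟩
  · intro w hw
    obtain ⟨v, hv, rfl⟩ := Finset.mem_image.mp hw
    rw [val_subst]
    have h1 : p * ((p * s - q * r) * (s * v.1 - q * v.2)) +
        q * ((p * s - q * r) * (p * v.2 - r * v.1)) = v.1 := by linear_combination v.1 * hsq
    have h2 : r * ((p * s - q * r) * (s * v.1 - q * v.2)) +
        s * ((p * s - q * r) * (p * v.2 - r * v.1)) = v.2 := by linear_combination v.2 * hsq
    simp only [h1, h2]
    exact hS.1 v hv
  · intro w hw w' hw' hne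
    obtain ⟨v, hv, rfl⟩ := Finset.mem_image.mp hw
    obtain ⟨v', hv', rfl⟩ := Finset.mem_image.mp hw'
    have := hS.2 v hv v' hv' (fun h => hne (by rw [h]))
    intro h0
    apply this
    apply (mul_eq_zero.mp (?_ : (p * s - q * r) * (v.1 * v'.2 - v.2 * v'.1) = 0)).resolve_left
    · rcases h with h | h <;> rw [h] <;> norm_num
    · simp only at h0
      linear_combination h0 - (p * s - q * r) * (v.1 * v'.2 - v.2 * v'.1) * hsq

/-- A solution of `f(x, y) = ±1` can be moved to `(1, 0)`. -/
theorem exists_unimodular {f : BinaryCubic} {x y : ℤ} (h : f.val x y = 1 ∨ f.val x y = -1) :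
    ∃ q s : ℤ, x * s - q * y = 1 := by
  have hc : IsCoprime x y := by
    rw [Int.isCoprime_iff_gcd_eq_one]
    have hx : (Int.gcd x y : ℤ) ∣ x := Int.gcd_dvd_left ..
    have hy : (Int.gcd x y : ℤ) ∣ y := Int.gcd_dvd_right ..
    have hF : (Int.gcd x y : ℤ) ∣ f.val x y := by
      simp only [val]
      exact dvd_add (dvd_add (dvd_add (Dvd.dvd.mul_left (dvd_pow hx (by norm_num)) _)
        (Dvd.dvd.mul_left hy _)) (Dvd.dvd.mul_left (dvd_pow hy (by norm_num)) _))
        (Dvd.dvd.mul_left (dvd_pow hy (by norm_num)) _)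
    have : (Int.gcd x y : ℤ) ∣ 1 := by
      rcases h with h | h <;> rw [h] at hF
      · exact hF
      · exact (Int.dvd_neg.mp hF)
    exact_mod_cast Int.eq_one_of_dvd_one (by positivity) this
  obtain ⟨u, v, huv⟩ := hc
  exact ⟨-v, u, by linarith⟩

theorem det_eq_zero_of_sol {f : BinaryCubic} {x y x' y' : ℤ} (h : f.val x y = 1 ∨ f.val x y = -1)
    (h' : f.val x' y' = 1 ∨ f.val x' y' = -1) (h0 : x * y' - y * x' = 0) :
    (x, y) = (x', y') ∨ (x, y) = -(x', y') := by
  obtain ⟨q, s, hqs⟩ := exists_unimodular h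
  obtain ⟨q', s', hqs'⟩ := exists_unimodular h'
  have hx : x' = x * (s * x' - q * y') := by linear_combination (-x') * hqs + q * h0
  have hy : y' = y * (s * x' - q * y') := by linear_combination (-y') * hqs + s * h0
  set k := s * x' - q * y' with hk
  have hk1 : k ∣ 1 := ⟨x * s' - q' * y, by linear_combination -hqs' + s' * hx - q' * hy⟩
  have := Int.isUnit_iff.mp (isUnit_of_dvd_one hk1)
  rcases this with h1 | h1
  · left; rw [h1] at hx hy; ext <;> simp <;> linarith
  · right; rw [h1] at hx hy; ext <;> simp <;> linarith

end BinaryCubic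

theorem card_quot_le_of_solBound {a b c d : ℤ} (h : (BinaryCubic.mk a b c d).SolBound 10) :
    Finite (Quot (pmRelCubic a b c d)) ∧ Nat.card (Quot (pmRelCubic a b c d)) ≤ 10 := by
  by_contra hcon
  have hemb : ∃ g : Fin 11 → Quot (pmRelCubic a b c d), Function.Injective g := by
    by_cases hfin : Finite (Quot (pmRelCubic a b c d))
    · have hcard : 11 ≤ Nat.card (Quot (pmRelCubic a b c d)) := by
        by_contra h'; exact hcon ⟨hfin, by omega⟩
      have e := Finite.equivFin (Quot (pmRelCubic a b c d))
      exact ⟨fun i => e.symm (Fin.castLE hcard i),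
        e.symm.injective.comp (Fin.castLE_injective hcard)⟩
    · rw [not_finite_iff_infinite] at hfin
      exact ⟨fun i => Infinite.natEmbedding _ i,
        (Infinite.natEmbedding _).injective.comp Fin.val_injective⟩
  obtain ⟨g, hg⟩ := hemb
  have hout : ∀ i, ∃ p : CubicThueSol a b c d, Quot.mk _ p = g i := fun i => Quot.exists_rep _
  choose t ht using hout
  have hval : ∀ p : ℤ × ℤ, (BinaryCubic.mk a b c d).val p.1 p.2 = cubicFormVal a b c d p :=
    fun p => rfl
  have hsol : ∀ i, (BinaryCubic.mk a b c d).val (t i).1.1 (t i).1.2 = 1 ∨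
      (BinaryCubic.mk a b c d).val (t i).1.1 (t i).1.2 = -1 := fun i => (t i).2
  have hinj : Function.Injective fun i => (t i : ℤ × ℤ) := by
    intro i j hij
    apply hg
    rw [← ht i, ← ht j, Subtype.ext hij]
  have := h (Finset.univ.image fun i => (t i : ℤ × ℤ)) ⟨?_, ?_⟩
  · rw [Finset.card_image_of_injective _ hinj] at this
    simp at this
  · intro p hp
    obtain ⟨i, -, rfl⟩ := Finset.mem_image.mp hp
    exact hsol i
  · intro p hp q hq hne h0
    obtain ⟨i, -, rfl⟩ := Finset.mem_image.mp hp
    obtain ⟨j, -, rfl⟩ := Finset.mem_image.mp hq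
    have := BinaryCubic.det_eq_zero_of_sol (hsol i) (hsol j) h0
    apply hne
    have hij : i = j := by
      apply hg
      rw [← ht i, ← ht j]
      exact Quot.sound this
    rw [hij]

theorem anisotropic_of_irreducible {a b c d : ℤ}
    (hirr : Irreducible
      (MvPolynomial.C (a : ℚ) * MvPolynomial.X 0 ^ 3 +
        MvPolynomial.C (b : ℚ) * MvPolynomial.X 0 ^ 2 * MvPolynomial.X 1 +
        MvPolynomial.C (c : ℚ) * MvPolynomial.X 0 * MvPolynomial.X 1 ^ 2 +
        MvPolynomial.C (d : ℚ) * MvPolynomial.X 1 ^ 3 : MvPolynomial (Fin 2) ℚ)) :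
    (BinaryCubic.mk a b c d).Anisotropic := by
  intro x y hxy
  simp only [BinaryCubic.val] at hxy
  by_contra hne
  have hunit : ∀ (p : MvPolynomial (Fin 2) ℚ) (v : Fin 2 → ℚ), MvPolynomial.eval v p = 0 →
      ¬ IsUnit p := fun p v h0 hp => by
    have := hp.map (MvPolynomial.eval v)
    rw [h0] at this
    simp at this
  by_cases hy : y = 0
  · subst hy
    have hx : x ≠ 0 := fun h => hne ⟨h, rfl⟩
    have ha : a = 0 := by
      have : a * x ^ 3 = 0 := by linarith
      exact (mul_eq_zero.mp this).resolve_right (pow_ne_zero _ hx)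
    have := hirr.isUnit_or_isUnit (a := MvPolynomial.X 1)
      (b := MvPolynomial.C (b : ℚ) * MvPolynomial.X 0 ^ 2 +
        MvPolynomial.C (c : ℚ) * MvPolynomial.X 0 * MvPolynomial.X 1 +
        MvPolynomial.C (d : ℚ) * MvPolynomial.X 1 ^ 2) (by rw [ha]; simp; ring)
    rcases this with h | h
    · exact hunit _ (fun _ => 0) (by simp) h
    · exact hunit _ (fun _ => 0) (by simp) h
  · have hy' : (y : ℚ) ≠ 0 := by exact_mod_cast hy
    set t : ℚ := x / y with ht
    have hroot : (d : ℚ) = -(a * t ^ 3 + b * t ^ 2 + c * t) := by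
      have : (a * x ^ 3 + b * x ^ 2 * y + c * x * y ^ 2 + d * y ^ 3 : ℚ) = 0 := by
        exact_mod_cast hxy
      rw [ht]
      field_simp
      linear_combination this
    have := hirr.isUnit_or_isUnit
      (a := MvPolynomial.X 0 - MvPolynomial.C t * MvPolynomial.X 1)
      (b := MvPolynomial.C (a : ℚ) * MvPolynomial.X 0 ^ 2 +
        MvPolynomial.C (b + a * t) * MvPolynomial.X 0 * MvPolynomial.X 1 +
        MvPolynomial.C (c + b * t + a * t ^ 2) * MvPolynomial.X 1 ^ 2) (by
          rw [hroot]
          simp only [map_add, map_mul, map_neg, map_pow]; ring)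
    rcases this with h | h
    · exact hunit _ (fun i => if i = 0 then t else 1) (by simp) h
    · exact hunit _ (fun _ => 0) (by simp) h

section

open Finset

/-- Homogeneous diagonal Padé polynomials for the binomial function with exponent `ν`. -/
def padeA {K : Type*} [Field K] (ν X W : K) : ℕ → K
  | 0 => 1
  | 1 => 2 * X - (1 + ν) * W
  | n + 2 => ((2 * n + 3) * (2 * X - W) * padeA ν X W (n + 1) -
      ((n + 1) ^ 2 - ν ^ 2) / (n + 1) * W ^ 2 * padeA ν X W n) / (n + 2)

/-- The coefficient of `X^k W^j` in the Padé polynomial of degree `j + k`. -/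
noncomputable def padeCoeff {K : Type*} [Field K] (ν : K) (j k : ℕ) : K :=
  (-1) ^ j * (∏ i ∈ range j, ((j + k : ℕ) + ν - i)) * ((j + 2 * k).factorial : K) /
    (j.factorial * (j + k).factorial * k.factorial)

section explicit

variable {K : Type*} [Field K] [CharZero K]

theorem prod_shift (x : K) (j : ℕ) :
    ∏ i ∈ range (j + 1), (x - i) = x * ∏ i ∈ range j, (x - 1 - i) := by
  rw [prod_range_succ', mul_comm]
  congr 1
  · simp
  · apply prod_congr rfl; intros; push_cast; ring

theorem padeCoeff_zero_succ (ν : K) (k : ℕ) :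
    (k + 1) * padeCoeff ν 0 (k + 1) = (2 * k + 1) * (2 * padeCoeff ν 0 k) := by
  have h1 : ((k.factorial : ℕ) : K) ≠ 0 := by exact_mod_cast k.factorial_ne_zero
  have h2 : (k + 1 : K) ≠ 0 := by exact_mod_cast k.succ_ne_zero
  simp only [padeCoeff, range_zero, prod_empty, pow_zero, Nat.zero_add, mul_add, mul_one,
    Nat.factorial_succ, Nat.factorial_zero]
  push_cast
  field_simp
  ring

theorem padeCoeff_one_succ (ν : K) (k : ℕ) :
    (k + 2) * padeCoeff ν 1 (k + 1) =
      (2 * k + 3) * (2 * padeCoeff ν 1 k - padeCoeff ν 0 (k + 1)) := by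
  have h1 : ((k.factorial : ℕ) : K) ≠ 0 := by exact_mod_cast k.factorial_ne_zero
  have h2 : (k + 1 : K) ≠ 0 := by exact_mod_cast k.succ_ne_zero
  have h3 : (k + 1 + 1 : K) ≠ 0 := by exact_mod_cast (k + 1).succ_ne_zero
  have e1 : 1 + 2 * (k + 1) = 2 * k + 1 + 1 + 1 := by ring
  have e2 : 1 + (k + 1) = k + 1 + 1 := by ring
  have e3 : 1 + 2 * k = 2 * k + 1 := by ring
  have e4 : 1 + k = k + 1 := by ring
  have e5 : 0 + 2 * (k + 1) = 2 * k + 1 + 1 := by ring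
  simp only [padeCoeff, e1, e2, e3, e4, e5, range_zero, prod_empty, range_one, prod_singleton,
    pow_zero, pow_one, Nat.zero_add, Nat.factorial_succ, Nat.factorial_zero]
  push_cast
  field_simp
  ring

theorem padeCoeff_add_two_zero (ν : K) (j : ℕ) :
    (j + 2) * padeCoeff ν (j + 2) 0 = (2 * j + 3) * (-padeCoeff ν (j + 1) 0) -
      ((j + 1) ^ 2 - ν ^ 2) / (j + 1) * padeCoeff ν j 0 := by
  have h1 : ((j.factorial : ℕ) : K) ≠ 0 := by exact_mod_cast j.factorial_ne_zero
  have h2 : (j + 1 : K) ≠ 0 := by exact_mod_cast j.succ_ne_zero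
  have h3 : (j + 1 + 1 : K) ≠ 0 := by exact_mod_cast (j + 1).succ_ne_zero
  have e1 : ∏ i ∈ range (j + 2), (((j + 2 + 0 : ℕ) : K) + ν - i) =
      (j + 2 + ν) * ((j + 1 + ν) * ∏ i ∈ range j, (((j + 0 : ℕ) : K) + ν - i)) := by
    rw [prod_shift, prod_shift]; push_cast
    congr 2
    · ring
    · ring
    · apply prod_congr rfl; intros; ring
  have e2 : ∏ i ∈ range (j + 1), (((j + 1 + 0 : ℕ) : K) + ν - i) =
      (j + 1 + ν) * ∏ i ∈ range j, (((j + 0 : ℕ) : K) + ν - i) := by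
    rw [prod_shift]; push_cast
    congr 1
    · ring
    · apply prod_congr rfl; intros; ring
  simp only [padeCoeff, e1, e2]
  set T := ∏ i ∈ range j, (((j + 0 : ℕ) : K) + ν - i)
  simp only [mul_zero, add_zero, Nat.factorial_succ, Nat.factorial_zero]
  push_cast
  field_simp
  ring

theorem padeCoeff_add_two_succ (ν : K) (j k : ℕ) :
    (j + k + 3) * padeCoeff ν (j + 2) (k + 1) =
      (2 * (j + k) + 5) * (2 * padeCoeff ν (j + 2) k - padeCoeff ν (j + 1) (k + 1)) -
      ((j + k + 2) ^ 2 - ν ^ 2) / (j + k + 2) * padeCoeff ν j (k + 1) := by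
  have h1 : ((j.factorial : ℕ) : K) ≠ 0 := by exact_mod_cast j.factorial_ne_zero
  have h2 : (j + 1 : K) ≠ 0 := by exact_mod_cast j.succ_ne_zero
  have h3 : (j + 1 + 1 : K) ≠ 0 := by exact_mod_cast (j + 1).succ_ne_zero
  have h4 : ((k.factorial : ℕ) : K) ≠ 0 := by exact_mod_cast k.factorial_ne_zero
  have h5 : (k + 1 : K) ≠ 0 := by exact_mod_cast k.succ_ne_zero
  have h6 : (((j + k).factorial : ℕ) : K) ≠ 0 := by exact_mod_cast (j + k).factorial_ne_zero
  have h7 : (j + k + 1 : K) ≠ 0 := by exact_mod_cast (j + k).succ_ne_zero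
  have h8 : (j + k + 1 + 1 : K) ≠ 0 := by exact_mod_cast (j + k + 1).succ_ne_zero
  have h9 : (j + k + 1 + 1 + 1 : K) ≠ 0 := by exact_mod_cast (j + k + 2).succ_ne_zero
  have h8' : (j + k + 2 : K) ≠ 0 := by convert h8 using 1; ring
  have h9' : (j + k + 3 : K) ≠ 0 := by convert h9 using 1; ring
  have e1 : ∏ i ∈ range (j + 2), (((j + 2 + (k + 1) : ℕ) : K) + ν - i) =
      (j + k + 3 + ν) * ((j + k + 2 + ν) *
        ∏ i ∈ range j, (((j + (k + 1) : ℕ) : K) + ν - i)) := by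
    rw [prod_shift, prod_shift]; push_cast
    congr 2
    · ring
    · ring
    · apply prod_congr rfl; intros; ring
  have e2 : ∏ i ∈ range (j + 1), (((j + 1 + (k + 1) : ℕ) : K) + ν - i) =
      (j + k + 2 + ν) * ∏ i ∈ range j, (((j + (k + 1) : ℕ) : K) + ν - i) := by
    rw [prod_shift]; push_cast
    congr 1
    · ring
    · apply prod_congr rfl; intros; ring
  have e3 : ∏ i ∈ range (j + 2), (((j + 2 + k : ℕ) : K) + ν - i) =
      (j + k + 2 + ν) * ((∏ i ∈ range j, (((j + (k + 1) : ℕ) : K) + ν - i)) *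
        (k + 1 + ν)) := by
    rw [prod_shift, prod_range_succ]; push_cast
    congr 2
    · ring
    · apply prod_congr rfl; intros; ring
    · ring
  simp only [padeCoeff, e1, e2, e3]
  set T := ∏ i ∈ range j, (((j + (k + 1) : ℕ) : K) + ν - i)
  have f1 : j + 2 + 2 * (k + 1) = j + 2 * k + 1 + 1 + 1 + 1 := by ring
  have f2 : j + 2 + (k + 1) = j + k + 1 + 1 + 1 := by ring
  have f3 : j + 2 + 2 * k = j + 2 * k + 1 + 1 := by ring
  have f4 : j + 2 + k = j + k + 1 + 1 := by ring
  have f5 : j + 1 + 2 * (k + 1) = j + 2 * k + 1 + 1 + 1 := by ring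
  have f6 : j + 1 + (k + 1) = j + k + 1 + 1 := by ring
  have f7 : j + 2 * (k + 1) = j + 2 * k + 1 + 1 := by ring
  have f8 : j + (k + 1) = j + k + 1 := by ring
  have f9 : j + 2 = j + 1 + 1 := by ring
  simp only [f1, f2, f3, f4, f5, f6, f7, f8, Nat.factorial_succ, f9]
  push_cast
  have r1 : (j + k + 1 + 1 : K) = j + k + 2 := by ring
  have r2 : (j + k + 2 + 1 : K) = j + k + 3 := by ring
  simp only [r1, r2]
  field_simp
  ring

/-- Explicit form of the Padé polynomials. -/
theorem padeA_eq_sum (ν X W : K) (n : ℕ) :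
    padeA ν X W n = ∑ p ∈ antidiagonal n, padeCoeff ν p.1 p.2 * X ^ p.2 * W ^ p.1 := by
  induction n using Nat.twoStepInduction with
  | zero => simp [padeA, padeCoeff]
  | one =>
    simp [padeA, padeCoeff, Finset.Nat.antidiagonal_succ]
    ring
  | more n ih1 ih2 =>
    rw [padeA, ih1, ih2]
    have hn1 : (n + 1 : K) ≠ 0 := by exact_mod_cast n.succ_ne_zero
    have hn2 : (n + 2 : K) ≠ 0 := by exact_mod_cast (n + 1).succ_ne_zero
    rw [div_eq_iff hn2]
    set g : ℕ × ℕ → K := fun p => padeCoeff ν p.1 p.2 * X ^ p.2 * W ^ p.1 with hg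
    let u : ℕ × ℕ → K := fun p => match p with
      | (_, 0) => 0
      | (j, k + 1) => X * g (j, k)
    let v : ℕ × ℕ → K := fun p => match p with
      | (0, _) => 0
      | (j + 1, k) => W * g (j, k)
    let w : ℕ × ℕ → K := fun p => match p with
      | (0, _) => 0
      | (1, _) => 0
      | (j + 2, k) => W ^ 2 * g (j, k)
    have hu : X * ∑ p ∈ antidiagonal (n + 1), g p = ∑ p ∈ antidiagonal (n + 2), u p := by
      rw [Finset.Nat.sum_antidiagonal_succ' (n := n + 1) (f := u), mul_sum]
      simp [u]
    have hv : W * ∑ p ∈ antidiagonal (n + 1), g p = ∑ p ∈ antidiagonal (n + 2), v p := by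
      rw [Finset.Nat.sum_antidiagonal_succ (n := n + 1) (f := v), mul_sum]
      simp [v]
    have hw : W ^ 2 * ∑ p ∈ antidiagonal n, g p = ∑ p ∈ antidiagonal (n + 2), w p := by
      rw [Finset.Nat.sum_antidiagonal_succ (n := n + 1) (f := w), Finset.Nat.sum_antidiagonal_succ,
        mul_sum]
      simp [w]
    have key : ∀ p ∈ antidiagonal (n + 2), g p * (n + 2) = (2 * n + 3) * (2 * u p - v p) -
        ((n + 1) ^ 2 - ν ^ 2) / (n + 1) * w p := by
      rintro ⟨j, k⟩ hp
      rw [HasAntidiagonal.mem_antidiagonal] at hp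
      simp only at hp
      match j, k with
      | 0, 0 => omega
      | 0, k + 1 =>
        obtain rfl : k = n + 1 := by omega
        have := padeCoeff_zero_succ ν (n + 1)
        simp only [hg, u, v, w, pow_zero]
        push_cast at this ⊢
        linear_combination (X ^ (n + 1 + 1)) * this
      | 1, 0 => omega
      | 1, k + 1 =>
        obtain rfl : k = n := by omega
        have := padeCoeff_one_succ ν k
        simp only [hg, u, v, w, pow_zero, pow_one]
        linear_combination (X ^ (k + 1) * W) * this
      | j + 2, 0 =>
        obtain rfl : j = n := by omega
        have := padeCoeff_add_two_zero ν j
        simp only [hg, u, v, w, pow_zero]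
        linear_combination (W ^ (j + 2)) * this
      | j + 2, k + 1 =>
        obtain rfl : n = j + k + 1 := by omega
        have := padeCoeff_add_two_succ ν j k
        simp only [hg, u, v, w]
        have e1 : ((j + k + 1 : ℕ) : K) + 1 = j + k + 2 := by push_cast; ring
        rw [e1]
        push_cast
        linear_combination (X ^ (k + 1) * W ^ (j + 2)) * this
    have := sum_congr rfl key
    rw [← sum_mul, sum_sub_distrib, ← mul_sum, ← mul_sum, sum_sub_distrib, ← mul_sum, ← hu, ← hv,
      ← hw] at this
    rw [this]
    ring

end explicit

theorem pow_mul_prod_range {M : Type*} [CommMonoid M] (c : M) (f : ℕ → M) (j : ℕ) :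
    c ^ j * ∏ i ∈ range j, f i = ∏ i ∈ range j, c * f i := by
  rw [prod_mul_distrib, prod_const, card_range]

theorem factorial_dvd_three_pow_mul_prod (m : ℤ) (j : ℕ) :
    ((j.factorial : ℕ) : ℤ) ∣ 3 ^ (j / 2) * ∏ i ∈ range j, (m - 3 * i) := by
  have : Fact (Nat.Prime 3) := ⟨Nat.prime_three⟩
  obtain ⟨v, N, hN, hj⟩ := Nat.exists_eq_pow_mul_and_not_dvd j.factorial_ne_zero 3 (by norm_num)
  have hv : v ≤ j / 2 := by
    have h1 := sub_one_mul_padicValNat_factorial (p := 3) j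
    have h2 : padicValNat 3 j.factorial = v := by
      rw [hj, padicValNat.mul (by positivity) (by rintro rfl; simp at hN), padicValNat.prime_pow,
        padicValNat.eq_zero_of_not_dvd hN]; simp
    rw [h2] at h1
    omega
  rw [hj]
  push_cast
  apply mul_dvd_mul (pow_dvd_pow _ hv)
  have hcop : IsCoprime (3 : ℤ) N := by
    rw [Int.isCoprime_iff_gcd_eq_one]
    have : Nat.Coprime 3 N := (Nat.Prime.coprime_iff_not_dvd Nat.prime_three).mpr hN
    exact_mod_cast this
  obtain ⟨r, q, hrq⟩ := hcop
  have h1 : (N : ℤ) ∣ ∏ i ∈ range j, (r * m - i) := by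
    have h2 : (N : ℤ) ∣ j.factorial := by rw [hj]; push_cast; exact dvd_mul_left _ _
    refine h2.trans ?_
    have h3 := Nat.factorial_coe_dvd_prod j (-(r * m))
    have h4 : ∏ i ∈ range j, (r * m - i) = (-1) ^ j * ∏ i ∈ range j, (-(r * m) + i) := by
      rw [pow_mul_prod_range]
      apply prod_congr rfl; intros; ring
    rw [h4]
    exact Dvd.dvd.mul_left h3 _
  have h2 : (N : ℤ) ∣ r ^ j * ∏ i ∈ range j, (m - 3 * i) := by
    have h3 : r ^ j * ∏ i ∈ range j, (m - 3 * i) = ∏ i ∈ range j, (r * m - r * 3 * i) := by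
      conv_lhs => rw [pow_mul_prod_range]
      apply prod_congr rfl; intros; ring
    rw [h3]
    refine (Int.ModEq.dvd ?_).trans (dvd_of_eq (sub_zero _))
    refine (Int.modEq_zero_iff_dvd.mpr h1).symm.trans ?_
    refine Int.ModEq.prod fun i _ => ?_
    refine (Int.modEq_iff_dvd.mpr ⟨q * i, ?_⟩)
    linear_combination (-(i : ℤ)) * hrq
  have hcr : IsCoprime (N : ℤ) (r ^ j) := IsCoprime.pow_right ⟨q, 3, by linarith⟩
  exact hcr.dvd_of_dvd_mul_left h2

/-- The order `ℤ + ℤω` for a quadratic integer `ω`. -/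
def quadOrder (ω : ℂ) (T N : ℤ) (h : ω ^ 2 = T * ω - N) : Subring ℂ where
  carrier := {z | ∃ a q : ℤ, z = a + q * ω}
  mul_mem' := by
    rintro _ _ ⟨a, q, rfl⟩ ⟨a', q', rfl⟩
    refine ⟨a * a' - q * q' * N, a * q' + a' * q + q * q' * T, ?_⟩
    push_cast
    linear_combination (q * q' : ℂ) * h
  one_mem' := ⟨1, 0, by simp⟩
  add_mem' := by
    rintro _ _ ⟨a, q, rfl⟩ ⟨a', q', rfl⟩
    exact ⟨a + a', q + q', by push_cast; ring⟩
  zero_mem' := ⟨0, 0, by simp⟩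
  neg_mem' := by
    rintro _ ⟨a, q, rfl⟩
    exact ⟨-a, -q, by push_cast; ring⟩

theorem mem_quadOrder {ω : ℂ} {T N : ℤ} {h : ω ^ 2 = T * ω - N} {z : ℂ} :
    z ∈ quadOrder ω T N h ↔ ∃ a q : ℤ, z = a + q * ω := Iff.rfl

theorem padeA_mem {R : Subring ℂ} {s X ν : ℂ} {D t e : ℤ} (hs : s ^ 2 = -3 * D)
    (hsR : s ∈ R) (hX : X ∈ R) (hν : 3 * ν = t) (n : ℕ) :
    padeA ν X (3 * e * s) n ∈ R := by
  rw [padeA_eq_sum]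
  refine R.sum_mem fun p _ => ?_
  obtain ⟨j, k⟩ := p
  simp only
  have hsj : s ^ j / 3 ^ (j / 2) ∈ R := by
    have h1 : s ^ j / 3 ^ (j / 2) = (((-D) ^ (j / 2) : ℤ) : ℂ) * s ^ (j % 2) := by
      conv_lhs => rw [← Nat.div_add_mod j 2, pow_add, pow_mul, hs]
      have h2 : (2 * (j / 2) + j % 2) / 2 = j / 2 := by omega
      rw [h2, mul_pow]
      push_cast
      have : ((-3 : ℂ)) ^ (j / 2) = (-1) ^ (j / 2) * 3 ^ (j / 2) := by rw [← mul_pow]; norm_num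
      rw [this, neg_pow (D : ℂ)]
      field_simp
    rw [h1]
    exact R.mul_mem (intCast_mem R _) (R.pow_mem hsR _)
  obtain ⟨M, hM⟩ := factorial_dvd_three_pow_mul_prod (3 * (j + k) + t) j
  have hprod : (3 : ℂ) ^ (j / 2) * (3 ^ j * ∏ i ∈ range j, (((j + k : ℕ) : ℂ) + ν - i)) =
      j.factorial * M := by
    have h1 : (3 : ℂ) ^ j * ∏ i ∈ range j, (((j + k : ℕ) : ℂ) + ν - i) =
        ((∏ i ∈ range j, (3 * (j + k) + t - 3 * i) : ℤ) : ℂ) := by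
      conv_lhs => rw [pow_mul_prod_range]
      push_cast
      apply prod_congr rfl; intros; rw [← hν]; ring
    rw [h1]
    exact_mod_cast hM
  have hchoose : ((j + 2 * k).choose k : ℂ) =
      (j + 2 * k).factorial / ((j + k).factorial * k.factorial) := by
    rw [Nat.cast_choose ℂ (by omega), show j + 2 * k - k = j + k by omega]
    ring
  have h3 : (3 : ℂ) ^ (j / 2) ≠ 0 := pow_ne_zero _ (by norm_num)
  have hj0 : ((j.factorial : ℕ) : ℂ) ≠ 0 := by exact_mod_cast j.factorial_ne_zero
  have hk0 : ((k.factorial : ℕ) : ℂ) ≠ 0 := by exact_mod_cast k.factorial_ne_zero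
  have hjk0 : (((j + k).factorial : ℕ) : ℂ) ≠ 0 := by exact_mod_cast (j + k).factorial_ne_zero
  have key : padeCoeff ν j k * X ^ k * (3 * e * s) ^ j =
      (((-1) ^ j * (j + 2 * k).choose k * M * e ^ j : ℤ) : ℂ) * (X ^ k * (s ^ j / 3 ^ (j / 2))) := by
    have h4 : 3 ^ j * ∏ i ∈ range j, (((j + k : ℕ) : ℂ) + ν - i) =
        j.factorial * M / 3 ^ (j / 2) := by
      rw [eq_div_iff h3, ← hprod]; ring
    have h5 : padeCoeff ν j k * X ^ k * (3 * e * s) ^ j = (-1) ^ j *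
        (3 ^ j * ∏ i ∈ range j, (((j + k : ℕ) : ℂ) + ν - i)) * ((j + 2 * k).factorial : ℂ) /
        (j.factorial * (j + k).factorial * k.factorial) * X ^ k * e ^ j * s ^ j := by
      rw [padeCoeff]; ring
    rw [h5, h4]
    push_cast
    rw [hchoose]
    field_simp
  rw [key]
  exact R.mul_mem (intCast_mem R _) (R.mul_mem (R.pow_mem hX _) hsj)

end

open Complex in
/-- The Padé polynomials on the unit circle, twisted by `e^{iνθ}`. -/
noncomputable def padeE (ν : ℝ) (n : ℕ) (θ : ℝ) : ℂ :=
  exp (ν * θ * I) * padeA (ν : ℂ) (exp (θ * I)) (2 * Real.sin θ * I) n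

/-- Leading coefficients of the Padé remainders. -/
noncomputable def padeK (ν : ℝ) : ℕ → ℝ
  | 0 => 1
  | n + 1 => padeK ν n * (2 * ((n + 1) ^ 2 - ν ^ 2) / ((n + 1) * (2 * n + 3)))

/-- Real part of the Padé polynomials on the unit circle. -/
noncomputable def padeU (ν : ℝ) (θ : ℝ) : ℕ → ℝ
  | 0 => 1
  | 1 => 2 * Real.cos θ
  | n + 2 => ((2 * n + 3) * (2 * Real.cos θ) * padeU ν θ (n + 1) +
      4 * ((n + 1) ^ 2 - ν ^ 2) / (n + 1) * Real.sin θ ^ 2 * padeU ν θ n) / (n + 2)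

/-- Imaginary part, divided by `-ν`, of the Padé polynomials on the unit circle. -/
noncomputable def padeV (ν : ℝ) (θ : ℝ) : ℕ → ℝ
  | 0 => 0
  | 1 => 2 * Real.sin θ
  | n + 2 => ((2 * n + 3) * (2 * Real.cos θ) * padeV ν θ (n + 1) +
      4 * ((n + 1) ^ 2 - ν ^ 2) / (n + 1) * Real.sin θ ^ 2 * padeV ν θ n) / (n + 2)

section

variable {ν : ℝ}

theorem two_exp_sub (θ : ℝ) :
    2 * Complex.exp (θ * Complex.I) - 2 * Real.sin θ * Complex.I = 2 * Real.cos θ := by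
  rw [Complex.exp_mul_I]; push_cast; ring

theorem padeE_zero (θ : ℝ) : padeE ν 0 θ = Complex.exp (ν * θ * Complex.I) := by
  simp [padeE, padeA]

theorem padeE_one (θ : ℝ) : padeE ν 1 θ =
    Complex.exp (ν * θ * Complex.I) * (2 * Real.cos θ - 2 * ν * Real.sin θ * Complex.I) := by
  simp only [padeE, padeA]
  rw [← two_exp_sub]; ring

theorem padeE_add_two (n : ℕ) (θ : ℝ) : padeE ν (n + 2) θ =
    ((2 * n + 3) * (2 * Real.cos θ) * padeE ν (n + 1) θ +
      4 * ((n + 1) ^ 2 - ν ^ 2) / (n + 1) * Real.sin θ ^ 2 * padeE ν n θ) / (n + 2) := by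
  simp only [padeE, padeA]
  have : (2 * (Real.sin θ : ℂ) * Complex.I) ^ 2 = -4 * Real.sin θ ^ 2 := by
    rw [mul_pow, Complex.I_sq]; ring
  rw [two_exp_sub, this]; ring

theorem padeE_eq (n : ℕ) (θ : ℝ) : padeE ν n θ =
    Complex.exp (ν * θ * Complex.I) * (padeU ν θ n - ν * padeV ν θ n * Complex.I) := by
  induction n using Nat.twoStepInduction with
  | zero => simp [padeE_zero, padeU, padeV]
  | one => rw [padeE_one]; simp only [padeU, padeV]; push_cast; ring
  | more n ih1 ih2 =>
    rw [padeE_add_two, ih1, ih2]; simp only [padeU, padeV]; push_cast; ring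

theorem padeE_re (n : ℕ) (θ : ℝ) : (padeE ν n θ).re =
    Real.cos (ν * θ) * padeU ν θ n + Real.sin (ν * θ) * ν * padeV ν θ n := by
  rw [padeE_eq, ← Complex.ofReal_mul, Complex.mul_re, Complex.exp_ofReal_mul_I_re,
    Complex.exp_ofReal_mul_I_im]
  simp; ring

theorem padeU_nonneg (hν : ν ^ 2 ≤ 1) {θ : ℝ} (hc : 0 ≤ Real.cos θ) (n : ℕ) :
    0 ≤ padeU ν θ n := by
  induction n using Nat.twoStepInduction with
  | zero => simp [padeU]
  | one => simp only [padeU]; positivity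
  | more n ih1 ih2 =>
    have : 0 ≤ ((n : ℝ) + 1) ^ 2 - ν ^ 2 := by nlinarith [(n.cast_nonneg : (0 : ℝ) ≤ n)]
    simp only [padeU]; positivity

theorem padeV_nonneg (hν : ν ^ 2 ≤ 1) {θ : ℝ} (hc : 0 ≤ Real.cos θ) (hs : 0 ≤ Real.sin θ)
    (n : ℕ) : 0 ≤ padeV ν θ n := by
  induction n using Nat.twoStepInduction with
  | zero => simp [padeV]
  | one => simp only [padeV]; positivity
  | more n ih1 ih2 =>
    have : 0 ≤ ((n : ℝ) + 1) ^ 2 - ν ^ 2 := by nlinarith [(n.cast_nonneg : (0 : ℝ) ≤ n)]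
    simp only [padeV]; positivity

theorem centralBinom_succ_real (n : ℕ) :
    ((n + 1).centralBinom : ℝ) = 2 * (2 * n + 1) * n.centralBinom / (n + 1) := by
  have := Nat.succ_mul_centralBinom_succ n
  rw [eq_div_iff (by positivity)]
  have h : (((n + 1) * (n + 1).centralBinom : ℕ) : ℝ) = ((2 * (2 * n + 1) * n.centralBinom : ℕ) : ℝ) := by
    exact_mod_cast this
  push_cast at h
  linarith

theorem le_padeU (hν : ν ^ 2 ≤ 1) {θ : ℝ} (hc : 0 ≤ Real.cos θ) (n : ℕ) :
    n.centralBinom * Real.cos θ ^ n ≤ padeU ν θ n := by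
  induction n using Nat.twoStepInduction with
  | zero => simp [padeU]
  | one => simp [padeU, Nat.centralBinom, Nat.choose]
  | more n ih1 ih2 =>
    have h1 : 0 ≤ ((n : ℝ) + 1) ^ 2 - ν ^ 2 := by nlinarith [(n.cast_nonneg : (0 : ℝ) ≤ n)]
    have h2 := padeU_nonneg hν hc n
    simp only [padeU]
    rw [centralBinom_succ_real, le_div_iff₀ (by positivity)]
    have h3 : 0 ≤ 4 * (((n : ℝ) + 1) ^ 2 - ν ^ 2) / (n + 1) * Real.sin θ ^ 2 * padeU ν θ n := by
      positivity
    have h4 := mul_le_mul_of_nonneg_left ih2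
      (show (0 : ℝ) ≤ (2 * n + 3) * (2 * Real.cos θ) by positivity)
    have h5 : 2 * (2 * ((n + 1 : ℕ) : ℝ) + 1) * ((n + 1).centralBinom : ℝ) / ((n + 1 : ℕ) + 1) *
        Real.cos θ ^ (n + 2) * (n + 2) =
        (2 * n + 3) * (2 * Real.cos θ) * ((n + 1).centralBinom * Real.cos θ ^ (n + 1)) := by
      push_cast
      have : (n : ℝ) + 1 + 1 ≠ 0 := by positivity
      field_simp
      ring
    rw [h5]
    linarith

theorem le_padeE_re (hν : ν ^ 2 ≤ 1) {θ : ℝ} (h0 : 0 ≤ θ) (h1 : θ ≤ Real.pi / 2) (n : ℕ) :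
    n.centralBinom * Real.cos θ ^ (n + 1) ≤ (padeE ν n θ).re := by
  have hpi := Real.pi_pos
  have habs : |ν| ≤ 1 := by rw [← sq_le_one_iff_abs_le_one]; exact hν
  have hc : 0 ≤ Real.cos θ := Real.cos_nonneg_of_neg_pi_div_two_le_of_le (by linarith) h1
  have hs : 0 ≤ Real.sin θ := Real.sin_nonneg_of_nonneg_of_le_pi h0 (by linarith)
  rw [padeE_re]
  have h2 : 0 ≤ Real.sin (ν * θ) * ν := by
    rcases le_total 0 ν with h | h
    · exact mul_nonneg (Real.sin_nonneg_of_nonneg_of_le_pi (by positivity)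
        (by nlinarith [le_abs_self ν])) h
    · apply mul_nonneg_of_nonpos_of_nonpos _ h
      apply Real.sin_nonpos_of_nonpos_of_neg_pi_le
      · exact mul_nonpos_of_nonpos_of_nonneg h h0
      · nlinarith [neg_abs_le ν]
  have h3 : Real.cos θ ≤ Real.cos (ν * θ) := by
    rw [← Real.cos_abs (ν * θ), abs_mul, abs_of_nonneg h0]
    apply Real.cos_le_cos_of_nonneg_of_le_pi (by positivity) (by linarith)
    nlinarith [abs_nonneg ν]
  have h4 := le_padeU hν hc n
  have h5 := padeV_nonneg hν hc hs n
  have h6 : n.centralBinom * Real.cos θ ^ (n + 1) ≤ Real.cos (ν * θ) * padeU ν θ n := by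
    calc n.centralBinom * Real.cos θ ^ (n + 1) = Real.cos θ * (n.centralBinom * Real.cos θ ^ n) := by
          ring
      _ ≤ _ := mul_le_mul h3 h4 (by positivity) (hc.trans h3)
  nlinarith [mul_nonneg h2 h5]

theorem norm_padeE_le (hν : ν ^ 2 ≤ 1) {θ : ℝ} (hc : 0 ≤ Real.cos θ) (n : ℕ) :
    ‖padeE ν n θ‖ ≤ n.centralBinom := by
  have hexp : ‖Complex.exp (ν * θ * Complex.I)‖ = 1 := by
    rw [← Complex.ofReal_mul, Complex.norm_exp_ofReal_mul_I]
  have hcs := Real.sin_sq_add_cos_sq θ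
  have hc1 := Real.cos_le_one θ
  suffices h : ‖padeE ν n θ‖ ≤ n.centralBinom ∧ ‖padeE ν (n + 1) θ‖ ≤ (n + 1).centralBinom from h.1
  induction n with
  | zero =>
    constructor
    · rw [padeE_zero, hexp]; simp
    · rw [zero_add, padeE_one, norm_mul, hexp, one_mul]
      have : ((Nat.centralBinom 1 : ℕ) : ℝ) = 2 := by simp [Nat.centralBinom, Nat.choose]
      rw [this, ← abs_of_pos (show (0 : ℝ) < 2 by norm_num), ← abs_norm, ← sq_le_sq,
        ← Complex.normSq_eq_norm_sq, Complex.normSq_apply]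
      simp only [Complex.sub_re, Complex.mul_re, Complex.re_ofNat, Complex.ofReal_re,
        Complex.im_ofNat, Complex.ofReal_im, Complex.I_re, Complex.I_im, Complex.sub_im,
        Complex.mul_im]
      nlinarith [mul_nonneg (sub_nonneg.mpr hν) (sq_nonneg (Real.sin θ))]
  | succ n ih =>
    refine ⟨ih.2, ?_⟩
    have h1 : 0 ≤ ((n : ℝ) + 1) ^ 2 - ν ^ 2 := by nlinarith [(n.cast_nonneg : (0 : ℝ) ≤ n)]
    have hn : (0 : ℝ) ≤ n := n.cast_nonneg
    rw [padeE_add_two, norm_div]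
    have hn2 : ‖((n : ℂ) + 2)‖ = n + 2 := by
      rw [← Complex.ofReal_natCast, ← Complex.ofReal_ofNat, ← Complex.ofReal_add,
        Complex.norm_real, Real.norm_of_nonneg (by positivity)]
    rw [hn2, div_le_iff₀ (by positivity)]
    have e1 : ((2 * n + 3) * (2 * Real.cos θ) : ℂ) = (((2 * n + 3) * (2 * Real.cos θ) : ℝ) : ℂ) := by
      push_cast; ring
    have e2 : (4 * ((n + 1) ^ 2 - ν ^ 2) / (n + 1) * Real.sin θ ^ 2 : ℂ) =
        ((4 * ((n + 1) ^ 2 - ν ^ 2) / (n + 1) * Real.sin θ ^ 2 : ℝ) : ℂ) := by push_cast; ring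
    refine (norm_add_le _ _).trans ?_
    rw [e1, e2, norm_mul, norm_mul, Complex.norm_real, Complex.norm_real,
      Real.norm_of_nonneg (by positivity), Real.norm_of_nonneg (by positivity)]
    have h3 := mul_le_mul_of_nonneg_left ih.2
      (show (0 : ℝ) ≤ (2 * n + 3) * (2 * Real.cos θ) by positivity)
    have h4 := mul_le_mul_of_nonneg_left ih.1
      (show (0 : ℝ) ≤ 4 * (((n : ℝ) + 1) ^ 2 - ν ^ 2) / (n + 1) * Real.sin θ ^ 2 by positivity)
    refine (add_le_add h3 h4).trans ?_
    rw [centralBinom_succ_real (n + 1), centralBinom_succ_real n]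
    set c : ℝ := ((n.centralBinom : ℕ) : ℝ)
    have hcpos : 0 ≤ c := by positivity
    push_cast
    have key : (2 * n + 3) * (2 * Real.cos θ) * (2 * (2 * n + 1)) +
        4 * (((n : ℝ) + 1) ^ 2 - ν ^ 2) * Real.sin θ ^ 2 ≤
        2 * (2 * (n + 1) + 1) * (2 * (2 * n + 1)) := by
      have hs2 : Real.sin θ ^ 2 ≤ 2 * (1 - Real.cos θ) := by nlinarith
      have : (((n : ℝ) + 1) ^ 2 - ν ^ 2) * Real.sin θ ^ 2 ≤
          (n + 1) ^ 2 * (2 * (1 - Real.cos θ)) := by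
        apply mul_le_mul _ hs2 (sq_nonneg _) (by positivity)
        nlinarith [sq_nonneg ν]
      nlinarith [mul_nonneg hn (sub_nonneg.mpr hc1), mul_nonneg (mul_nonneg hn hn) (sub_nonneg.mpr hc1)]
    have e3 : (2 * n + 3) * (2 * Real.cos θ) * (2 * (2 * n + 1) * c / (n + 1)) +
        4 * (((n : ℝ) + 1) ^ 2 - ν ^ 2) / (n + 1) * Real.sin θ ^ 2 * c =
        ((2 * n + 3) * (2 * Real.cos θ) * (2 * (2 * n + 1)) +
        4 * (((n : ℝ) + 1) ^ 2 - ν ^ 2) * Real.sin θ ^ 2) * (c / (n + 1)) := by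
      field_simp
    have e4 : 2 * (2 * ((n : ℝ) + 1) + 1) * (2 * (2 * n + 1) * c / (n + 1)) / (n + 1 + 1) * (n + 2) =
        2 * (2 * (n + 1) + 1) * (2 * (2 * n + 1)) * (c / (n + 1)) := by
      field_simp; ring
    rw [e3, e4]
    exact mul_le_mul_of_nonneg_right key (by positivity)


theorem padeE_im_zero (θ : ℝ) : (padeE ν 0 θ).im = Real.sin (ν * θ) := by
  rw [padeE_zero, ← Complex.ofReal_mul, Complex.exp_ofReal_mul_I_im]

theorem padeE_im_one (θ : ℝ) : (padeE ν 1 θ).im =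
    2 * (Real.cos θ * Real.sin (ν * θ) - Real.sin θ * (Real.cos (ν * θ) * ν)) := by
  rw [padeE_one, ← Complex.ofReal_mul, Complex.mul_im, Complex.exp_ofReal_mul_I_im,
    Complex.exp_ofReal_mul_I_re]
  simp only [Complex.sub_re, Complex.mul_re, Complex.re_ofNat, Complex.ofReal_re,
    Complex.im_ofNat, Complex.ofReal_im, Complex.I_re, Complex.I_im, Complex.sub_im,
    Complex.mul_im]
  ring

theorem padeE_im_add_two (n : ℕ) (θ : ℝ) : (padeE ν (n + 2) θ).im =
    ((2 * n + 3) * (2 * Real.cos θ) * (padeE ν (n + 1) θ).im +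
      4 * ((n + 1) ^ 2 - ν ^ 2) / (n + 1) * Real.sin θ ^ 2 * (padeE ν n θ).im) / (n + 2) := by
  have h : padeE ν (n + 2) θ =
      ((((2 * n + 3) * (2 * Real.cos θ) / (n + 2) : ℝ) : ℂ)) * padeE ν (n + 1) θ +
      (((4 * ((n + 1) ^ 2 - ν ^ 2) / (n + 1) * Real.sin θ ^ 2 / (n + 2) : ℝ) : ℂ)) *
        padeE ν n θ := by
    rw [padeE_add_two]; push_cast; ring
  rw [h, Complex.add_im, Complex.im_ofReal_mul, Complex.im_ofReal_mul]
  ring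

theorem hasDerivAt_padeE_im_zero (θ : ℝ) :
    HasDerivAt (fun θ => (padeE ν 0 θ).im) (Real.cos (ν * θ) * ν) θ := by
  simp only [padeE_im_zero]
  simpa using ((hasDerivAt_id θ).const_mul ν).sin

theorem hasDerivAt_padeE_im_succ (n : ℕ) (θ : ℝ) :
    HasDerivAt (fun θ => (padeE ν (n + 1) θ).im)
      (-(2 * ((n + 1) ^ 2 - ν ^ 2) / (n + 1)) * Real.sin θ * (padeE ν n θ).im) θ := by
  have hsin := Real.hasDerivAt_sin θ
  have hcos := Real.hasDerivAt_cos θ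
  have hsc := Real.sin_sq_add_cos_sq θ
  induction n using Nat.twoStepInduction with
  | zero =>
    simp only [zero_add, padeE_im_one, padeE_im_zero]
    have h1 : HasDerivAt (fun θ => Real.sin (ν * θ)) (Real.cos (ν * θ) * ν) θ := by
      simpa using ((hasDerivAt_id θ).const_mul ν).sin
    have h2 : HasDerivAt (fun θ => Real.cos (ν * θ)) (-Real.sin (ν * θ) * ν) θ := by
      simpa using ((hasDerivAt_id θ).const_mul ν).cos
    refine (((hcos.mul h1).sub (hsin.mul (h2.mul_const ν))).const_mul 2).congr_deriv ?_
    push_cast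
    ring
  | one =>
    have h0 := hasDerivAt_padeE_im_zero (ν := ν) θ
    have h1 : HasDerivAt (fun θ => (padeE ν 1 θ).im)
      (-(2 * (1 - ν ^ 2)) * Real.sin θ * (padeE ν 0 θ).im) θ := by
      simp only [padeE_im_one, padeE_im_zero]
      have h1 : HasDerivAt (fun θ => Real.sin (ν * θ)) (Real.cos (ν * θ) * ν) θ := by
        simpa using ((hasDerivAt_id θ).const_mul ν).sin
      have h2 : HasDerivAt (fun θ => Real.cos (ν * θ)) (-Real.sin (ν * θ) * ν) θ := by
        simpa using ((hasDerivAt_id θ).const_mul ν).cos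
      refine (((hcos.mul h1).sub (hsin.mul (h2.mul_const ν))).const_mul 2).congr_deriv ?_
      ring
    have hr := padeE_im_one (ν := ν) θ
    have e : (fun θ => (padeE ν (1 + 1) θ).im) = fun θ => ((2 * ((0 : ℕ) : ℝ) + 3) *
      (2 * Real.cos θ) * (padeE ν (0 + 1) θ).im +
      4 * ((((0 : ℕ) : ℝ) + 1) ^ 2 - ν ^ 2) / (((0 : ℕ) : ℝ) + 1) * Real.sin θ ^ 2 *
        (padeE ν 0 θ).im) / (((0 : ℕ) : ℝ) + 2) := by
      funext θ; exact padeE_im_add_two 0 θ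
    rw [e]
    refine ((((hcos.const_mul 2).const_mul _).mul h1).add
      (((hsin.pow 2).const_mul _).mul h0)).div_const _ |>.congr_deriv ?_
    rw [← padeE_im_zero] at hr
    simp only [Nat.cast_zero, Nat.cast_one, zero_add, mul_zero] at hr ⊢
    simp only [Pi.pow_apply]
    norm_num
    linear_combination ((1 - ν ^ 2) * Real.sin θ) * hr
  | more n ih1 ih2 =>
    have e : (fun θ => (padeE ν (n + 2 + 1) θ).im) = fun θ => ((2 * ((n + 1 : ℕ) : ℝ) + 3) *
      (2 * Real.cos θ) * (padeE ν (n + 1 + 1) θ).im +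
      4 * ((((n + 1 : ℕ) : ℝ) + 1) ^ 2 - ν ^ 2) / (((n + 1 : ℕ) : ℝ) + 1) * Real.sin θ ^ 2 *
        (padeE ν (n + 1) θ).im) / (((n + 1 : ℕ) : ℝ) + 2) := by
      funext θ; exact padeE_im_add_two (n + 1) θ
    rw [e]
    refine ((((hcos.const_mul 2).const_mul _).mul ih2).add
      (((hsin.pow 2).const_mul _).mul ih1)).div_const _ |>.congr_deriv ?_
    have hr := padeE_im_add_two (ν := ν) n θ
    rw [eq_div_iff (by positivity)] at hr
    simp only [Pi.pow_apply]
    push_cast at hr ⊢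
    have hn1 : (n : ℝ) + 1 ≠ 0 := by positivity
    have hn2 : (n : ℝ) + 1 + 1 ≠ 0 := by positivity
    have hn3 : (n : ℝ) + 1 + 2 ≠ 0 := by positivity
    have hn4 : (n : ℝ) + 2 ≠ 0 := by positivity
    have hn5 : (n : ℝ) + 3 ≠ 0 := by positivity
    rw [div_eq_iff hn3]
    rw [show n + 1 + 1 = n + 2 from rfl]
    have r1 : (n : ℝ) + 1 + 1 = n + 2 := by ring
    have r2 : (n : ℝ) + 2 + 1 = n + 3 := by ring
    have r3 : (n : ℝ) + 1 + 2 = n + 3 := by ring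
    simp only [r1, r2, r3]
    have hr' : 4 * ((n + 1) ^ 2 - ν ^ 2) / (n + 1) * Real.sin θ ^ 2 * (padeE ν n θ).im =
      (padeE ν (n + 2) θ).im * (n + 2) - (2 * n + 3) * (2 * Real.cos θ) * (padeE ν (n + 1) θ).im := by
      linarith
    have key : 4 * (((n : ℝ) + 2) ^ 2 - ν ^ 2) / (n + 2) * Real.sin θ ^ 2 *
        (-(2 * ((n + 1) ^ 2 - ν ^ 2) / (n + 1)) * Real.sin θ * (padeE ν n θ).im) =
        -(4 * ((n + 2) ^ 2 - ν ^ 2) / (n + 2) * Real.sin θ) / 2 *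
        ((padeE ν (n + 2) θ).im * (n + 2) -
          (2 * n + 3) * (2 * Real.cos θ) * (padeE ν (n + 1) θ).im) := by
      rw [← hr']; ring
    rw [key]
    field_simp
    ring

theorem padeK_pos (hν : ν ^ 2 < 1) (n : ℕ) : 0 < padeK ν n := by
  induction n with
  | zero => simp [padeK]
  | succ n ih =>
    have : 0 < ((n : ℝ) + 1) ^ 2 - ν ^ 2 := by nlinarith [(n.cast_nonneg : (0 : ℝ) ≤ n)]
    simp only [padeK]; positivity

/-- Normalised imaginary part of the Padé polynomials on the unit circle. -/
noncomputable def padeG (ν : ℝ) (n : ℕ) (θ : ℝ) : ℝ := (-1) ^ n * (padeE ν n θ).im / ν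

theorem hasDerivAt_padeG_zero (hν : ν ≠ 0) (θ : ℝ) :
    HasDerivAt (padeG ν 0) (Real.cos (ν * θ)) θ := by
  have := ((hasDerivAt_padeE_im_zero (ν := ν) θ).const_mul ((-1) ^ 0)).div_const ν
  refine this.congr_deriv ?_
  field_simp

theorem hasDerivAt_padeG_succ (n : ℕ) (θ : ℝ) :
    HasDerivAt (padeG ν (n + 1))
      (2 * ((n + 1) ^ 2 - ν ^ 2) / (n + 1) * Real.sin θ * padeG ν n θ) θ := by
  have := ((hasDerivAt_padeE_im_succ (ν := ν) n θ).const_mul ((-1) ^ (n + 1))).div_const ν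
  refine this.congr_deriv ?_
  simp only [padeG]; ring

theorem padeG_at_zero (n : ℕ) : padeG ν n 0 = 0 := by
  have : padeE ν n 0 = padeU ν 0 n := by
    rw [padeE_eq]
    have h : padeV ν 0 n = 0 := by
      induction n using Nat.twoStepInduction with
      | zero => simp [padeV]
      | one => simp [padeV]
      | more n ih1 ih2 => simp [padeV, ih1, ih2]
    simp [h]
  simp [padeG, this]

theorem le_of_hasDerivAt_le {f g f' g' : ℝ → ℝ} {b : ℝ} (hf : ∀ x, HasDerivAt f (f' x) x)
    (hg : ∀ x, HasDerivAt g (g' x) x) (h0 : f 0 ≤ g 0)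
    (hle : ∀ x, 0 ≤ x → x ≤ b → f' x ≤ g' x) {x : ℝ} (hx : 0 ≤ x) (hxb : x ≤ b) : f x ≤ g x :=
  image_le_of_deriv_right_le_deriv_boundary (a := 0) (b := b)
    (fun x _ => (hf x).continuousAt.continuousWithinAt) (fun x _ => (hf x).hasDerivWithinAt) h0
    (fun x _ => (hg x).continuousAt.continuousWithinAt) (fun x _ => (hg x).hasDerivWithinAt)
    (fun x hx => hle x hx.1 hx.2.le) ⟨hx, hxb⟩

theorem padeG_bounds (h0 : ν ≠ 0) (hν : ν ^ 2 < 1) (n : ℕ) :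
    ∀ θ, 0 ≤ θ → θ ≤ Real.pi / 2 → padeK ν n * Real.sin θ ^ (2 * n + 1) ≤ padeG ν n θ ∧
      padeG ν n θ ≤ padeK ν n * θ ^ (2 * n + 1) := by
  have hpi := Real.pi_pos
  have habs : |ν| ≤ 1 := by rw [← sq_le_one_iff_abs_le_one]; exact hν.le
  induction n with
  | zero =>
    intro θ h1 h2
    simp only [padeK, mul_zero, zero_add, pow_one, one_mul]
    constructor
    · refine le_of_hasDerivAt_le (b := Real.pi / 2) Real.hasDerivAt_sin (hasDerivAt_padeG_zero h0)
        (by rw [padeG_at_zero]; simp) ?_ h1 h2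
      intro x hx hxb
      rw [← Real.cos_abs (ν * x), abs_mul, abs_of_nonneg hx]
      apply Real.cos_le_cos_of_nonneg_of_le_pi (by positivity) (by linarith)
      nlinarith [abs_nonneg ν]
    · exact le_of_hasDerivAt_le (b := Real.pi / 2) (hasDerivAt_padeG_zero h0) hasDerivAt_id
        (by rw [padeG_at_zero]; simp) (fun x _ _ => Real.cos_le_one _) h1 h2
  | succ n ih =>
    intro θ h1 h2
    have hn : (0 : ℝ) ≤ n := n.cast_nonneg
    have hc : 0 < ((n : ℝ) + 1) ^ 2 - ν ^ 2 := by nlinarith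
    have hk := padeK_pos hν n
    have e : 2 * (n + 1) + 1 = 2 * n + 2 + 1 := by ring
    rw [e]
    have hKe : padeK ν (n + 1) * (2 * n + 3) =
        padeK ν n * (2 * ((n + 1) ^ 2 - ν ^ 2) / (n + 1)) := by
      simp only [padeK]; field_simp
    constructor
    · refine le_of_hasDerivAt_le (b := Real.pi / 2)
        (fun x => ((Real.hasDerivAt_sin x).pow (2 * n + 2 + 1)).const_mul (padeK ν (n + 1)))
        (hasDerivAt_padeG_succ n) (by simp [padeG_at_zero]) ?_ h1 h2
      intro x hx hxb
      have hs : 0 ≤ Real.sin x := Real.sin_nonneg_of_nonneg_of_le_pi hx (by linarith)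
      have hi := (ih x hx hxb).1
      push_cast
      calc padeK ν (n + 1) * ((2 * n + 2 + 1) * Real.sin x ^ (2 * n + 2 + 1 - 1) * Real.cos x)
          = padeK ν (n + 1) * (2 * n + 3) * Real.sin x ^ (2 * n + 2) * Real.cos x := by
            rw [Nat.add_sub_cancel]; ring
        _ ≤ padeK ν (n + 1) * (2 * n + 3) * Real.sin x ^ (2 * n + 2) * 1 := by
            apply mul_le_mul_of_nonneg_left (Real.cos_le_one x)
            have := padeK_pos hν (n + 1)
            positivity
        _ = 2 * ((n + 1) ^ 2 - ν ^ 2) / (n + 1) * Real.sin x *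
              (padeK ν n * Real.sin x ^ (2 * n + 1)) := by rw [hKe]; ring
        _ ≤ _ := by
            apply mul_le_mul_of_nonneg_left hi
            positivity
    · refine le_of_hasDerivAt_le (b := Real.pi / 2) (hasDerivAt_padeG_succ n)
        (fun x => ((hasDerivAt_id x).pow (2 * n + 2 + 1)).const_mul (padeK ν (n + 1)))
        (by simp [padeG_at_zero]) ?_ h1 h2
      intro x hx hxb
      have hs : 0 ≤ Real.sin x := Real.sin_nonneg_of_nonneg_of_le_pi hx (by linarith)
      have hsx := Real.sin_le hx
      have hi := (ih x hx hxb).2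
      have hx2 : 0 ≤ padeK ν n * x ^ (2 * n + 1) := by positivity
      calc 2 * ((n + 1) ^ 2 - ν ^ 2) / (n + 1) * Real.sin x * padeG ν n x
          ≤ 2 * ((n + 1) ^ 2 - ν ^ 2) / (n + 1) * Real.sin x * (padeK ν n * x ^ (2 * n + 1)) := by
            apply mul_le_mul_of_nonneg_left hi
            positivity
        _ ≤ 2 * ((n + 1) ^ 2 - ν ^ 2) / (n + 1) * x * (padeK ν n * x ^ (2 * n + 1)) := by
            gcongr
        _ = padeK ν (n + 1) * (2 * n + 3) * x ^ (2 * n + 2) := by rw [hKe]; ring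
        _ = _ := by
            rw [Nat.add_sub_cancel]; push_cast; simp only [id]; ring

theorem padeK_mul_le (hν : ν ^ 2 < 1) (n : ℕ) : padeK ν (n + 1) ≤ padeK ν n := by
  have hk := padeK_pos hν n
  have hn : (0 : ℝ) ≤ n := n.cast_nonneg
  simp only [padeK]
  apply mul_le_of_le_one_right hk.le
  rw [div_le_one (by positivity)]
  nlinarith [sq_nonneg ν]

theorem padeK_antitone (hν : ν ^ 2 < 1) : Antitone (padeK ν) :=
  antitone_nat_of_succ_le (padeK_mul_le hν)

theorem le_padeK (n : ℕ) : (1 / 2) ^ n ≤ padeK (1 / 3) n := by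
  induction n with
  | zero => simp [padeK]
  | succ n ih =>
    have hn : (0 : ℝ) ≤ n := n.cast_nonneg
    simp only [padeK]
    rw [pow_succ]
    apply mul_le_mul ih _ (by norm_num) (by linarith [pow_pos (show (0 : ℝ) < 1 / 2 by norm_num) n])
    rw [le_div_iff₀ (by positivity)]
    nlinarith

theorem padeK_third_le {n : ℕ} (hn : 2 ≤ n) : padeK (1 / 3) n ≤ 47 / 100 :=
  (padeK_antitone (by norm_num) hn).trans (by norm_num [padeK])

theorem padeK_third_one_le : padeK (1 / 3) 1 ≤ 593 / 1000 := by norm_num [padeK]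

theorem padeK_neg_two_thirds_le {n : ℕ} (hn : 2 ≤ n) : padeK (-2 / 3) n ≤ 27 / 100 :=
  (padeK_antitone (by norm_num) hn).trans (by norm_num [padeK])

theorem centralBinom_le {n : ℕ} (hn : 2 ≤ n) : (n.centralBinom : ℝ) ≤ 3 / 8 * 4 ^ n := by
  induction n, hn using Nat.le_induction with
  | base => norm_num [Nat.centralBinom, Nat.choose]
  | succ n hn ih =>
    rw [centralBinom_succ_real, div_le_iff₀ (by positivity), pow_succ]
    have : (0 : ℝ) ≤ n := n.cast_nonneg
    nlinarith [pow_pos (show (0 : ℝ) < 4 by norm_num) n]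

end

section

open ComplexConjugate

theorem padeA_mul {K : Type*} [Field K] (ν c X W : K) (n : ℕ) :
    padeA ν (c * X) (c * W) n = c ^ n * padeA ν X W n := by
  induction n using Nat.twoStepInduction with
  | zero => simp [padeA]
  | one => simp only [padeA]; ring
  | more n ih1 ih2 => simp only [padeA]; rw [ih1, ih2]; ring

/-- The square root `√(-3 D)`. -/
noncomputable def sqrtNeg (D : ℤ) : ℂ := (Real.sqrt (3 * D) : ℝ) * Complex.I

theorem sqrtNeg_sq {D : ℤ} (hD : 0 ≤ D) : sqrtNeg D ^ 2 = -3 * D := by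
  have h : (0 : ℝ) ≤ 3 * D := by positivity
  rw [sqrtNeg, mul_pow, Complex.I_sq, ← Complex.ofReal_pow, Real.sq_sqrt h]
  push_cast; ring

theorem conj_sqrtNeg (D : ℤ) : conj (sqrtNeg D) = -sqrtNeg D := by simp [sqrtNeg]

theorem sqrtNeg_re (D : ℤ) : (sqrtNeg D).re = 0 := by simp [sqrtNeg]

theorem sqrtNeg_im (D : ℤ) : (sqrtNeg D).im = Real.sqrt (3 * D) := by simp [sqrtNeg]

/-- The quadratic order of discriminant `-3 D` as a subring of `ℂ`. -/
theorem exists_order {D : ℤ} (hD : 0 ≤ D) (hD4 : D % 4 = 0 ∨ D % 4 = 1) :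
    ∃ R : Subring ℂ, (∀ a b : ℤ, (a - b * D) % 2 = 0 → (a + b * sqrtNeg D) / 2 ∈ R) ∧
      ∀ z ∈ R, ∃ b : ℤ, 2 * z.im = Real.sqrt (3 * D) * b := by
  obtain ⟨N, hN⟩ : ∃ N, D ^ 2 + 3 * D = 4 * N := by
    rcases hD4 with h | h
    · obtain ⟨k, rfl⟩ := Int.dvd_of_emod_eq_zero h
      exact ⟨4 * k ^ 2 + 3 * k, by ring⟩
    · obtain ⟨k, hk⟩ : ∃ k, D = 4 * k + 1 := ⟨D / 4, by omega⟩
      exact ⟨4 * k ^ 2 + 5 * k + 1, by rw [hk]; ring⟩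
  have hω : ((D + sqrtNeg D) / 2) ^ 2 = D * ((D + sqrtNeg D) / 2) - N := by
    have hN' : (D : ℂ) ^ 2 + 3 * D = 4 * N := by exact_mod_cast hN
    linear_combination sqrtNeg_sq hD / 4 - hN' / 4
  refine ⟨quadOrder _ D N hω, ?_, ?_⟩
  · intro a b hab
    rw [mem_quadOrder]
    obtain ⟨k, hk⟩ := Int.dvd_of_emod_eq_zero hab
    refine ⟨k, b, ?_⟩
    have hk' : (a : ℂ) - b * D = 2 * k := by exact_mod_cast hk
    linear_combination hk' / 2
  · rintro z ⟨a, b, rfl⟩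
    refine ⟨b, ?_⟩
    simp [sqrtNeg_re, sqrtNeg_im]
    ring

/-- The resolvent data attached to two solutions of a cubic Thue equation. -/
structure PadePair (lam D : ℤ) (ξ η : ℂ) (h k G G₂ F F₂ U m p q : ℤ) : Prop where
  normSq_left : Complex.normSq ξ = h
  normSq_right : Complex.normSq η = k
  cube_left : 2 * ξ ^ 3 = lam * (G + 3 * F * sqrtNeg D)
  cube_right : 2 * η ^ 3 = lam * (G₂ + 3 * F₂ * sqrtNeg D)
  polar : 2 * ξ * conj η = lam * (U + m * sqrtNeg D)
  polar_sq : 2 * conj ξ ^ 2 * conj η = lam * (p + q * sqrtNeg D)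

namespace PadePair

variable {lam D : ℤ} {ξ η : ℂ} {h k G G₂ F F₂ U m p q : ℤ}

theorem neg_left (P : PadePair lam D ξ η h k G G₂ F F₂ U m p q) :
    PadePair lam D (-ξ) η h k (-G) G₂ (-F) F₂ (-U) (-m) p q where
  normSq_left := by rw [Complex.normSq_neg]; exact P.normSq_left
  normSq_right := P.normSq_right
  cube_left := by push_cast; linear_combination -P.cube_left
  cube_right := P.cube_right
  polar := by push_cast; linear_combination -P.polar
  polar_sq := by rw [map_neg]; linear_combination P.polar_sq

theorem neg_right (P : PadePair lam D ξ η h k G G₂ F F₂ U m p q) :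
    PadePair lam D ξ (-η) h k G (-G₂) F (-F₂) (-U) (-m) (-p) (-q) where
  normSq_left := P.normSq_left
  normSq_right := by rw [Complex.normSq_neg]; exact P.normSq_right
  cube_left := P.cube_left
  cube_right := by push_cast; linear_combination -P.cube_right
  polar := by rw [map_neg]; push_cast; linear_combination -P.polar
  polar_sq := by rw [map_neg]; push_cast; linear_combination -P.polar_sq

theorem star (P : PadePair lam D ξ η h k G G₂ F F₂ U m p q) :
    PadePair lam D (conj ξ) (conj η) h k G G₂ (-F) (-F₂) U (-m) p (-q) where
  normSq_left := by rw [Complex.normSq_conj]; exact P.normSq_left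
  normSq_right := by rw [Complex.normSq_conj]; exact P.normSq_right
  cube_left := by
    have := congrArg conj P.cube_left
    simp [conj_sqrtNeg, map_ofNat] at this ⊢
    linear_combination this
  cube_right := by
    have := congrArg conj P.cube_right
    simp [conj_sqrtNeg, map_ofNat] at this ⊢
    linear_combination this
  polar := by
    have := congrArg conj P.polar
    simp [conj_sqrtNeg, map_ofNat] at this ⊢
    linear_combination this
  polar_sq := by
    have := congrArg conj P.polar_sq
    simp [conj_sqrtNeg, map_ofNat] at this ⊢
    linear_combination this

theorem normSq_quad (hD : 0 ≤ D) (a b : ℤ) :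
    Complex.normSq (lam * (a + b * sqrtNeg D)) = lam ^ 2 * (a ^ 2 + 3 * D * b ^ 2) := by
  have h3 : (0 : ℝ) ≤ 3 * D := by positivity
  rw [Complex.normSq_apply]
  simp only [Complex.mul_re, Complex.mul_im, Complex.add_re, Complex.add_im, Complex.intCast_re,
    Complex.intCast_im, sqrtNeg_re, sqrtNeg_im]
  linear_combination (lam ^ 2 * b ^ 2 : ℝ) * Real.sq_sqrt h3

theorem polar_norm (P : PadePair lam D ξ η h k G G₂ F F₂ U m p q) (hD : 0 ≤ D) :
    lam ^ 2 * (U ^ 2 + 3 * D * m ^ 2) = 4 * h * k := by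
  have := congrArg Complex.normSq P.polar
  rw [normSq_quad hD, map_mul, map_mul, Complex.normSq_conj, P.normSq_left, P.normSq_right] at this
  norm_num at this
  have h2 : (4 * h * k : ℝ) = lam ^ 2 * (U ^ 2 + 3 * D * m ^ 2) := by linarith
  exact_mod_cast h2.symm

theorem cube_norm (P : PadePair lam D ξ η h k G G₂ F F₂ U m p q) (hD : 0 ≤ D) :
    lam ^ 2 * (G ^ 2 + 27 * D * F ^ 2) = 4 * h ^ 3 := by
  have := congrArg Complex.normSq P.cube_left
  have e : (3 * F * sqrtNeg D : ℂ) = ((3 * F : ℤ) : ℂ) * sqrtNeg D := by push_cast; ring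
  rw [e, normSq_quad hD, map_mul, map_pow, P.normSq_left] at this
  norm_num at this
  have h2 : (4 * h ^ 3 : ℝ) = lam ^ 2 * (G ^ 2 + 27 * D * F ^ 2) := by linarith
  exact_mod_cast h2.symm

theorem polar_sq_norm (P : PadePair lam D ξ η h k G G₂ F F₂ U m p q) (hD : 0 ≤ D) :
    lam ^ 2 * (p ^ 2 + 3 * D * q ^ 2) = 4 * h ^ 2 * k := by
  have := congrArg Complex.normSq P.polar_sq
  rw [normSq_quad hD, map_mul, map_mul, map_pow, Complex.normSq_conj, Complex.normSq_conj,
    P.normSq_left, P.normSq_right] at this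
  norm_num at this
  have h2 : (4 * h ^ 2 * k : ℝ) = lam ^ 2 * (p ^ 2 + 3 * D * q ^ 2) := by linarith
  exact_mod_cast h2.symm

theorem emod_two_of_sq {t a b c : ℤ} (ht : Odd t)
    (h : t ^ 2 * (a ^ 2 + 3 * D * b ^ 2) = 4 * c) : (a - b * D) % 2 = 0 := by
  have h1 : Even (t ^ 2 * (a ^ 2 + 3 * D * b ^ 2)) := ⟨2 * c, by rw [h]; ring⟩
  rw [← Int.even_iff]
  have ht' := Int.not_even_iff_odd.mpr ht
  simp only [Int.even_mul, Int.even_pow, Int.even_add, Int.even_sub] at h1 ⊢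
  have h3 : ¬ Even (3 : ℤ) := by decide
  tauto

end PadePair

theorem padeA_polar (ν : ℂ) {ξ : ℂ} {r φ : ℝ} (hξ : ξ = r * Complex.exp (φ * Complex.I)) (n : ℕ) :
    padeA ν (ξ ^ 3) (ξ ^ 3 - conj ξ ^ 3) n = r ^ (3 * n) *
      padeA ν (Complex.exp ((3 * φ : ℝ) * Complex.I)) (2 * Real.sin (3 * φ) * Complex.I) n := by
  have h1 : ξ ^ 3 = (r : ℂ) ^ 3 * Complex.exp ((3 * φ : ℝ) * Complex.I) := by
    rw [hξ, mul_pow, ← Complex.exp_nat_mul]; congr 2; push_cast; ring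
  have h2 : ξ ^ 3 - conj ξ ^ 3 = (r : ℂ) ^ 3 * (2 * Real.sin (3 * φ) * Complex.I) := by
    rw [← map_pow, h1, map_mul, map_pow, Complex.conj_ofReal, ← mul_sub, Complex.sub_conj,
      Complex.exp_ofReal_mul_I_im]
    push_cast; ring
  rw [h2, h1, padeA_mul, pow_mul]

theorem im_exp_neg_mul (φ : ℝ) (z : ℂ) :
    (Complex.exp (-(φ * Complex.I)) * z).im = z.im * Real.cos φ - z.re * Real.sin φ := by
  have : -((φ : ℂ) * Complex.I) = ((-φ : ℝ) : ℂ) * Complex.I := by push_cast; ring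
  rw [this, Complex.mul_im, Complex.exp_ofReal_mul_I_re, Complex.exp_ofReal_mul_I_im, Real.cos_neg,
    Real.sin_neg]
  ring

theorem conj_polar {η : ℂ} {r φ : ℝ} (hη : η = r * Complex.exp (φ * Complex.I)) :
    conj η = r * Complex.exp (-(φ * Complex.I)) := by
  rw [hη, map_mul, Complex.conj_ofReal, ← Complex.exp_conj]
  simp

namespace PadePair

variable {lam D : ℤ} {ξ η : ℂ} {h k G G₂ F F₂ U m p q : ℤ}

theorem exists_int_aux (P : PadePair lam D ξ η h k G G₂ 1 F₂ U m p q) (hD : 0 ≤ D)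
    (hD4 : D % 4 = 0 ∨ D % 4 = 1) (hlam : Odd lam) {ν : ℂ} {t : ℤ} (hν : 3 * ν = t) {z : ℂ}
    {a b c : ℤ} (hz : 2 * z = lam * (a + b * sqrtNeg D))
    (habc : lam ^ 2 * (a ^ 2 + 3 * D * b ^ 2) = 4 * c) (n : ℕ) :
    ∃ e : ℤ, 2 * (z * padeA ν (ξ ^ 3) (ξ ^ 3 - conj ξ ^ 3) n).im =
      lam ^ (n + 1) * (Real.sqrt (3 * D) * e) := by
  obtain ⟨R, hR, hRe⟩ := exists_order hD hD4
  have hs : sqrtNeg D ∈ R := by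
    have := hR 0 2 (by omega)
    convert this using 1
    push_cast; ring
  have hX : (G + (3 : ℤ) * sqrtNeg D) / 2 ∈ R := by
    apply hR
    have := P.cube_norm hD
    apply emod_two_of_sq (c := h ^ 3) hlam
    rw [← this]
    ring
  have hz' : (a + b * sqrtNeg D) / 2 ∈ R := hR _ _ (emod_two_of_sq hlam habc)
  obtain ⟨e, he⟩ := hRe _ (R.mul_mem hz' (padeA_mem (e := 1) (sqrtNeg_sq hD) hs hX hν n))
  refine ⟨e, ?_⟩
  have h1 : ξ ^ 3 = lam * ((G + (3 : ℤ) * sqrtNeg D) / 2) := by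
    have := P.cube_left
    push_cast at this ⊢
    linear_combination this / 2
  have h2 : ξ ^ 3 - conj ξ ^ 3 = lam * (3 * (1 : ℤ) * sqrtNeg D) := by
    have h3 := P.star.cube_left
    have h4 := P.cube_left
    push_cast at h3 h4 ⊢
    linear_combination h4 / 2 - h3 / 2
  have h5 : z = lam * ((a + b * sqrtNeg D) / 2) := by linear_combination hz / 2
  rw [h2, h1, padeA_mul, h5]
  have h6 : (lam : ℂ) * ((a + b * sqrtNeg D) / 2) * ((lam : ℂ) ^ n *
      padeA ν ((G + (3 : ℤ) * sqrtNeg D) / 2) (3 * (1 : ℤ) * sqrtNeg D) n) =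
      ((lam ^ (n + 1) : ℝ) : ℂ) * ((a + b * sqrtNeg D) / 2 *
      padeA ν ((G + (3 : ℤ) * sqrtNeg D) / 2) (3 * (1 : ℤ) * sqrtNeg D) n) := by
    push_cast; ring
  rw [h6, Complex.im_ofReal_mul, ← he]
  ring

theorem polar_mul_padeA {r₁ r₂ φ₁ φ₂ : ℝ} (hξ : ξ = r₁ * Complex.exp (φ₁ * Complex.I))
    (hη : η = r₂ * Complex.exp (φ₂ * Complex.I)) (n : ℕ) :
    2 * (r₂ * r₁ ^ (3 * n + 1) * ((padeE (1 / 3) n (3 * φ₁)).im * Real.cos φ₂ -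
      (padeE (1 / 3) n (3 * φ₁)).re * Real.sin φ₂)) =
    2 * (ξ * conj η * padeA ((1 / 3 : ℝ) : ℂ) (ξ ^ 3) (ξ ^ 3 - conj ξ ^ 3) n).im := by
  rw [← im_exp_neg_mul, padeA_polar _ hξ, padeE, conj_polar hη]
  have : ξ * (r₂ * Complex.exp (-(φ₂ * Complex.I))) * (r₁ ^ (3 * n) *
      padeA ((1 / 3 : ℝ) : ℂ) (Complex.exp ((3 * φ₁ : ℝ) * Complex.I))
      (2 * Real.sin (3 * φ₁) * Complex.I) n) = ((r₂ * r₁ ^ (3 * n + 1) : ℝ) : ℂ) *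
      (Complex.exp (-(φ₂ * Complex.I)) * (Complex.exp (((1 / 3 : ℝ) : ℂ) * (3 * φ₁ : ℝ) * Complex.I) *
      padeA ((1 / 3 : ℝ) : ℂ) (Complex.exp ((3 * φ₁ : ℝ) * Complex.I))
      (2 * Real.sin (3 * φ₁) * Complex.I) n)) := by
    have e1 : ((1 / 3 : ℝ) : ℂ) * (3 * φ₁ : ℝ) * Complex.I = φ₁ * Complex.I := by
      push_cast; ring
    rw [e1, hξ]; push_cast; ring
  rw [this, Complex.im_ofReal_mul]

theorem exists_int (P : PadePair lam D ξ η h k G G₂ 1 F₂ U m p q) (hD : 0 ≤ D)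
    (hD4 : D % 4 = 0 ∨ D % 4 = 1) (hlam : Odd lam) {r₁ r₂ φ₁ φ₂ : ℝ}
    (hξ : ξ = r₁ * Complex.exp (φ₁ * Complex.I)) (hη : η = r₂ * Complex.exp (φ₂ * Complex.I))
    (n : ℕ) : ∃ e : ℤ, 2 * (r₂ * r₁ ^ (3 * n + 1) * ((padeE (1 / 3) n (3 * φ₁)).im * Real.cos φ₂ -
      (padeE (1 / 3) n (3 * φ₁)).re * Real.sin φ₂)) = lam ^ (n + 1) * (Real.sqrt (3 * D) * e) := by
  obtain ⟨e, he⟩ := P.exists_int_aux hD hD4 hlam (ν := ((1 / 3 : ℝ) : ℂ)) (t := 1)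
    (by push_cast; norm_num) (z := ξ * conj η) (by rw [← P.polar]; ring)
    ((P.polar_norm hD).trans (mul_assoc _ _ _)) n
  exact ⟨e, (polar_mul_padeA hξ hη n).trans he⟩

theorem int_zero (P : PadePair lam D ξ η h k G G₂ F F₂ U m p q) {r₁ r₂ φ₁ φ₂ : ℝ}
    (hξ : ξ = r₁ * Complex.exp (φ₁ * Complex.I)) (hη : η = r₂ * Complex.exp (φ₂ * Complex.I)) :
    2 * (r₂ * r₁ ^ (3 * 0 + 1) * ((padeE (1 / 3) 0 (3 * φ₁)).im * Real.cos φ₂ -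
      (padeE (1 / 3) 0 (3 * φ₁)).re * Real.sin φ₂)) = lam ^ (0 + 1) * (Real.sqrt (3 * D) * m) := by
  rw [polar_mul_padeA hξ hη]
  have := congrArg Complex.im P.polar
  rw [mul_assoc, show (2 : ℂ) = ((2 : ℝ) : ℂ) by norm_num, Complex.im_ofReal_mul] at this
  rw [padeA, mul_one, this, Complex.mul_im, Complex.add_im, Complex.mul_im, Complex.intCast_im,
    Complex.intCast_im, Complex.intCast_im, Complex.intCast_re, Complex.intCast_re, sqrtNeg_im]
  ring

theorem int_one (P : PadePair lam D ξ η h k G G₂ 1 F₂ U m p q) (hD : 0 ≤ D) {r₁ r₂ φ₁ φ₂ : ℝ}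
    (hξ : ξ = r₁ * Complex.exp (φ₁ * Complex.I)) (hη : η = r₂ * Complex.exp (φ₂ * Complex.I)) :
    2 * (r₂ * r₁ ^ (3 * 1 + 1) * ((padeE (1 / 3) 1 (3 * φ₁)).im * Real.cos φ₂ -
      (padeE (1 / 3) 1 (3 * φ₁)).re * Real.sin φ₂)) =
      lam ^ (1 + 1) * (Real.sqrt (3 * D) * (m * G - U : ℤ)) := by
  rw [polar_mul_padeA hξ hη]
  have h1 := P.cube_left
  have h2 := P.star.cube_left
  have h3 := P.polar
  have h4 : 2 * (ξ * conj η * padeA ((1 / 3 : ℝ) : ℂ) (ξ ^ 3) (ξ ^ 3 - conj ξ ^ 3) 1) =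
      ((lam ^ 2 * (U * G + 3 * D * m) : ℤ) : ℂ) + ((lam ^ 2 * (m * G - U) : ℤ) : ℂ) * sqrtNeg D := by
    have h5 : padeA ((1 / 3 : ℝ) : ℂ) (ξ ^ 3) (ξ ^ 3 - conj ξ ^ 3) 1 =
        lam * (G - sqrtNeg D) := by
      rw [padeA]
      push_cast at h1 h2 ⊢
      linear_combination h1 / 3 + 2 / 3 * h2
    rw [h5]
    push_cast
    linear_combination lam * (G - sqrtNeg D) * h3 - lam ^ 2 * m * sqrtNeg_sq hD
  have := congrArg Complex.im h4
  rw [show (2 : ℂ) = ((2 : ℝ) : ℂ) by norm_num, Complex.im_ofReal_mul] at this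
  rw [this, Complex.add_im, Complex.mul_im, Complex.intCast_im, Complex.intCast_im,
    Complex.intCast_re, sqrtNeg_im]
  push_cast
  ring

theorem exists_int' (P : PadePair lam D ξ η h k G G₂ 1 F₂ U m p q) (hD : 0 ≤ D)
    (hD4 : D % 4 = 0 ∨ D % 4 = 1) (hlam : Odd lam) {r₁ r₂ φ₁ φ₂ : ℝ}
    (hξ : ξ = r₁ * Complex.exp (φ₁ * Complex.I)) (hη : η = r₂ * Complex.exp (φ₂ * Complex.I))
    (n : ℕ) : ∃ e : ℤ, 2 * (r₂ * r₁ ^ (3 * n + 2) * ((padeE (-2 / 3) n (3 * φ₁)).im * Real.cos φ₂ -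
      (padeE (-2 / 3) n (3 * φ₁)).re * Real.sin φ₂)) = lam ^ (n + 1) * (Real.sqrt (3 * D) * e) := by
  obtain ⟨e, he⟩ := P.exists_int_aux hD hD4 hlam (ν := ((-2 / 3 : ℝ) : ℂ)) (t := -2)
    (by push_cast; norm_num) (z := conj ξ ^ 2 * conj η) (by rw [← P.polar_sq]; ring)
    ((P.polar_sq_norm hD).trans (mul_assoc _ _ _)) n
  refine ⟨e, ?_⟩
  rw [← he, ← im_exp_neg_mul, padeA_polar _ hξ, padeE, conj_polar hη, conj_polar hξ]
  have : (r₁ * Complex.exp (-(φ₁ * Complex.I))) ^ 2 *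
      (r₂ * Complex.exp (-(φ₂ * Complex.I))) * (r₁ ^ (3 * n) *
      padeA ((-2 / 3 : ℝ) : ℂ) (Complex.exp ((3 * φ₁ : ℝ) * Complex.I))
      (2 * Real.sin (3 * φ₁) * Complex.I) n) = ((r₂ * r₁ ^ (3 * n + 2) : ℝ) : ℂ) *
      (Complex.exp (-(φ₂ * Complex.I)) * (Complex.exp (((-2 / 3 : ℝ) : ℂ) * (3 * φ₁ : ℝ) * Complex.I) *
      padeA ((-2 / 3 : ℝ) : ℂ) (Complex.exp ((3 * φ₁ : ℝ) * Complex.I))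
      (2 * Real.sin (3 * φ₁) * Complex.I) n)) := by
    have e1 : Complex.exp (((-2 / 3 : ℝ) : ℂ) * (3 * φ₁ : ℝ) * Complex.I) =
        Complex.exp (-(φ₁ * Complex.I)) ^ 2 := by
      rw [← Complex.exp_nat_mul]; congr 1; push_cast; ring
    rw [e1]; push_cast; ring
  rw [this, Complex.im_ofReal_mul]

theorem exists_polar_form {z : ℂ} (hre : 0 < z.re) (him : 4 * z.im ^ 2 ≤ Complex.normSq z) :
    ∃ φ : ℝ, |φ| ≤ Real.pi / 6 ∧ z = ‖z‖ * Complex.exp (φ * Complex.I) := by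
  refine ⟨z.arg, ?_, (Complex.norm_mul_exp_arg_mul_I z).symm⟩
  have hz : z ≠ 0 := by rintro rfl; simp at hre
  have hpos : 0 < ‖z‖ := norm_pos_iff.mpr hz
  have h1 : |z.arg| ≤ Real.pi / 2 := (Complex.abs_arg_lt_pi_div_two_iff.mpr (Or.inl hre)).le
  have hpi := Real.pi_pos
  have h2 : |Real.sin z.arg| ≤ 1 / 2 := by
    rw [Complex.sin_arg, abs_div, abs_of_pos hpos, div_le_iff₀ hpos]
    apply abs_le_of_sq_le_sq _ (by positivity)
    rw [Complex.normSq_eq_norm_sq] at him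
    nlinarith
  obtain ⟨h3, h4⟩ := abs_le.mp h2
  obtain ⟨h5, h6⟩ := abs_le.mp h1
  have hs6 : Real.sin (Real.pi / 6) = 1 / 2 := Real.sin_pi_div_six
  rw [abs_le]
  constructor
  · refine (Real.strictMonoOn_sin.le_iff_le ⟨by linarith, by linarith⟩ ⟨h5, h6⟩).mp ?_
    rw [Real.sin_neg, hs6]; linarith
  · refine (Real.strictMonoOn_sin.le_iff_le ⟨h5, h6⟩ ⟨by linarith, by linarith⟩).mp ?_
    rw [hs6]; linarith

theorem sin_three (P : PadePair lam D ξ η h k G G₂ F F₂ U m p q) {r φ : ℝ}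
    (hξ : ξ = r * Complex.exp (φ * Complex.I)) :
    2 * r ^ 3 * Real.sin (3 * φ) = lam * (3 * F * Real.sqrt (3 * D)) := by
  have h1 : ξ ^ 3 = ((r ^ 3 : ℝ) : ℂ) * Complex.exp ((3 * φ : ℝ) * Complex.I) := by
    rw [hξ, mul_pow, ← Complex.exp_nat_mul]; push_cast; congr 2; ring
  have := congrArg Complex.im P.cube_left
  rw [h1, show (2 : ℂ) = ((2 : ℝ) : ℂ) by norm_num, Complex.im_ofReal_mul, Complex.im_ofReal_mul,
    Complex.exp_ofReal_mul_I_im] at this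
  rw [mul_assoc, this]
  simp [sqrtNeg_im, sqrtNeg_re]

theorem sin_three_right (P : PadePair lam D ξ η h k G G₂ F F₂ U m p q) {r φ : ℝ}
    (hη : η = r * Complex.exp (φ * Complex.I)) :
    2 * r ^ 3 * Real.sin (3 * φ) = lam * (3 * F₂ * Real.sqrt (3 * D)) := by
  have h1 : η ^ 3 = ((r ^ 3 : ℝ) : ℂ) * Complex.exp ((3 * φ : ℝ) * Complex.I) := by
    rw [hη, mul_pow, ← Complex.exp_nat_mul]; push_cast; congr 2; ring
  have := congrArg Complex.im P.cube_right
  rw [h1, show (2 : ℂ) = ((2 : ℝ) : ℂ) by norm_num, Complex.im_ofReal_mul, Complex.im_ofReal_mul,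
    Complex.exp_ofReal_mul_I_im] at this
  rw [mul_assoc, this]
  simp [sqrtNeg_im, sqrtNeg_re]

/-- The algebraic relation between the resolvent data of two solutions. -/
theorem polar_cube (P : PadePair lam D ξ η h k G G₂ 1 F₂ U m p q) (hD : 0 < D) (hlam : lam ≠ 0) :
    2 * F₂ * (G ^ 2 + 27 * D) =
      lam * (U ^ 3 - 9 * D * U * m ^ 2 - G * m * U ^ 2 + G * D * m ^ 3) := by
  have hs := sqrtNeg_sq hD.le
  have h1 := P.cube_left
  have h2 := P.star.cube_right
  have h3 := P.polar
  have hl : (lam : ℂ) ^ 2 ≠ 0 := pow_ne_zero _ (by exact_mod_cast hlam)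
  have h4 : (2 * (G + 3 * sqrtNeg D) * (G₂ - 3 * F₂ * sqrtNeg D) : ℂ) =
      lam * (U + m * sqrtNeg D) ^ 3 := by
    have : (lam : ℂ) ^ 2 * (2 * (G + 3 * sqrtNeg D) * (G₂ - 3 * F₂ * sqrtNeg D)) =
        lam ^ 2 * (lam * (U + m * sqrtNeg D) ^ 3) := by
      calc (lam : ℂ) ^ 2 * (2 * (G + 3 * sqrtNeg D) * (G₂ - 3 * F₂ * sqrtNeg D)) =
          2 * (2 * ξ ^ 3) * (2 * conj η ^ 3) := by rw [h1, h2]; push_cast; ring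
        _ = (2 * ξ * conj η) ^ 3 := by ring
        _ = _ := by rw [h3]; ring
    exact mul_left_cancel₀ hl this
  have h5 := congrArg Complex.re h4
  have h6 := congrArg Complex.im h4
  have hsne : Real.sqrt (3 * D) ≠ 0 := by
    have : (0 : ℝ) < D := by exact_mod_cast hD
    positivity
  have e1 : (2 * (G + 3 * sqrtNeg D) * (G₂ - 3 * F₂ * sqrtNeg D) : ℂ) =
      ((2 * (G * G₂ + 27 * D * F₂) : ℝ) : ℂ) + ((6 * (G₂ - G * F₂) : ℝ) : ℂ) * sqrtNeg D := by
    push_cast; linear_combination (-18 * F₂ : ℂ) * hs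
  have e2 : (lam * (U + m * sqrtNeg D) ^ 3 : ℂ) =
      ((lam * (U ^ 3 - 9 * D * U * m ^ 2) : ℝ) : ℂ) +
        ((3 * lam * m * (U ^ 2 - D * m ^ 2) : ℝ) : ℂ) * sqrtNeg D := by
    push_cast; linear_combination (3 * lam * U * m ^ 2 + lam * m ^ 3 * sqrtNeg D : ℂ) * hs
  rw [e1, e2, Complex.add_re, Complex.add_re, Complex.re_ofReal_mul, Complex.re_ofReal_mul,
    sqrtNeg_re, Complex.ofReal_re, Complex.ofReal_re] at h5
  rw [e1, e2, Complex.add_im, Complex.add_im, Complex.im_ofReal_mul, Complex.im_ofReal_mul,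
    sqrtNeg_im, Complex.ofReal_im, Complex.ofReal_im, zero_add, zero_add] at h6
  have h7 := mul_right_cancel₀ hsne h6
  have h8 : (2 * F₂ * (G ^ 2 + 27 * D) : ℝ) =
      lam * (U ^ 3 - 9 * D * U * m ^ 2 - G * m * U ^ 2 + G * D * m ^ 3) := by
    linear_combination h5 - G / 3 * h7
  exact_mod_cast h8

end PadePair

/-- The real data attached to a large solution and a second solution close to it. -/
structure PadeAngles (l D y L r₁ r₂ φ₁ φ₂ : ℝ) : Prop where
  one_le_l : 1 ≤ l
  one_le_D : 1 ≤ D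
  L_pos : 0 < L
  L_sq : L ^ 2 = 3 * D
  le_y : 512 * D ^ 2 ≤ y
  r₁_pos : 0 < r₁
  r₁_le : r₁ ≤ r₂
  r₁_cube : r₁ ^ 3 = l * y
  φ₁_nonneg : 0 ≤ φ₁
  φ₁_le : φ₁ ≤ Real.pi / 6
  φ₂_le : |φ₂| ≤ Real.pi / 6
  sin_left : 2 * y * Real.sin (3 * φ₁) = 3 * L
  sin_right : 2 * r₂ ^ 3 * |Real.sin (3 * φ₂)| = 3 * l * L

namespace PadeAngles

variable {l D y L r₁ r₂ φ₁ φ₂ : ℝ} (A : PadeAngles l D y L r₁ r₂ φ₁ φ₂)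

include A

theorem y_ge : 512 ≤ y := by nlinarith [A.le_y, A.one_le_D]

theorem sin_pos : 0 < Real.sin (3 * φ₁) := by
  have h := A.sin_left
  have hy := A.y_ge
  have hL := A.L_pos
  by_contra hc
  push Not at hc
  nlinarith

theorem sin_sq : y ^ 2 * Real.sin (3 * φ₁) ^ 2 = 27 / 4 * D := by
  have h := A.sin_left
  have : (2 * y * Real.sin (3 * φ₁)) ^ 2 = 9 * (3 * D) := by rw [h, mul_pow, A.L_sq]; norm_num
  linarith

theorem sin_le : Real.sin (3 * φ₁) ≤ 51 / 10000 := by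
  have hD := A.one_le_D
  have h2 : (512 * D) ^ 2 ≤ y ^ 2 := by
    apply pow_le_pow_left₀ (by linarith)
    nlinarith [A.le_y]
  have h3 := A.sin_sq
  have h4 : Real.sin (3 * φ₁) ^ 2 ≤ (51 / 10000) ^ 2 := by
    have h5 : (512 * D) ^ 2 * Real.sin (3 * φ₁) ^ 2 ≤ 27 / 4 * D := by
      rw [← h3]; exact mul_le_mul_of_nonneg_right h2 (sq_nonneg _)
    have h6 : D * (512 ^ 2 * D * Real.sin (3 * φ₁) ^ 2) ≤ D * (27 / 4) := by linarith
    have h7 := le_of_mul_le_mul_left h6 (by linarith)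
    nlinarith [sq_nonneg (Real.sin (3 * φ₁))]
  exact (abs_le.mp (abs_le_of_sq_le_sq h4 (by norm_num))).2

theorem theta_le : 3 * φ₁ ≤ 10001 / 10000 * Real.sin (3 * φ₁) := by
  have hs := A.sin_le
  have h0 := A.φ₁_nonneg
  have h1 : 2 / Real.pi * (3 * φ₁) ≤ Real.sin (3 * φ₁) :=
    Real.mul_le_sin (by linarith) (by linarith [A.φ₁_le])
  have hpi := Real.pi_lt_d2
  have hpi0 := Real.pi_pos
  have h2 : 3 * φ₁ ≤ Real.pi / 2 * Real.sin (3 * φ₁) := by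
    rw [div_mul_eq_mul_div, div_le_iff₀ hpi0] at h1
    linarith
  have hsp := A.sin_pos
  have h3 : 3 * φ₁ ≤ 1 / 100 := by nlinarith
  have h4 : 0 < 3 * φ₁ := by
    rcases h0.eq_or_lt with h | h
    · rw [← h] at hsp; simp at hsp
    · linarith
  have h5 := Real.sin_gt_sub_cube h4
  nlinarith [mul_pos h4 h4]

theorem sin_le_theta : Real.sin (3 * φ₁) ≤ 3 * φ₁ := Real.sin_le (by linarith [A.φ₁_nonneg])

theorem theta_small : 3 * φ₁ ≤ 1 / 100 := by linarith [A.theta_le, A.sin_le]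

theorem cos_left : 9998 / 10000 ≤ Real.cos (3 * φ₁) := by
  have := Real.one_sub_sq_div_two_le_cos (x := 3 * φ₁)
  nlinarith [A.theta_small, A.φ₁_nonneg]

theorem y_theta : y ^ 3 * (3 * φ₁) ^ 4 ≤ 891 / 10000 := by
  have hy := A.y_ge
  have hD := A.one_le_D
  have h1 : (3 * φ₁) ^ 4 ≤ (10001 / 10000 * Real.sin (3 * φ₁)) ^ 4 :=
    pow_le_pow_left₀ (by linarith [A.φ₁_nonneg]) A.theta_le 4
  have h2 : (y ^ 3 * Real.sin (3 * φ₁) ^ 4) * y = (27 / 4 * D) ^ 2 := by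
    rw [← A.sin_sq]; ring
  have h3 : y ^ 3 * Real.sin (3 * φ₁) ^ 4 ≤ 89 / 1000 := by
    have h4 : (y ^ 3 * Real.sin (3 * φ₁) ^ 4) * (512 * D ^ 2) ≤ (27 / 4 * D) ^ 2 := by
      rw [← h2]; exact mul_le_mul_of_nonneg_left A.le_y (by positivity)
    have h5 : D ^ 2 * (512 * (y ^ 3 * Real.sin (3 * φ₁) ^ 4)) ≤ D ^ 2 * (729 / 16) := by linarith
    have h6 := le_of_mul_le_mul_left h5 (by positivity)
    linarith
  calc y ^ 3 * (3 * φ₁) ^ 4 ≤ y ^ 3 * (10001 / 10000 * Real.sin (3 * φ₁)) ^ 4 := by gcongr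
    _ = (10001 / 10000) ^ 4 * (y ^ 3 * Real.sin (3 * φ₁) ^ 4) := by ring
    _ ≤ (10001 / 10000) ^ 4 * (89 / 1000) := by gcongr
    _ ≤ _ := by norm_num

theorem r₂_pos : 0 < r₂ := A.r₁_pos.trans_le A.r₁_le

theorem l_L_le : l * L ≤ 34 / 10000 * r₂ ^ 3 := by
  have h1 : r₁ ^ 3 ≤ r₂ ^ 3 := pow_le_pow_left₀ A.r₁_pos.le A.r₁_le 3
  have h2 := A.sin_left
  have h3 := A.sin_le
  have hy := A.y_ge
  have hl := A.one_le_l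
  have : L ≤ 34 / 10000 * y := by nlinarith
  calc l * L ≤ l * (34 / 10000 * y) := by gcongr
    _ = 34 / 10000 * r₁ ^ 3 := by rw [A.r₁_cube]; ring
    _ ≤ _ := by gcongr

theorem abs_sin_right : l * L ≤ 2 * r₂ ^ 3 * |Real.sin φ₂| ∧
    2 * r₂ ^ 3 * |Real.sin φ₂| ≤ 10001 / 10000 * (l * L) := by
  have h := A.sin_right
  have hr := pow_pos A.r₂_pos 3
  obtain ⟨h1, h2⟩ := abs_le.mp A.φ₂_le
  have hpi := Real.pi_pos
  have hs : |Real.sin φ₂| ≤ 1 / 2 := by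
    rw [abs_le]
    constructor
    · rw [← Real.sin_pi_div_six, ← Real.sin_neg]
      exact Real.sin_le_sin_of_le_of_le_pi_div_two (by linarith) (by linarith) (by linarith)
    · rw [← Real.sin_pi_div_six]
      exact Real.sin_le_sin_of_le_of_le_pi_div_two (by linarith) (by linarith) (by linarith)
  have h0 := abs_nonneg (Real.sin φ₂)
  have h3 : |Real.sin (3 * φ₂)| = |Real.sin φ₂| * (3 - 4 * |Real.sin φ₂| ^ 2) := by
    rw [Real.sin_three_mul, sq_abs, show 3 * Real.sin φ₂ - 4 * Real.sin φ₂ ^ 3 =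
      Real.sin φ₂ * (3 - 4 * Real.sin φ₂ ^ 2) by ring, abs_mul]
    congr 1
    rw [abs_of_nonneg]
    rw [← sq_abs]; nlinarith
  rw [h3] at h
  set s := |Real.sin φ₂|
  have h4 : 2 * r₂ ^ 3 * s * (3 - 4 * s ^ 2) = 3 * (l * L) := by linarith
  have hp : 0 ≤ 2 * r₂ ^ 3 * s := by positivity
  have h5 : l * L ≤ 2 * r₂ ^ 3 * s := by nlinarith [mul_nonneg hp (sq_nonneg s)]
  refine ⟨h5, ?_⟩
  have h6 : 2 * r₂ ^ 3 * s * 2 ≤ 3 * (l * L) := by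
    have : s ^ 2 ≤ (1 / 2) ^ 2 := by gcongr
    nlinarith
  have h7 : s ≤ 26 / 10000 := by
    have := A.l_L_le
    by_contra hc
    push Not at hc
    nlinarith
  have h8 : s ^ 2 ≤ (26 / 10000) ^ 2 := by gcongr
  nlinarith

theorem cos_right : 9999 / 10000 ≤ Real.cos φ₂ := by
  have h1 := A.abs_sin_right.2
  have h2 := A.l_L_le
  have hr := pow_pos A.r₂_pos 3
  have h0 := abs_nonneg (Real.sin φ₂)
  have h3 : |Real.sin φ₂| ≤ 1 / 100 := by
    by_contra hc
    push Not at hc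
    nlinarith
  have hpi := Real.pi_pos
  obtain ⟨h4, h5⟩ := abs_le.mp A.φ₂_le
  have h6 : 0 ≤ Real.cos φ₂ := Real.cos_nonneg_of_neg_pi_div_two_le_of_le (by linarith) (by linarith)
  have h7 := Real.sin_sq_add_cos_sq φ₂
  rw [← sq_abs (Real.sin φ₂)] at h7
  nlinarith

/-- Upper bound for the imaginary part of the twisted Padé polynomials. -/
theorem abs_im_le {ν : ℝ} (h0 : ν ≠ 0) (hν : ν ^ 2 < 1) (n : ℕ) :
    |(padeE ν n (3 * φ₁)).im| ≤ |ν| * (padeK ν n * (3 * φ₁) ^ (2 * n + 1)) ∧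
    |ν| * (padeK ν n * Real.sin (3 * φ₁) ^ (2 * n + 1)) ≤ |(padeE ν n (3 * φ₁)).im| := by
  obtain ⟨h1, h2⟩ := padeG_bounds h0 hν n (3 * φ₁) (by linarith [A.φ₁_nonneg])
    (by linarith [A.φ₁_le])
  have h3 : |(padeE ν n (3 * φ₁)).im| = |ν| * |padeG ν n (3 * φ₁)| := by
    rw [padeG, abs_div, abs_mul, abs_pow, abs_neg, abs_one, one_pow, one_mul,
      mul_div_cancel₀ _ (abs_ne_zero.mpr h0)]
  have hk := padeK_pos hν n
  have hs := A.sin_pos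
  have h4 : 0 ≤ padeG ν n (3 * φ₁) := le_trans (by positivity) h1
  rw [h3, abs_of_nonneg h4]
  constructor <;> gcongr

/-- The basic estimate for the integer produced by the Padé approximation. -/
theorem estimate {ν : ℝ} (h0 : ν ≠ 0) (hν : ν ^ 2 < 1) (n : ℕ) :
    |2 * r₂ * y ^ n * ((padeE ν n (3 * φ₁)).im * Real.cos φ₂ -
      (padeE ν n (3 * φ₁)).re * Real.sin φ₂)| * r₁ ^ 3 * r₂ ^ 2 ≤
      l * L * (30003 / 10000 * |ν| * padeK ν n * r₂ ^ 3 * (y * (3 * φ₁) ^ 2) ^ n +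
        10001 / 10000 * n.centralBinom * y ^ n * r₁ ^ 3) := by
  have hy := A.y_ge
  have hr1 := A.r₁_pos
  have hr2 := A.r₂_pos
  have hk := padeK_pos hν n
  have hl := A.one_le_l
  have hth := A.φ₁_nonneg
  have h1 := (A.abs_im_le h0 hν n).1
  have h2 : |(padeE ν n (3 * φ₁)).re| ≤ n.centralBinom :=
    (Complex.abs_re_le_norm _).trans (norm_padeE_le hν.le (by linarith [A.cos_left]) n)
  have h3 : |(padeE ν n (3 * φ₁)).im * Real.cos φ₂ - (padeE ν n (3 * φ₁)).re * Real.sin φ₂| ≤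
      |ν| * (padeK ν n * (3 * φ₁) ^ (2 * n + 1)) + n.centralBinom * |Real.sin φ₂| := by
    refine (abs_sub _ _).trans ?_
    rw [abs_mul, abs_mul]
    have := mul_le_mul_of_nonneg_left (Real.abs_cos_le_one φ₂)
      (abs_nonneg (padeE ν n (3 * φ₁)).im)
    have := mul_le_mul_of_nonneg_right h2 (abs_nonneg (Real.sin φ₂))
    linarith
  have h4 := A.theta_le
  have h5 : r₁ ^ 3 * (2 * (3 * φ₁)) ≤ 30003 / 10000 * (l * L) := by
    have := A.sin_left
    rw [A.r₁_cube]
    have : l * (y * (2 * (3 * φ₁))) ≤ l * (30003 / 10000 * L) := by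
      apply mul_le_mul_of_nonneg_left _ (by linarith)
      nlinarith
    linarith
  have h6 := A.abs_sin_right.2
  rw [abs_mul, abs_of_nonneg (show 0 ≤ 2 * r₂ * y ^ n by positivity)]
  generalize 3 * φ₁ = θ at *
  calc 2 * r₂ * y ^ n * |(padeE ν n θ).im * Real.cos φ₂ -
        (padeE ν n θ).re * Real.sin φ₂| * r₁ ^ 3 * r₂ ^ 2
      ≤ 2 * r₂ * y ^ n * (|ν| * (padeK ν n * θ ^ (2 * n + 1)) +
        n.centralBinom * |Real.sin φ₂|) * r₁ ^ 3 * r₂ ^ 2 := by gcongr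
    _ = |ν| * padeK ν n * r₂ ^ 3 * (y * θ ^ 2) ^ n * (r₁ ^ 3 * (2 * θ)) +
        n.centralBinom * y ^ n * r₁ ^ 3 * (2 * r₂ ^ 3 * |Real.sin φ₂|) := by ring
    _ ≤ |ν| * padeK ν n * r₂ ^ 3 * (y * θ ^ 2) ^ n * (30003 / 10000 * (l * L)) +
        n.centralBinom * y ^ n * r₁ ^ 3 * (10001 / 10000 * (l * L)) := by gcongr
    _ = _ := by ring

theorem re_pos {ν : ℝ} (hν : ν ^ 2 < 1) (n : ℕ) : 0 < (padeE ν n (3 * φ₁)).re := by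
  have h := le_padeE_re hν.le (show 0 ≤ 3 * φ₁ by linarith [A.φ₁_nonneg])
    (by linarith [A.φ₁_le]) n
  have hc := A.cos_left
  have : (0 : ℝ) < n.centralBinom := by exact_mod_cast n.centralBinom_pos
  exact lt_of_lt_of_le (by positivity) h

theorem sin_right_ne_zero : Real.sin φ₂ ≠ 0 := by
  intro h
  have := A.abs_sin_right.1
  rw [h] at this
  have := A.L_pos
  have := A.one_le_l
  simp at *
  nlinarith

theorem not_both_zero (n : ℕ)
    (h1 : (padeE (1 / 3) n (3 * φ₁)).im * Real.cos φ₂ -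
      (padeE (1 / 3) n (3 * φ₁)).re * Real.sin φ₂ = 0)
    (h2 : (padeE (-2 / 3) n (3 * φ₁)).im * Real.cos φ₂ -
      (padeE (-2 / 3) n (3 * φ₁)).re * Real.sin φ₂ = 0) : False := by
  have hc : 0 < Real.cos φ₂ := by linarith [A.cos_right]
  have hs := A.sin_right_ne_zero
  have hS := A.sin_pos
  have hR1 := A.re_pos (ν := 1 / 3) (by norm_num) n
  have hR2 := A.re_pos (ν := -2 / 3) (by norm_num) n
  have hG1 : 0 < padeG (1 / 3) n (3 * φ₁) := lt_of_lt_of_le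
    (mul_pos (padeK_pos (by norm_num) n) (pow_pos hS _))
    (padeG_bounds (by norm_num) (by norm_num) n _ (by linarith [A.φ₁_nonneg])
    (by linarith [A.φ₁_le])).1
  have hG2 : 0 < padeG (-2 / 3) n (3 * φ₁) := lt_of_lt_of_le
    (mul_pos (padeK_pos (by norm_num) n) (pow_pos hS _))
    (padeG_bounds (by norm_num) (by norm_num) n _ (by linarith [A.φ₁_nonneg])
    (by linarith [A.φ₁_le])).1
  have e1 : (padeE (1 / 3) n (3 * φ₁)).im = (-1) ^ n * (1 / 3) * padeG (1 / 3) n (3 * φ₁) := by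
    have : ((-1 : ℝ) ^ n) * (-1) ^ n = 1 := by rw [← mul_pow]; norm_num
    rw [padeG]
    linear_combination (-(padeE (1 / 3) n (3 * φ₁)).im) * this
  have e2 : (padeE (-2 / 3) n (3 * φ₁)).im = (-1) ^ n * (-2 / 3) * padeG (-2 / 3) n (3 * φ₁) := by
    have : ((-1 : ℝ) ^ n) * (-1) ^ n = 1 := by rw [← mul_pow]; norm_num
    rw [padeG]
    linear_combination (-(padeE (-2 / 3) n (3 * φ₁)).im) * this
  rw [e1] at h1
  rw [e2] at h2
  have hp1 := mul_pos hG1 hc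
  have hp2 := mul_pos hG2 hc
  rcases neg_one_pow_eq_or ℝ n with h | h <;> rw [h] at h1 h2 <;>
    rcases lt_or_gt_of_ne hs with h3 | h3
  · linarith [mul_neg_of_pos_of_neg hR1 h3]
  · linarith [mul_pos hR2 h3]
  · linarith [mul_neg_of_pos_of_neg hR2 h3]
  · linarith [mul_pos hR1 h3]

theorem third_zero (n : ℕ)
    (h1 : (padeE (1 / 3) n (3 * φ₁)).im * Real.cos φ₂ -
      (padeE (1 / 3) n (3 * φ₁)).re * Real.sin φ₂ = 0) :
    9999 * (padeK (1 / 3) n * Real.sin (3 * φ₁) ^ (2 * n) * r₂ ^ 3) ≤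
      10001 * (n.centralBinom * r₁ ^ 3) ∧
    10000 * (n.centralBinom * Real.cos (3 * φ₁) ^ (n + 1) * r₁ ^ 3) ≤
      10001 * (r₂ ^ 3 * padeK (1 / 3) n * (3 * φ₁) ^ (2 * n)) := by
  have hc := A.cos_right
  have hc1 := Real.cos_le_one φ₂
  have hR := A.re_pos (ν := 1 / 3) (by norm_num) n
  have hS := A.sin_pos
  obtain ⟨hi1, hi2⟩ := A.abs_im_le (ν := 1 / 3) (by norm_num) (by norm_num) n
  obtain ⟨hs1, hs2⟩ := A.abs_sin_right
  have hr := pow_pos A.r₂_pos 3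
  have hk := padeK_pos (show (1 / 3 : ℝ) ^ 2 < 1 by norm_num) n
  have hth := A.theta_le
  have hre1 := le_padeE_re (show (1 / 3 : ℝ) ^ 2 ≤ 1 by norm_num)
    (show 0 ≤ 3 * φ₁ by linarith [A.φ₁_nonneg]) (by linarith [A.φ₁_le]) n
  have hre2 : (padeE (1 / 3) n (3 * φ₁)).re ≤ n.centralBinom :=
    (le_abs_self _).trans ((Complex.abs_re_le_norm _).trans
      (norm_padeE_le (by norm_num) (by linarith [A.cos_left]) n))
  have h2 : |(padeE (1 / 3) n (3 * φ₁)).im| * Real.cos φ₂ =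
      (padeE (1 / 3) n (3 * φ₁)).re * |Real.sin φ₂| := by
    have := congrArg abs (sub_eq_zero.mp h1)
    rwa [abs_mul, abs_mul, abs_of_pos hR, abs_of_pos (show 0 < Real.cos φ₂ by linarith)] at this
  rw [abs_of_pos (show (0 : ℝ) < 1 / 3 by norm_num)] at hi1 hi2
  have hlL : 3 * (l * L) = 2 * r₁ ^ 3 * Real.sin (3 * φ₁) := by
    rw [A.r₁_cube]; linear_combination -l * A.sin_left
  have hnn := abs_nonneg (Real.sin φ₂)
  have hin := abs_nonneg (padeE (1 / 3) n (3 * φ₁)).im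
  have hcl := A.cos_left
  have hphi := A.φ₁_nonneg
  have hCn : (0 : ℝ) ≤ n.centralBinom := by positivity
  generalize (padeE (1 / 3) n (3 * φ₁)).re = Re at *
  generalize |(padeE (1 / 3) n (3 * φ₁)).im| = I at *
  generalize |Real.sin φ₂| = s at *
  generalize (n.centralBinom : ℝ) = C at *
  generalize padeK (1 / 3) n = k at *
  generalize Real.sin (3 * φ₁) = S at *
  generalize hθ : 3 * φ₁ = θ at *
  have hr1 := pow_pos A.r₁_pos 3
  constructor
  · have h3 : 1 / 3 * (k * S ^ (2 * n + 1)) * (9999 / 10000) ≤ I * Real.cos φ₂ := by gcongr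
    have h4 : Re * s ≤ C * s := by gcongr
    have h5 : 2 * r₂ ^ 3 * (1 / 3 * (k * S ^ (2 * n + 1)) * (9999 / 10000)) ≤
        C * (10001 / 10000 * (l * L)) := by
      calc 2 * r₂ ^ 3 * (1 / 3 * (k * S ^ (2 * n + 1)) * (9999 / 10000)) ≤
          2 * r₂ ^ 3 * (C * s) := mul_le_mul_of_nonneg_left (by linarith) (by positivity)
        _ = C * (2 * r₂ ^ 3 * s) := by ring
        _ ≤ _ := by gcongr
    have h6 : S * (9999 * (k * S ^ (2 * n) * r₂ ^ 3)) ≤ S * (10001 * (C * r₁ ^ 3)) := by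
      rw [show l * L = 2 / 3 * r₁ ^ 3 * S by linarith] at h5
      rw [pow_succ S] at h5
      linarith
    exact le_of_mul_le_mul_left h6 hS
  · have h3 : I * Real.cos φ₂ ≤ 1 / 3 * (k * θ ^ (2 * n + 1)) := by
      calc I * Real.cos φ₂ ≤ I * 1 := by gcongr
        _ ≤ _ := by linarith
    have h4 : C * Real.cos θ ^ (n + 1) * s ≤ Re * s := by gcongr
    have hcos : 0 ≤ Real.cos θ := by linarith
    have hθ0 : 0 ≤ θ := by linarith
    have h5 : C * Real.cos θ ^ (n + 1) * (l * L) ≤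
        2 * r₂ ^ 3 * (1 / 3 * (k * θ ^ (2 * n + 1))) := by
      calc C * Real.cos θ ^ (n + 1) * (l * L) ≤ C * Real.cos θ ^ (n + 1) * (2 * r₂ ^ 3 * s) := by
            gcongr
        _ = 2 * r₂ ^ 3 * (C * Real.cos θ ^ (n + 1) * s) := by ring
        _ ≤ _ := mul_le_mul_of_nonneg_left (by linarith) (by positivity)
    have h6 : S * (10000 * (C * Real.cos θ ^ (n + 1) * r₁ ^ 3)) ≤
        S * (10001 * (r₂ ^ 3 * k * θ ^ (2 * n))) := by
      rw [show l * L = 2 / 3 * r₁ ^ 3 * S by linarith] at h5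
      have h7 : 10000 * (r₂ ^ 3 * k * θ ^ (2 * n) * θ) ≤
          10000 * (r₂ ^ 3 * k * θ ^ (2 * n) * (10001 / 10000 * S)) := by gcongr
      rw [pow_succ θ] at h5
      linarith
    exact le_of_mul_le_mul_left h6 hS

/-- The case where the first Padé approximation degenerates. -/
theorem degenerate_false {n : ℕ} (hn : 2 ≤ n)
    (h1 : (padeE (1 / 3) n (3 * φ₁)).im * Real.cos φ₂ -
      (padeE (1 / 3) n (3 * φ₁)).re * Real.sin φ₂ = 0)
    (hE : r₁ * r₂ ^ 2 ≤ 20002 / 10000 * padeK (-2 / 3) n * r₂ ^ 3 * (y * (3 * φ₁) ^ 2) ^ n +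
        10001 / 10000 * n.centralBinom * y ^ n * r₁ ^ 3) : False := by
  obtain ⟨hU, hLo⟩ := A.third_zero n h1
  have hS := A.sin_pos
  have hθ1 := A.theta_le
  have hθ2 := A.sin_le_theta
  have hw := A.y_theta
  have hc := A.cos_left
  have hk := padeK_pos (show (1 / 3 : ℝ) ^ 2 < 1 by norm_num) n
  have hk1 := le_padeK n
  have hk2 := padeK_third_le hn
  have hk' := padeK_pos (show (-2 / 3 : ℝ) ^ 2 < 1 by norm_num) n
  have hk'2 := padeK_neg_two_thirds_le hn
  have hC := centralBinom_le hn
  have hC0 : (0 : ℝ) < n.centralBinom := by exact_mod_cast n.centralBinom_pos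
  have hr1 := A.r₁_pos
  have hr2 := A.r₂_pos
  have hy := A.y_ge
  generalize (n.centralBinom : ℝ) = C at *
  generalize padeK (1 / 3) n = k at *
  generalize padeK (-2 / 3) n = k' at *
  generalize Real.sin (3 * φ₁) = S at *
  generalize Real.cos (3 * φ₁) = c at *
  generalize hθ : 3 * φ₁ = θ at *
  have hθ0 : 0 < θ := by linarith
  have hT0 : 0 ≤ y * θ ^ 2 := by positivity
  rcases le_total (r₁ * r₂ ^ 2) (40004 / 10000 * k' * r₂ ^ 3 * (y * θ ^ 2) ^ n) with h | h
  · have h2 : r₁ ≤ 40004 / 10000 * k' * r₂ * (y * θ ^ 2) ^ n := by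
      have : r₂ ^ 2 * r₁ ≤ r₂ ^ 2 * (40004 / 10000 * k' * r₂ * (y * θ ^ 2) ^ n) := by linarith
      exact le_of_mul_le_mul_left this (by positivity)
    have h3 : r₁ ^ 3 ≤ (40004 / 10000) ^ 3 * k' ^ 3 * r₂ ^ 3 * ((y * θ ^ 2) ^ 3) ^ n := by
      calc r₁ ^ 3 ≤ (40004 / 10000 * k' * r₂ * (y * θ ^ 2) ^ n) ^ 3 := by gcongr
        _ = _ := by ring
    have h4 : (y * θ ^ 2) ^ 3 ≤ 892 / 10000 * S ^ 2 := by
      have : θ ^ 2 ≤ (10001 / 10000 * S) ^ 2 := by gcongr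
      calc (y * θ ^ 2) ^ 3 = y ^ 3 * θ ^ 4 * θ ^ 2 := by ring
        _ ≤ 891 / 10000 * (10001 / 10000 * S) ^ 2 := by gcongr
        _ ≤ _ := by nlinarith [sq_nonneg S]
    have h5 : r₁ ^ 3 * (k * S ^ (2 * n)) ≤ r₁ ^ 3 * (65 * k' ^ 3 * C * (892 / 10000) ^ n * S ^ (2 * n)) := by
      calc r₁ ^ 3 * (k * S ^ (2 * n)) ≤
          (40004 / 10000) ^ 3 * k' ^ 3 * r₂ ^ 3 * ((y * θ ^ 2) ^ 3) ^ n * (k * S ^ (2 * n)) := by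
            gcongr
        _ = (40004 / 10000) ^ 3 * k' ^ 3 * ((y * θ ^ 2) ^ 3) ^ n * (k * S ^ (2 * n) * r₂ ^ 3) := by
            ring
        _ ≤ (40004 / 10000) ^ 3 * k' ^ 3 * (892 / 10000 * S ^ 2) ^ n *
            (10001 / 9999 * (C * r₁ ^ 3)) :=
            mul_le_mul (by gcongr) (by linarith) (by positivity) (by positivity)
        _ = r₁ ^ 3 * ((40004 / 10000) ^ 3 * (10001 / 9999) * (k' ^ 3 * C * (892 / 10000) ^ n *
            S ^ (2 * n))) := by rw [mul_pow, ← pow_mul]; ring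
        _ ≤ r₁ ^ 3 * (65 * (k' ^ 3 * C * (892 / 10000) ^ n * S ^ (2 * n))) := by
            gcongr; norm_num
        _ = _ := by ring
    have h6 := le_of_mul_le_mul_left h5 (by positivity)
    have h7 : k ≤ 65 * k' ^ 3 * C * (892 / 10000) ^ n := le_of_mul_le_mul_right h6 (by positivity)
    have h8 : (1 / 2 : ℝ) ^ n ≤ 65 * (27 / 100) ^ 3 * (3 / 8) * (3568 / 10000) ^ n := by
      calc (1 / 2 : ℝ) ^ n ≤ 65 * k' ^ 3 * C * (892 / 10000) ^ n := by linarith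
        _ ≤ 65 * (27 / 100) ^ 3 * (3 / 8 * 4 ^ n) * (892 / 10000) ^ n := by gcongr
        _ = 65 * (27 / 100) ^ 3 * (3 / 8) * (4 * (892 / 10000)) ^ n := by rw [mul_pow]; ring
        _ = _ := by norm_num
    have h9 : (3568 / 10000 : ℝ) ^ n ≤ (1 / 2) ^ n :=
      pow_le_pow_left₀ (by norm_num) (by norm_num) n
    have h10 : (0 : ℝ) < (1 / 2) ^ n := by positivity
    linarith
  · have h2 : r₂ ^ 2 ≤ 20003 / 10000 * C * y ^ n * r₁ ^ 2 := by
      have : r₁ * r₂ ^ 2 ≤ r₁ * (20003 / 10000 * C * y ^ n * r₁ ^ 2) := by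
        have : 0 ≤ C * y ^ n * r₁ ^ 3 := by positivity
        linarith
      exact le_of_mul_le_mul_left this hr1
    have h3 : r₂ ^ 6 ≤ 801 / 100 * C ^ 3 * (y ^ 3) ^ n * r₁ ^ 6 := by
      calc r₂ ^ 6 = (r₂ ^ 2) ^ 3 := by ring
        _ ≤ (20003 / 10000 * C * y ^ n * r₁ ^ 2) ^ 3 := by gcongr
        _ = (20003 / 10000) ^ 3 * (C ^ 3 * (y ^ 3) ^ n * r₁ ^ 6) := by ring
        _ ≤ 801 / 100 * (C ^ 3 * (y ^ 3) ^ n * r₁ ^ 6) := by gcongr; norm_num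
        _ = _ := by ring
    have hcn : (9996 / 10000 : ℝ) ^ (n + 1) ≤ (c ^ 2) ^ (n + 1) := by
      gcongr; nlinarith
    have h4 : C ^ 2 * r₁ ^ 6 * (9996 / 10000) ^ (n + 1) ≤
        C ^ 2 * r₁ ^ 6 * (802 / 100 * C * k ^ 2 * (y ^ 3 * θ ^ 4) ^ n) := by
      calc C ^ 2 * r₁ ^ 6 * (9996 / 10000) ^ (n + 1) ≤ C ^ 2 * r₁ ^ 6 * (c ^ 2) ^ (n + 1) := by
            gcongr
        _ = (C * c ^ (n + 1) * r₁ ^ 3) ^ 2 := by ring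
        _ ≤ (10001 / 10000 * (r₂ ^ 3 * k * θ ^ (2 * n))) ^ 2 := by
            refine pow_le_pow_left₀ (by positivity) (by linarith) 2
        _ = (10001 / 10000) ^ 2 * (k ^ 2 * (θ ^ 4) ^ n * r₂ ^ 6) := by ring
        _ ≤ (10001 / 10000) ^ 2 * (k ^ 2 * (θ ^ 4) ^ n *
            (801 / 100 * C ^ 3 * (y ^ 3) ^ n * r₁ ^ 6)) := by gcongr
        _ = (10001 / 10000) ^ 2 * (801 / 100) *
            (C ^ 2 * r₁ ^ 6 * (C * k ^ 2 * (y ^ 3 * θ ^ 4) ^ n)) := by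
            rw [mul_pow (y ^ 3)]; ring
        _ ≤ 802 / 100 * (C ^ 2 * r₁ ^ 6 * (C * k ^ 2 * (y ^ 3 * θ ^ 4) ^ n)) := by
            gcongr; norm_num
        _ = _ := by ring
    have h5 := le_of_mul_le_mul_left h4 (by positivity)
    have h6 : (9996 / 10000 : ℝ) ^ (n + 1) ≤
        802 / 100 * (3 / 8) * (47 / 100) ^ 2 * (3564 / 10000) ^ n := by
      calc (9996 / 10000 : ℝ) ^ (n + 1) ≤ 802 / 100 * C * k ^ 2 * (y ^ 3 * θ ^ 4) ^ n := h5
        _ ≤ 802 / 100 * (3 / 8 * 4 ^ n) * (47 / 100) ^ 2 * (891 / 10000) ^ n := by gcongr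
        _ = 802 / 100 * (3 / 8) * (47 / 100) ^ 2 * (4 * (891 / 10000)) ^ n := by
            rw [mul_pow]; ring
        _ = _ := by norm_num
    have h9 : (3564 / 10000 : ℝ) ^ n ≤ (9996 / 10000) ^ n :=
      pow_le_pow_left₀ (by norm_num) (by norm_num) n
    have h10 : (0 : ℝ) < (9996 / 10000) ^ n := by positivity
    rw [pow_succ] at h6
    linarith

/-- The generic case of the Padé argument. -/
theorem generic_false {n : ℕ} (hn : 2 ≤ n)
    (hE : r₁ ^ 2 * r₂ ^ 2 ≤ 10001 / 10000 * padeK (1 / 3) n * r₂ ^ 3 * (y * (3 * φ₁) ^ 2) ^ n +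
        10001 / 10000 * n.centralBinom * y ^ n * r₁ ^ 3)
    (hlo : 3 / 4 * 4 ^ n * r₁ * y ^ n ≤ r₂ ^ 2)
    (hhi : r₂ ^ 2 ≤ 3 / 4 * 4 ^ (n + 1) * r₁ * y ^ (n + 1)) : False := by
  have hw := A.y_theta
  have hk := padeK_pos (show (1 / 3 : ℝ) ^ 2 < 1 by norm_num) n
  have hk2 := padeK_third_le hn
  have hC := centralBinom_le hn
  have hC0 : (0 : ℝ) < n.centralBinom := by exact_mod_cast n.centralBinom_pos
  have hr1 := A.r₁_pos
  have hr2 := A.r₂_pos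
  have hy := A.y_ge
  have hl := A.one_le_l
  have hc := A.r₁_cube
  have hθ0 := A.φ₁_nonneg
  generalize (n.centralBinom : ℝ) = C at *
  generalize padeK (1 / 3) n = k at *
  generalize hθ : 3 * φ₁ = θ at *
  have hT0 : 0 ≤ (y * θ ^ 2) ^ n := by positivity
  have h1 : C * y ^ n * r₁ ^ 3 ≤ 1 / 2 * (r₁ ^ 2 * r₂ ^ 2) := by
    calc C * y ^ n * r₁ ^ 3 ≤ 3 / 8 * 4 ^ n * y ^ n * r₁ ^ 3 := by gcongr
      _ = 1 / 2 * (r₁ ^ 2 * (3 / 4 * 4 ^ n * r₁ * y ^ n)) := by ring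
      _ ≤ _ := by gcongr
  have h2 : k * r₂ ^ 3 * (y * θ ^ 2) ^ n ≤ 47 / 100 * r₂ ^ 3 * (y * θ ^ 2) ^ n := by gcongr
  have h3 : r₂ ^ 2 * r₁ ^ 2 ≤ r₂ ^ 2 * (941 / 1000 * r₂ * (y * θ ^ 2) ^ n) := by
    have : 0 ≤ r₂ ^ 3 * (y * θ ^ 2) ^ n := by positivity
    linarith
  have h4 := le_of_mul_le_mul_left h3 (by positivity)
  have h5 : r₁ * (r₁ ^ 3) ≤ r₁ * (y * (8 / 10)) := by
    calc r₁ * (r₁ ^ 3) = (r₁ ^ 2) ^ 2 := by ring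
      _ ≤ (941 / 1000 * r₂ * (y * θ ^ 2) ^ n) ^ 2 := by gcongr
      _ = (941 / 1000) ^ 2 * r₂ ^ 2 * ((y * θ ^ 2) ^ n) ^ 2 := by ring
      _ ≤ (941 / 1000) ^ 2 * (3 / 4 * 4 ^ (n + 1) * r₁ * y ^ (n + 1)) * ((y * θ ^ 2) ^ n) ^ 2 := by
          gcongr
      _ = (941 / 1000) ^ 2 * 3 * r₁ * y * (4 * (y ^ 3 * θ ^ 4)) ^ n := by
          rw [mul_pow 4, mul_pow (y ^ 3)]; ring
      _ ≤ (941 / 1000) ^ 2 * 3 * r₁ * y * (4 * (891 / 10000)) ^ n := by gcongr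
      _ ≤ (941 / 1000) ^ 2 * 3 * r₁ * y * (4 * (891 / 10000)) ^ 2 := by
          gcongr ?_ * ?_
          exact pow_le_pow_of_le_one (by norm_num) (by norm_num) hn
      _ ≤ _ := by
          have : 0 < r₁ * y := by positivity
          linarith
  have h6 := le_of_mul_le_mul_left h5 hr1
  nlinarith

theorem r₁_ge : 8 ≤ r₁ := by
  by_contra hc
  push Not at hc
  have h1 : r₁ ^ 3 < 8 ^ 3 := pow_lt_pow_left₀ hc A.r₁_pos.le (by norm_num)
  have h2 := A.r₁_cube
  have h3 := A.y_ge
  have h4 := A.one_le_l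
  nlinarith

theorem int_le {n : ℕ} {e : ℝ}
    (he : 2 * (r₂ * r₁ ^ (3 * n + 1) * ((padeE (1 / 3) n (3 * φ₁)).im * Real.cos φ₂ -
      (padeE (1 / 3) n (3 * φ₁)).re * Real.sin φ₂)) = l ^ (n + 1) * (L * e)) :
    |e| * (r₁ ^ 2 * r₂ ^ 2) ≤ 10001 / 10000 * padeK (1 / 3) n * r₂ ^ 3 * (y * (3 * φ₁) ^ 2) ^ n +
        10001 / 10000 * n.centralBinom * y ^ n * r₁ ^ 3 := by
  have h := A.estimate (ν := 1 / 3) (by norm_num) (by norm_num) n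
  have hl := A.one_le_l
  have hL := A.L_pos
  have hr := A.r₁_pos
  have h1 : 2 * r₂ * y ^ n * ((padeE (1 / 3) n (3 * φ₁)).im * Real.cos φ₂ -
      (padeE (1 / 3) n (3 * φ₁)).re * Real.sin φ₂) * r₁ = l * L * e := by
    have : l ^ n * (2 * r₂ * y ^ n * ((padeE (1 / 3) n (3 * φ₁)).im * Real.cos φ₂ -
      (padeE (1 / 3) n (3 * φ₁)).re * Real.sin φ₂) * r₁) = l ^ n * (l * L * e) := by
      rw [pow_succ r₁, pow_mul, A.r₁_cube, mul_pow] at he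
      linear_combination he
    exact mul_left_cancel₀ (by positivity) this
  have h2 := congrArg abs h1
  rw [abs_mul, abs_of_pos hr, abs_mul (l * L), abs_of_pos (show 0 < l * L by positivity)] at h2
  rw [abs_of_pos (show (0 : ℝ) < 1 / 3 by norm_num)] at h
  refine le_of_mul_le_mul_left ?_ (show 0 < l * L by positivity)
  calc l * L * (|e| * (r₁ ^ 2 * r₂ ^ 2)) = (l * L * |e|) * (r₁ ^ 2 * r₂ ^ 2) := by ring
    _ ≤ _ := by
      rw [← h2]
      refine le_trans (le_of_eq (by ring)) (h.trans (le_of_eq (by ring)))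

theorem int_le' {n : ℕ} {e : ℝ}
    (he : 2 * (r₂ * r₁ ^ (3 * n + 2) * ((padeE (-2 / 3) n (3 * φ₁)).im * Real.cos φ₂ -
      (padeE (-2 / 3) n (3 * φ₁)).re * Real.sin φ₂)) = l ^ (n + 1) * (L * e)) :
    |e| * (r₁ * r₂ ^ 2) ≤ 20002 / 10000 * padeK (-2 / 3) n * r₂ ^ 3 * (y * (3 * φ₁) ^ 2) ^ n +
        10001 / 10000 * n.centralBinom * y ^ n * r₁ ^ 3 := by
  have h := A.estimate (ν := -2 / 3) (by norm_num) (by norm_num) n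
  have hl := A.one_le_l
  have hL := A.L_pos
  have hr := A.r₁_pos
  have h1 : 2 * r₂ * y ^ n * ((padeE (-2 / 3) n (3 * φ₁)).im * Real.cos φ₂ -
      (padeE (-2 / 3) n (3 * φ₁)).re * Real.sin φ₂) * r₁ ^ 2 = l * L * e := by
    have : l ^ n * (2 * r₂ * y ^ n * ((padeE (-2 / 3) n (3 * φ₁)).im * Real.cos φ₂ -
      (padeE (-2 / 3) n (3 * φ₁)).re * Real.sin φ₂) * r₁ ^ 2) = l ^ n * (l * L * e) := by
      rw [pow_add r₁, pow_mul, A.r₁_cube, mul_pow] at he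
      linear_combination he
    exact mul_left_cancel₀ (by positivity) this
  have h2 := congrArg abs h1
  rw [abs_mul, abs_of_pos (pow_pos hr 2), abs_mul (l * L),
    abs_of_pos (show 0 < l * L by positivity)] at h2
  rw [abs_of_neg (show (-2 / 3 : ℝ) < 0 by norm_num)] at h
  refine le_of_mul_le_mul_left ?_ (show 0 < l * L by positivity)
  calc l * L * (|e| * (r₁ * r₂ ^ 2)) = (l * L * |e|) * (r₁ * r₂ ^ 2) := by ring
    _ ≤ _ := by
      rw [← h2]
      refine le_trans (le_of_eq (by ring)) (h.trans (le_of_eq (by ring)))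

theorem exists_degree (h : 12 * r₁ * y ^ 2 ≤ r₂ ^ 2) : ∃ n : ℕ, 2 ≤ n ∧
    3 / 4 * 4 ^ n * r₁ * y ^ n ≤ r₂ ^ 2 ∧ r₂ ^ 2 ≤ 3 / 4 * 4 ^ (n + 1) * r₁ * y ^ (n + 1) := by
  by_contra hc
  push Not at hc
  have hy := A.y_ge
  have hr := A.r₁_ge
  have h1 : ∀ n : ℕ, 2 ≤ n → 3 / 4 * 4 ^ n * r₁ * y ^ n ≤ r₂ ^ 2 := by
    intro n hn
    induction n, hn using Nat.le_induction with
    | base => linarith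
    | succ n hn ih => exact (hc n hn ih).le
  obtain ⟨n, hn⟩ := pow_unbounded_of_one_lt (r₂ ^ 2) (show (1 : ℝ) < 4 by norm_num)
  have h2 := h1 (n + 2) (by omega)
  have h3 : (1 : ℝ) ≤ y ^ (n + 2) := one_le_pow₀ (by linarith)
  have h4 : (4 : ℝ) ^ n * (12 * 8) ≤ 3 / 4 * 4 ^ (n + 2) * r₁ * y ^ (n + 2) := by
    calc (4 : ℝ) ^ n * (12 * 8) = 3 / 4 * 4 ^ (n + 2) * 8 * 1 := by rw [pow_add]; ring
      _ ≤ _ := by gcongr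
  have h5 : (0 : ℝ) < 4 ^ n := by positivity
  linarith

theorem r₂_ge {m : ℝ} (hm : 1 ≤ |m|)
    (h : |m| * (r₁ ^ 2 * r₂ ^ 2) ≤ 10001 / 10000 * (r₂ ^ 3 + r₁ ^ 3)) :
    997 / 1000 * r₁ ^ 2 ≤ r₂ := by
  have hr := A.r₁_ge
  have hr2 := A.r₁_le
  have hp := A.r₂_pos
  have h0 : r₁ ^ 2 * r₂ ^ 2 ≤ 10001 / 10000 * (r₂ ^ 3 + r₁ ^ 3) := by
    have : 0 ≤ r₁ ^ 2 * r₂ ^ 2 := by positivity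
    nlinarith
  have h1 : r₁ ^ 2 ≤ 10001 / 10000 * (r₂ + r₁) := by
    have h3 : r₁ ^ 3 ≤ r₁ * r₂ ^ 2 := by
      rw [show r₁ ^ 3 = r₁ * r₁ ^ 2 by ring]; gcongr
    have : r₂ ^ 2 * r₁ ^ 2 ≤ r₂ ^ 2 * (10001 / 10000 * (r₂ + r₁)) := by linarith
    exact le_of_mul_le_mul_left this (by positivity)
  have h2 : 6 * r₁ ≤ r₂ := by nlinarith
  have h3 : r₁ ^ 2 ≤ 10001 / 10000 * (r₂ + r₁ / 36) := by
    have h3 : r₁ * (6 * r₁) ^ 2 ≤ r₁ * r₂ ^ 2 := by gcongr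
    have : r₂ ^ 2 * r₁ ^ 2 ≤ r₂ ^ 2 * (10001 / 10000 * (r₂ + r₁ / 36)) := by linarith
    exact le_of_mul_le_mul_left this (by positivity)
  have h4 : 69 / 10 * r₁ ≤ r₂ := by nlinarith
  have h5 : r₁ ^ 2 ≤ 10001 / 10000 * (r₂ + r₁ / 47) := by
    have h3 : r₁ * (69 / 10 * r₁) ^ 2 ≤ r₁ * r₂ ^ 2 := by gcongr
    have h6 : 0 < r₁ ^ 3 := by positivity
    have : r₂ ^ 2 * r₁ ^ 2 ≤ r₂ ^ 2 * (10001 / 10000 * (r₂ + r₁ / 47)) := by linarith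
    exact le_of_mul_le_mul_left this (by positivity)
  nlinarith

/-- The second integer is bounded when the two solutions are close. -/
theorem int_one_lt {b : ℝ} (hr : 997 / 1000 * r₁ ^ 2 ≤ r₂) (hlt : r₂ ^ 2 ≤ 12 * r₁ * y ^ 2)
    (hb : |b| * (r₁ ^ 2 * r₂ ^ 2) ≤ 10001 / 10000 * (593 / 1000) * r₂ ^ 3 * (y * (3 * φ₁) ^ 2) +
      20002 / 10000 * y * r₁ ^ 3) {c : ℝ} (hc0 : 0 ≤ c) (hc : 3764 / 10000 ≤ c ^ 2 * l) :
    |b| ≤ c + 2013 / 1000 / l ∧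
    |b| * r₂ ^ 2 ≤ c * r₂ ^ 2 + 20002 / 10000 * r₁ ^ 4 / l := by
  have hl := A.one_le_l
  have hy := A.y_ge
  have hw := A.y_theta
  have h1 := A.r₁_pos
  have h2 := A.r₂_pos
  have hcube := A.r₁_cube
  have hyl : y = r₁ ^ 3 / l := by rw [hcube]; field_simp
  have h3 : (10001 / 10000 * (593 / 1000) * r₂ * (y * (3 * φ₁) ^ 2)) ^ 2 ≤ (c * r₁ ^ 2) ^ 2 := by
    calc (10001 / 10000 * (593 / 1000) * r₂ * (y * (3 * φ₁) ^ 2)) ^ 2 =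
        (10001 / 10000 * (593 / 1000)) ^ 2 * r₂ ^ 2 * (y ^ 2 * (3 * φ₁) ^ 4) := by ring
      _ ≤ (10001 / 10000 * (593 / 1000)) ^ 2 * (12 * r₁ * y ^ 2) * (y ^ 2 * (3 * φ₁) ^ 4) := by
        gcongr
      _ = (10001 / 10000 * (593 / 1000)) ^ 2 * 12 * r₁ * y * (y ^ 3 * (3 * φ₁) ^ 4) := by ring
      _ ≤ (10001 / 10000 * (593 / 1000)) ^ 2 * 12 * r₁ * y * (891 / 10000) := by gcongr
      _ = r₁ * y * ((10001 / 10000 * (593 / 1000)) ^ 2 * 12 * (891 / 10000)) := by ring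
      _ ≤ r₁ * y * (c ^ 2 * l) := by
        refine mul_le_mul_of_nonneg_left (le_trans (by norm_num) hc) (by positivity)
      _ = c ^ 2 * r₁ * (l * y) := by ring
      _ = _ := by rw [← hcube]; ring
  have h4 : 10001 / 10000 * (593 / 1000) * r₂ * (y * (3 * φ₁) ^ 2) ≤ c * r₁ ^ 2 :=
    le_of_sq_le_sq h3 (by positivity)
  have h5 : |b| * r₂ ^ 2 ≤ c * r₂ ^ 2 + 20002 / 10000 * r₁ ^ 4 / l := by
    have : r₁ ^ 2 * (|b| * r₂ ^ 2) ≤ r₁ ^ 2 * (c * r₂ ^ 2 + 20002 / 10000 * r₁ ^ 4 / l) := by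
      calc r₁ ^ 2 * (|b| * r₂ ^ 2) = |b| * (r₁ ^ 2 * r₂ ^ 2) := by ring
        _ ≤ 10001 / 10000 * (593 / 1000) * r₂ ^ 3 * (y * (3 * φ₁) ^ 2) +
            20002 / 10000 * y * r₁ ^ 3 := hb
        _ = r₂ ^ 2 * (10001 / 10000 * (593 / 1000) * r₂ * (y * (3 * φ₁) ^ 2)) +
            20002 / 10000 * y * r₁ ^ 3 := by ring
        _ ≤ r₂ ^ 2 * (c * r₁ ^ 2) + 20002 / 10000 * y * r₁ ^ 3 := by gcongr
        _ = _ := by rw [hyl]; ring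
    exact le_of_mul_le_mul_left this (by positivity)
  refine ⟨?_, h5⟩
  have h6 : (997 / 1000 * r₁ ^ 2) ^ 2 ≤ r₂ ^ 2 := by gcongr
  have h7 : r₂ ^ 2 * |b| ≤ r₂ ^ 2 * (c + 2013 / 1000 / l) := by
    have : 20002 / 10000 * r₁ ^ 4 / l ≤ 2013 / 1000 * r₂ ^ 2 / l := by
      gcongr ?_ / l
      have : 0 < r₁ ^ 4 := by positivity
      linarith
    calc r₂ ^ 2 * |b| ≤ c * r₂ ^ 2 + 20002 / 10000 * r₁ ^ 4 / l := by linarith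
      _ ≤ c * r₂ ^ 2 + 2013 / 1000 * r₂ ^ 2 / l := by linarith
      _ = _ := by ring
  exact le_of_mul_le_mul_left h7 (by positivity)

/-- The first integer is `±1` when the second one is `±2`. -/
theorem int_zero_lt {m : ℝ} (hr : 997 / 1000 * r₁ ^ 2 ≤ r₂) (hb : 2 * r₂ ^ 2 ≤ 614 / 1000 * r₂ ^ 2 +
      20002 / 10000 * r₁ ^ 4)
    (h : |m| * (r₁ ^ 2 * r₂ ^ 2) ≤ 10001 / 10000 * (r₂ ^ 3 + r₁ ^ 3)) : |m| < 2 := by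
  have h1 := A.r₁_ge
  have h2 := A.r₂_pos
  have h3 : r₂ ≤ 1202 / 1000 * r₁ ^ 2 := by
    refine le_of_sq_le_sq ?_ (by positivity)
    have : 0 < r₁ ^ 4 := by positivity
    linarith
  by_contra hc
  push Not at hc
  have h4 : 2 * (r₁ ^ 2 * r₂ ^ 2) ≤ 10001 / 10000 * (r₂ ^ 3 + r₁ ^ 3) := by
    refine le_trans ?_ h
    gcongr
  have h5 : r₂ ^ 3 ≤ r₂ ^ 2 * (1202 / 1000 * r₁ ^ 2) := by
    rw [pow_succ]; gcongr
  have h6 : (997 / 1000 * r₁ ^ 2) ^ 2 * r₁ ^ 2 ≤ r₂ ^ 2 * r₁ ^ 2 := by gcongr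
  have h7 : r₁ ^ 3 * 512 ≤ r₁ ^ 6 := by
    have : (8 : ℝ) ^ 3 ≤ r₁ ^ 3 := by gcongr
    calc r₁ ^ 3 * 512 ≤ r₁ ^ 3 * r₁ ^ 3 := by gcongr; linarith
      _ = _ := by ring
  have : 0 < r₁ ^ 6 := by positivity
  linarith

end PadeAngles

namespace PadePair

variable {lam D : ℤ} {ξ η : ℂ} {h k G G₂ F F₂ U m p q : ℤ}

theorem G_sq_ge (P : PadePair lam D ξ η h k G G₂ 1 F₂ U m p q) (hD : 1 ≤ D) (hlam : lam ≠ 0)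
    (hh : 512 ^ 2 * D ^ 4 * lam ^ 2 ≤ h ^ 3) : 4 * 512 ^ 2 * D ^ 4 ≤ G ^ 2 + 27 * D := by
  have h1 := P.cube_norm (by omega)
  have h2 : 0 < lam ^ 2 := by positivity
  have h3 : lam ^ 2 * (4 * 512 ^ 2 * D ^ 4) ≤ lam ^ 2 * (G ^ 2 + 27 * D) := by linarith
  exact le_of_mul_le_mul_left h3 h2

theorem abs_G_gt (P : PadePair lam D ξ η h k G G₂ 1 F₂ U m p q) (hD : 1 ≤ D) (hlam : lam ≠ 0)
    (hh : 512 ^ 2 * D ^ 4 * lam ^ 2 ≤ h ^ 3) : 100 * D < |G| := by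
  have h1 := P.G_sq_ge hD hlam hh
  refine lt_of_pow_lt_pow_left₀ 2 (abs_nonneg _) ?_
  rw [sq_abs]
  have h2 : D * 1 ≤ D ^ 2 := by nlinarith
  have h3 : D ^ 2 * 1 ≤ D ^ 4 := by nlinarith
  nlinarith

theorem int_one_ne_zero (P : PadePair lam D ξ η h k G G₂ 1 F₂ U m p q) (hD : 1 ≤ D)
    (hlam : lam ≠ 0) (hF : F₂ = 1 ∨ F₂ = -1) (hh : 512 ^ 2 * D ^ 4 * lam ^ 2 ≤ h ^ 3) :
    m * G - U ≠ 0 := by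
  intro hb
  have h1 := P.polar_cube (by omega) hlam
  have h2 := P.abs_G_gt hD hlam hh
  obtain rfl : U = m * G := by omega
  have h3 : G ∣ 27 * D := by
    refine ⟨-G - F₂ * (4 * lam * D * m ^ 3), ?_⟩
    have hF2 : F₂ * F₂ = 1 := by rcases hF with rfl | rfl <;> norm_num
    have : 2 * (27 * D) = 2 * (G * (-G - F₂ * (4 * lam * D * m ^ 3))) := by
      linear_combination (-(2 * (G ^ 2 + 27 * D))) * hF2 + F₂ * h1
    linarith
  have h4 := Int.le_of_dvd (by omega) ((abs_dvd _ _).mpr h3)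
  omega

theorem int_one_ne_two (P : PadePair 1 D ξ η h k G G₂ 1 F₂ U m p q) (hD : 1 ≤ D)
    (hF : F₂ = 1 ∨ F₂ = -1) (hh : 512 ^ 2 * D ^ 4 ≤ h ^ 3) (hm : m = 1 ∨ m = -1) :
    ¬ (m * G - U = 2 ∨ m * G - U = -2) := by
  intro hb
  have h1 := P.polar_cube (by omega) one_ne_zero
  have h2 := P.abs_G_gt hD one_ne_zero (by linarith)
  have key : ∀ u ε f : ℤ, (ε = 1 ∨ ε = -1) → (f = 1 ∨ f = -1) →
      2 * f * ((u + 2 * ε) ^ 2 + 27 * D) =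
        u ^ 3 - 9 * D * u - (u + 2 * ε) * u ^ 2 + (u + 2 * ε) * D → |u| ≤ 13 * D + 2 := by
    intro u ε f hε hf h
    have hε2 : ε * ε = 1 := by rcases hε with rfl | rfl <;> norm_num
    have hcase : f = -ε ∨ f = ε := by omega
    rcases hcase with rfl | rfl
    · have h3 : u * (D - 1) = ε * (1 + 7 * D) := by
        have : 8 * (u * (D - 1)) = 8 * (ε * (1 + 7 * D)) := by
          linear_combination h + 8 * (u + ε) * hε2
        linarith
      have h4 := congrArg abs h3
      rw [abs_mul, abs_mul, show |ε| = 1 by rcases hε with rfl | rfl <;> norm_num,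
        abs_of_nonneg (show 0 ≤ D - 1 by omega), abs_of_nonneg (show 0 ≤ 1 + 7 * D by omega)] at h4
      have h5 := abs_nonneg u
      have : 1 ≤ D - 1 := by
        by_contra hc
        rw [show D = 1 by omega] at h4
        omega
      nlinarith
    · have h3 : u ∣ 13 * D + 2 := by
        refine ⟨-u - 2 * f * (D + 1), ?_⟩
        have : 4 * (13 * D + 2) = 4 * (u * (-u - 2 * f * (D + 1))) := by
          linear_combination f * h - (4 * u ^ 2 + 52 * D + 8 * f * u + 8 * (f * f + 1)) * hε2
        linarith
      exact Int.le_of_dvd (by omega) ((abs_dvd _ _).mpr h3)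
  have hm2 : m * m = 1 := by rcases hm with rfl | rfl <;> norm_num
  have hG : ∃ ε : ℤ, (ε = 1 ∨ ε = -1) ∧ G = m * U + 2 * ε := by
    rcases hm with rfl | rfl <;> rcases hb with hb | hb
    · exact ⟨1, by omega, by omega⟩
    · exact ⟨-1, by omega, by omega⟩
    · exact ⟨-1, by omega, by omega⟩
    · exact ⟨1, by omega, by omega⟩
  obtain ⟨ε, hε, rfl⟩ := hG
  have h3 := key (m * U) ε (m * F₂) hε (by rcases hm with rfl | rfl <;> omega) (by
    rcases hm with rfl | rfl <;> linarith)
  have h4 := abs_add_le (m * U) (2 * ε)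
  have h5 : |2 * ε| = 2 := by rcases hε with rfl | rfl <;> norm_num
  omega

theorem even_int_one (P : PadePair lam D ξ η h k G G₂ 1 F₂ U m p q) (hD : 0 ≤ D)
    (hlam : Odd lam) : (m * G - U) % 2 = 0 := by
  have h1 := emod_two_of_sq (D := D) (a := G) (b := 3) (c := h ^ 3) hlam (by rw [← P.cube_norm hD]; ring)
  have h2 := emod_two_of_sq (c := h * k) hlam ((P.polar_norm hD).trans (mul_assoc _ _ _))
  have h3 : m * G - U = m * (G - 3 * D) - (U - m * D) + 2 * (m * D) := by ring
  obtain ⟨a, ha⟩ := Int.dvd_of_emod_eq_zero h1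
  rw [h3, ha]
  have : m * (2 * a) = 2 * (m * a) := by ring
  omega

theorem false_of_angles (P : PadePair lam D ξ η h k G G₂ 1 F₂ U m p q)
    (hlam : lam = 1 ∨ lam = 7 ∧ D = 1) (hD : 1 ≤ D) (hD4 : D % 4 = 0 ∨ D % 4 = 1)
    (hF : F₂ = 1 ∨ F₂ = -1) (hm : m ≠ 0) (hh : 512 ^ 2 * D ^ 4 * lam ^ 2 ≤ h ^ 3)
    {y r₁ r₂ φ₁ φ₂ : ℝ} (hξ : ξ = r₁ * Complex.exp (φ₁ * Complex.I))
    (hη : η = r₂ * Complex.exp (φ₂ * Complex.I))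
    (A : PadeAngles lam D y (Real.sqrt (3 * D)) r₁ r₂ φ₁ φ₂) : False := by
  have hD0 : 0 ≤ D := by omega
  have hlam0 : lam ≠ 0 := by omega
  have hodd : Odd lam := by rcases hlam with rfl | ⟨rfl, -⟩ <;> decide
  have one_le : ∀ e : ℤ, e ≠ 0 → (1 : ℝ) ≤ |(e : ℝ)| := by
    intro e he
    exact_mod_cast Int.one_le_abs he
  have hr1 := A.r₁_pos
  have hr2 := A.r₂_pos
  have hL := A.L_pos
  have hl := A.one_le_l
  rcases le_total (12 * r₁ * y ^ 2) (r₂ ^ 2) with hgap | hgap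
  · obtain ⟨n, hn, hlo, hhi⟩ := A.exists_degree hgap
    obtain ⟨e, he⟩ := P.exists_int hD0 hD4 hodd hξ hη n
    rcases eq_or_ne e 0 with rfl | he0
    · have hZ : (padeE (1 / 3) n (3 * φ₁)).im * Real.cos φ₂ -
          (padeE (1 / 3) n (3 * φ₁)).re * Real.sin φ₂ = 0 := by
        have h0 : 2 * (r₂ * r₁ ^ (3 * n + 1)) ≠ 0 := by positivity
        refine (mul_eq_zero.mp (?_ : 2 * (r₂ * r₁ ^ (3 * n + 1)) * _ = 0)).resolve_left h0
        rw [mul_assoc, he]; simp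
      obtain ⟨e', he'⟩ := P.exists_int' hD0 hD4 hodd hξ hη n
      have he0 : e' ≠ 0 := by
        rintro rfl
        refine A.not_both_zero n hZ ?_
        have h0 : 2 * (r₂ * r₁ ^ (3 * n + 2)) ≠ 0 := by positivity
        refine (mul_eq_zero.mp (?_ : 2 * (r₂ * r₁ ^ (3 * n + 2)) * _ = 0)).resolve_left h0
        rw [mul_assoc, he']; simp
      refine A.degenerate_false hn hZ (le_trans ?_ (A.int_le' he'))
      exact le_mul_of_one_le_left (by positivity) (one_le e' he0)
    · refine A.generic_false hn (le_trans ?_ (A.int_le he)) hlo hhi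
      exact le_mul_of_one_le_left (by positivity) (one_le e he0)
  · have h0 := A.int_le (P.int_zero hξ hη)
    have h1 := A.int_le (P.int_one hD0 hξ hη)
    have hbeven := P.even_int_one hD0 hodd
    have hb0 := P.int_one_ne_zero hD hlam0 hF hh
    generalize hb : m * G - U = b at *
    simp only [padeK, Nat.centralBinom_zero, pow_zero, mul_one, Nat.cast_one] at h0
    rw [← mul_add] at h0
    have hr := A.r₂_ge (one_le m hm) h0
    have hy := A.y_ge
    have h1' : |(b : ℝ)| * (r₁ ^ 2 * r₂ ^ 2) ≤
        10001 / 10000 * (593 / 1000) * r₂ ^ 3 * (y * (3 * φ₁) ^ 2) +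
        20002 / 10000 * y * r₁ ^ 3 := by
      refine h1.trans ?_
      rw [pow_one, pow_one, show Nat.centralBinom 1 = 2 from rfl]
      have := padeK_third_one_le
      refine add_le_add (by gcongr) (le_of_eq ?_)
      push_cast; ring
    rcases hlam with rfl | ⟨rfl, rfl⟩
    · obtain ⟨h2, h3⟩ := A.int_one_lt hr hgap h1' (c := 614 / 1000) (by norm_num) (by norm_num)
      have h4 : |(b : ℝ)| < 3 := by norm_num at h2 ⊢; linarith
      have h5 : |b| < 3 := by exact_mod_cast h4
      have h6 : b = 2 ∨ b = -2 := by
        rw [abs_lt] at h5; omega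
      have h7 : |(b : ℝ)| = 2 := by rcases h6 with rfl | rfl <;> norm_num
      rw [h7] at h3
      have h8 := A.int_zero_lt hr (by norm_num at h3 ⊢; linarith) h0
      have h9 : |m| < 2 := by exact_mod_cast h8
      have hm1 : m = 1 ∨ m = -1 := by rw [abs_lt] at h9; omega
      exact P.int_one_ne_two hD hF (by linarith) hm1 (by rw [hb]; exact h6)
    · obtain ⟨h2, h3⟩ := A.int_one_lt hr hgap h1' (c := 232 / 1000) (by norm_num) (by norm_num)
      have h4 : |(b : ℝ)| < 1 := by norm_num at h2 ⊢; linarith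
      have h5 : |b| < 1 := by exact_mod_cast h4
      exact hb0 (Int.abs_lt_one_iff.mp h5)

theorem false_of_pos (P : PadePair lam D ξ η h k G G₂ 1 F₂ U m p q)
    (hlam : lam = 1 ∨ lam = 7 ∧ D = 1) (hD : 1 ≤ D) (hD4 : D % 4 = 0 ∨ D % 4 = 1)
    (hF : F₂ = 1 ∨ F₂ = -1) (hm : m ≠ 0) (hh : 512 ^ 2 * D ^ 4 * lam ^ 2 ≤ h ^ 3)
    (hk : h ≤ k) (hξ : 4 * ξ.im ^ 2 ≤ h) (hη : 4 * η.im ^ 2 ≤ k) (hξ0 : 0 < ξ.re)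
    (hη0 : 0 < η.re) : False := by
  obtain ⟨φ₁, hφ₁, e₁⟩ := exists_polar_form hξ0 (by rw [P.normSq_left]; exact hξ)
  obtain ⟨φ₂, hφ₂, e₂⟩ := exists_polar_form hη0 (by rw [P.normSq_right]; exact hη)
  have hlam0 : (1 : ℝ) ≤ lam := by
    have : 1 ≤ lam := by omega
    exact_mod_cast this
  have hD1 : (1 : ℝ) ≤ D := by exact_mod_cast hD
  have s₁ := P.sin_three e₁
  have s₂ := P.sin_three_right e₂
  have n₁ : ‖ξ‖ ^ 2 = h := by rw [← Complex.normSq_eq_norm_sq, P.normSq_left]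
  have n₂ : ‖η‖ ^ 2 = k := by rw [← Complex.normSq_eq_norm_sq, P.normSq_right]
  have p₁ : 0 < ‖ξ‖ := norm_pos_iff.mpr (by rintro rfl; simp at hξ0)
  have hL : 0 < Real.sqrt (3 * D) := Real.sqrt_pos.mpr (by linarith)
  have hpi := Real.pi_pos
  obtain ⟨hφ1, hφ2⟩ := abs_le.mp hφ₁
  have hsin : 0 < Real.sin (3 * φ₁) := by
    by_contra hc
    push Not at hc
    have : 0 < (lam : ℝ) * (3 * ((1 : ℤ) : ℝ) * Real.sqrt (3 * D)) := by push_cast; positivity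
    have : 2 * ‖ξ‖ ^ 3 * Real.sin (3 * φ₁) ≤ 0 := mul_nonpos_of_nonneg_of_nonpos (by positivity) hc
    linarith
  have hle : ‖ξ‖ ≤ ‖η‖ := by
    refine le_of_sq_le_sq ?_ (norm_nonneg _)
    rw [n₁, n₂]; exact_mod_cast hk
  refine P.false_of_angles hlam hD hD4 hF hm hh e₁ e₂ (y := ‖ξ‖ ^ 3 / lam) ⟨hlam0, hD1, hL,
    Real.sq_sqrt (by linarith), ?_, p₁, hle, by field_simp, ?_, hφ2, hφ₂, ?_, ?_⟩
  · rw [le_div_iff₀ (by linarith)]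
    refine le_of_sq_le_sq ?_ (by positivity)
    have : (512 ^ 2 * D ^ 4 * lam ^ 2 : ℝ) ≤ (h : ℝ) ^ 3 := by exact_mod_cast hh
    calc (512 * (D : ℝ) ^ 2 * lam) ^ 2 = 512 ^ 2 * (D : ℝ) ^ 4 * (lam : ℝ) ^ 2 := by ring
      _ ≤ (h : ℝ) ^ 3 := this
      _ = (‖ξ‖ ^ 3) ^ 2 := by rw [← n₁]; ring
  · by_contra hc
    push Not at hc
    have := Real.sin_nonpos_of_nonpos_of_neg_pi_le (x := 3 * φ₁) (by linarith) (by linarith)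
    linarith
  · have hne : (lam : ℝ) ≠ 0 := by positivity
    push_cast at s₁
    field_simp
    linear_combination s₁
  · have h3 : |Real.sin (3 * φ₂)| * (2 * ‖η‖ ^ 3) = |2 * ‖η‖ ^ 3 * Real.sin (3 * φ₂)| := by
      rw [abs_mul, abs_of_nonneg (show 0 ≤ 2 * ‖η‖ ^ 3 by positivity)]; ring
    rw [mul_comm, h3, s₂, abs_mul, abs_mul, abs_mul, abs_of_pos hL,
      abs_of_pos (show (0 : ℝ) < lam by linarith), show |(F₂ : ℝ)| = 1 by
        rcases hF with rfl | rfl <;> norm_num, abs_of_pos (show (0 : ℝ) < 3 by norm_num)]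
    ring

/-- Two large solutions cannot belong to the same class. -/
protected theorem false (P : PadePair lam D ξ η h k G G₂ F F₂ U m p q)
    (hlam : lam = 1 ∨ lam = 7 ∧ D = 1) (hD : 1 ≤ D) (hD4 : D % 4 = 0 ∨ D % 4 = 1)
    (hF : F = 1 ∨ F = -1) (hF₂ : F₂ = 1 ∨ F₂ = -1) (hm : m ≠ 0)
    (hh : 512 ^ 2 * D ^ 4 * lam ^ 2 ≤ h ^ 3) (hk : h ≤ k) (hξ : 4 * ξ.im ^ 2 ≤ h)
    (hη : 4 * η.im ^ 2 ≤ k) : False := by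
  have hpos : 0 < h := by
    by_contra hc
    have h1 : h ^ 3 ≤ 0 := by
      have : 0 ≤ (-h) ^ 3 := by apply pow_nonneg; omega
      linarith [show (-h) ^ 3 = -h ^ 3 by ring]
    have h2 : 0 < 512 ^ 2 * D ^ 4 * lam ^ 2 := by
      have : lam ≠ 0 := by omega
      positivity
    omega
  have re_ne : ∀ {z : ℂ} {t : ℤ}, 0 < t → Complex.normSq z = t → 4 * z.im ^ 2 ≤ t → z.re ≠ 0 := by
    intro z t ht h1 h2 h3
    rw [Complex.normSq_apply, h3] at h1
    have : (0 : ℝ) < t := by exact_mod_cast ht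
    nlinarith
  have hre1 := re_ne hpos P.normSq_left hξ
  have hre2 := re_ne (hpos.trans_le hk) P.normSq_right hη
  clear re_ne
  wlog hp1 : 0 < ξ.re generalizing ξ G F U m
  · refine this P.neg_left (by omega) (by omega) (by simpa using hξ) (by simpa using hre1) ?_
    rw [Complex.neg_re]
    rcases lt_or_gt_of_ne hre1 with h1 | h1 <;> [linarith; exact absurd h1 hp1]
  wlog hp2 : 0 < η.re generalizing η G₂ F₂ U m p q
  · refine this (by omega) (by simpa using hη) (by simpa using hre2) P.neg_right (by omega) ?_
    rw [Complex.neg_re]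
    rcases lt_or_gt_of_ne hre2 with h1 | h1 <;> [linarith; exact absurd h1 hp2]
  rcases hF with rfl | rfl
  · exact P.false_of_pos hlam hD hD4 hF₂ hm hh hk hξ hη hp1 hp2
  · exact P.star.false_of_pos hlam hD hD4 (by omega) (by omega) hh hk (by simpa using hξ)
      (by simpa using hη) (by simpa using hp1) (by simpa using hp2)

end PadePair

namespace BinaryCubic

/-- First coefficient of the Hessian. -/
def hessA (f : BinaryCubic) : ℤ := f.b ^ 2 - 3 * f.a * f.c

/-- Second coefficient of the Hessian. -/
def hessB (f : BinaryCubic) : ℤ := f.b * f.c - 9 * f.a * f.d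

/-- Third coefficient of the Hessian. -/
def hessC (f : BinaryCubic) : ℤ := f.c ^ 2 - 3 * f.b * f.d

/-- The Hessian covariant. -/
def hess (f : BinaryCubic) (x y : ℤ) : ℤ := f.hessA * x ^ 2 + f.hessB * x * y + f.hessC * y ^ 2

theorem hess_disc (f : BinaryCubic) : 4 * f.hessA * f.hessC - f.hessB ^ 2 = 3 * f.disc := by
  simp only [hessA, hessB, hessC, disc]; ring

theorem four_mul_hessA_cube (f : BinaryCubic) :
    4 * f.hessA ^ 3 = (3 * f.a * f.hessB - 2 * f.hessA * f.b) ^ 2 + 27 * f.disc * f.a ^ 2 := by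
  simp only [hessA, hessB, disc]; ring

theorem hess_subst (f : BinaryCubic) (p q r s x y : ℤ) :
    (f.subst p q r s).hess x y = (p * s - q * r) ^ 2 * f.hess (p * x + q * y) (r * x + s * y) := by
  simp only [hess, hessA, hessB, hessC, subst]; ring

theorem hessA_pos {f : BinaryCubic} (h : 0 < f.disc) : 0 < f.hessA := by
  have h1 := f.hess_disc
  have h2 := f.four_mul_hessA_cube
  by_contra hc
  have h3 : f.hessA ^ 3 = 0 := by
    have : f.hessA ^ 3 ≤ 0 := by
      rw [pow_succ]
      exact mul_nonpos_of_nonneg_of_nonpos (sq_nonneg _) (by linarith)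
    nlinarith [sq_nonneg f.a, sq_nonneg (3 * f.a * f.hessB - 2 * f.hessA * f.b),
      mul_nonneg h.le (sq_nonneg f.a)]
  have h4 : f.hessA = 0 := pow_eq_zero_iff (by norm_num) |>.1 h3
  rw [h4] at h1
  nlinarith [sq_nonneg f.hessB]

/-- A linear form over `ℚ(√(-3 D))` whose cube is the resolvent of the cubic form. -/
theorem exists_resolvent {f : BinaryCubic} (h : 0 < f.disc) {s : ℂ} (hs : s ^ 2 = -3 * f.disc)
    (hc : conj s = -s) : ∃ ζ β : ℂ, ζ * conj ζ = f.hessA ∧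
      2 * f.hessA * β = -f.hessB + s ∧ 2 * f.hessA * conj β = -f.hessB - s ∧
      f.hessA * (β * conj β) = f.hessC ∧
      2 * ζ ^ 3 = 3 * f.a * f.hessB - 2 * f.hessA * f.b + s * (3 * f.a) ∧
      -β * (3 * f.a * f.hessB - 2 * f.hessA * f.b + s * (3 * f.a)) =
        3 * f.a * f.hessC - f.c * f.hessA + s * f.b ∧
      -β * (3 * f.a * f.hessC - f.c * f.hessA + s * f.b) =
        f.b * f.hessC - 3 * f.d * f.hessA + s * f.c ∧
      -β * (f.b * f.hessC - 3 * f.d * f.hessA + s * f.c) =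
        2 * f.c * f.hessC - 3 * f.d * f.hessB + s * (3 * f.d) := by
  have hA := hessA_pos h
  have hA0 : (f.hessA : ℂ) ≠ 0 := by exact_mod_cast hA.ne'
  obtain ⟨ζ, hζ⟩ := IsAlgClosed.exists_pow_nat_eq
    ((3 * f.a * f.hessB - 2 * f.hessA * f.b + s * (3 * f.a)) / 2) (show 0 < 3 by norm_num)
  have h1 : (4 * f.hessA * f.hessC - f.hessB ^ 2 : ℂ) = 3 * f.disc := by exact_mod_cast f.hess_disc
  have h2 : (4 * f.hessA ^ 3 : ℂ) =
      (3 * f.a * f.hessB - 2 * f.hessA * f.b) ^ 2 + 27 * f.disc * f.a ^ 2 := by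
    exact_mod_cast f.four_mul_hessA_cube
  have eA : (f.hessA : ℂ) = f.b ^ 2 - 3 * f.a * f.c := by simp [hessA]
  have eB : (f.hessB : ℂ) = f.b * f.c - 9 * f.a * f.d := by simp [hessB]
  have eC : (f.hessC : ℂ) = f.c ^ 2 - 3 * f.b * f.d := by simp [hessC]
  have hcβ : conj ((-f.hessB + s) / (2 * f.hessA) : ℂ) = (-f.hessB - s) / (2 * f.hessA) := by
    have h4 : conj (2 : ℂ) = 2 := Complex.conj_ofNat 2
    rw [map_div₀, map_add, map_mul, map_neg, hc]
    simp [sub_eq_add_neg, h4]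
  have e1 : 2 * f.hessA * ((-f.hessB + s) / (2 * f.hessA) : ℂ) = -f.hessB + s := by field_simp
  have hn : ζ * conj ζ = f.hessA := by
    have h3 : (ζ * conj ζ) ^ 3 = (f.hessA : ℂ) ^ 3 := by
      have : conj ζ ^ 3 = (3 * f.a * f.hessB - 2 * f.hessA * f.b - s * (3 * f.a)) / 2 := by
        rw [← map_pow, hζ]
        have h4 : conj (2 : ℂ) = 2 := Complex.conj_ofNat 2
        have h3 : conj (3 : ℂ) = 3 := Complex.conj_ofNat 3
        simp [hc, sub_eq_add_neg, h4, h3]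
      rw [mul_pow, hζ, this]
      linear_combination (-9 / 4 * (f.a : ℂ) ^ 2) * hs - h2 / 4
    rw [Complex.mul_conj] at h3 ⊢
    have h4 : Complex.normSq ζ ^ 3 = (f.hessA : ℝ) ^ 3 := by exact_mod_cast h3
    have h5 : Complex.normSq ζ = (f.hessA : ℝ) :=
      (pow_left_inj₀ (Complex.normSq_nonneg _) (by exact_mod_cast hA.le) (by norm_num)).1 h4
    rw [h5]; simp
  have hD : (f.disc : ℂ) = f.b ^ 2 * f.c ^ 2 - 4 * f.a * f.c ^ 3 - 4 * f.b ^ 3 * f.d -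
      27 * f.a ^ 2 * f.d ^ 2 + 18 * f.a * f.b * f.c * f.d := by simp [disc]
  refine ⟨ζ, (-f.hessB + s) / (2 * f.hessA), hn, e1, ?_, ?_, ?_, ?_, ?_, ?_⟩
  · rw [hcβ]; field_simp
  · rw [hcβ]; field_simp
    linear_combination -hs - h1
  · rw [hζ]; ring
  · refine mul_left_cancel₀ (mul_ne_zero two_ne_zero hA0) ?_
    rw [← mul_assoc, mul_neg, e1]
    rw [hD] at hs
    rw [eA, eB, eC]
    linear_combination (-(3 * f.a) : ℂ) * hs
  · refine mul_left_cancel₀ (mul_ne_zero two_ne_zero hA0) ?_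
    rw [← mul_assoc, mul_neg, e1]
    rw [hD] at hs
    rw [eA, eB, eC]
    linear_combination (-(f.b) : ℂ) * hs
  · refine mul_left_cancel₀ (mul_ne_zero two_ne_zero hA0) ?_
    rw [← mul_assoc, mul_neg, e1]
    rw [hD] at hs
    rw [eA, eB, eC]
    linear_combination (-(f.c) : ℂ) * hs

/-- One of the three rotations of a complex number by cube roots of unity is close to the real
line. -/
theorem exists_rotation {ω : ℂ} (hre : ω.re = -1 / 2) (him : ω.im ^ 2 = 3 / 4) (z : ℂ) :
    ∃ j : Fin 3, 4 * (ω ^ (j : ℕ) * z).im ^ 2 ≤ Complex.normSq z := by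
  by_contra hc
  push Not at hc
  have h0 := hc 0
  have h1 := hc 1
  have h2 := hc 2
  simp only [Fin.val_zero, Fin.val_one, Fin.val_two, pow_zero, one_mul, pow_one, pow_two ω,
    Complex.mul_im, Complex.mul_re, Complex.normSq_apply] at h0 h1 h2
  set u := z.re
  set v := z.im
  set t := ω.im
  rw [hre] at h1 h2
  have e1 : u ^ 2 < 3 * v ^ 2 := by nlinarith
  have e2 : 2 * u * v * t < u ^ 2 := by
    linear_combination h1 / 2 + 2 * u ^ 2 * him
  have e3 : -(2 * u * v * t) < u ^ 2 := by
    have : (-1 / 2 * (-1 / 2) - t * t) = -1 / 2 := by linear_combination -him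
    rw [this] at h2
    linear_combination h2 / 2 + 2 * u ^ 2 * him
  have e4 : (2 * u * v * t) ^ 2 < (u ^ 2) ^ 2 := sq_lt_sq' (by linarith) (by linarith)
  have e5 : (2 * u * v * t) ^ 2 = u ^ 2 * (3 * v ^ 2) := by rw [mul_pow, him]; ring
  nlinarith [sq_nonneg u]

theorem exists_classes {f : BinaryCubic} {lam D : ℤ} (hl : lam ≠ 0) (hD : 0 < D)
    (hd : f.disc = lam ^ 2 * D) (hA : lam ∣ f.hessA) (hB : lam ∣ f.hessB) (hC : lam ∣ f.hessC) :
    ∃ ξ : Fin 3 → ℤ × ℤ → ℂ, (∀ j P Q, ∃ G G₂ U p q,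
      PadePair lam D (ξ j P) (ξ j Q) (f.hess P.1 P.2) (f.hess Q.1 Q.2) G G₂ (f.val P.1 P.2)
        (f.val Q.1 Q.2) U (P.1 * Q.2 - P.2 * Q.1) p q) ∧
      ∀ P, ∃ j, 4 * (ξ j P).im ^ 2 ≤ f.hess P.1 P.2 := by
  have hdpos : 0 < f.disc := by rw [hd]; positivity
  have hs : (lam * sqrtNeg D : ℂ) ^ 2 = -3 * f.disc := by
    rw [mul_pow, sqrtNeg_sq hD.le, hd]; push_cast; ring
  have hcs : conj (lam * sqrtNeg D : ℂ) = -(lam * sqrtNeg D) := by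
    rw [map_mul, conj_sqrtNeg]; simp
  obtain ⟨ζ, β, hζ, hβ, hβ', hββ, e0, e1, e2, e3⟩ := exists_resolvent hdpos hs hcs
  obtain ⟨A, hA⟩ := hA
  obtain ⟨B, hB⟩ := hB
  obtain ⟨C, hC⟩ := hC
  have cA : (f.hessA : ℂ) = lam * A := by rw [hA]; push_cast; ring
  have cB : (f.hessB : ℂ) = lam * B := by rw [hB]; push_cast; ring
  have cC : (f.hessC : ℂ) = lam * C := by rw [hC]; push_cast; ring
  set s := sqrtNeg D with hsd
  obtain ⟨ω, hre, him⟩ : ∃ ω : ℂ, ω.re = -1 / 2 ∧ ω.im ^ 2 = 3 / 4 := by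
    refine ⟨⟨-1 / 2, Real.sqrt (3 / 4)⟩, rfl, ?_⟩
    exact Real.sq_sqrt (by norm_num)
  have hω : ω * conj ω = 1 := by
    rw [Complex.mul_conj, Complex.normSq_apply, hre, ← pow_two ω.im, him]; norm_num
  have hω3 : ω ^ 3 = 1 := by
    have h1 : ω ^ 2 + ω + 1 = 0 := by
      apply Complex.ext
      · simp [pow_two, hre]; nlinarith
      · simp [pow_two, hre]; ring
    linear_combination (ω - 1) * h1
  have hnorm : ∀ P : ℤ × ℤ, (ζ * (P.1 - β * P.2)) * conj (ζ * (P.1 - β * P.2)) =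
      f.hess P.1 P.2 := by
    rintro ⟨x, y⟩
    simp only [map_mul, map_sub, map_intCast, hess]
    push_cast
    linear_combination (x - β * y) * (x - conj β * y) * hζ - x * y / 2 * (hβ + hβ') + y ^ 2 * hββ
  have hpow : ∀ j : ℕ, ω ^ j * conj (ω ^ j) = 1 := by
    intro j
    rw [map_pow, ← mul_pow, hω, one_pow]
  have hpow3 : ∀ j : ℕ, (ω ^ j) ^ 3 = 1 := by
    intro j
    rw [← pow_mul, mul_comm, pow_mul, hω3, one_pow]
  have hN : ∀ (j : ℕ) (P : ℤ × ℤ), Complex.normSq (ω ^ j * (ζ * (P.1 - β * P.2))) =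
      f.hess P.1 P.2 := by
    intro j P
    have := hnorm P
    have h2 : ((ω ^ j * (ζ * (P.1 - β * P.2))) * conj (ω ^ j * (ζ * (P.1 - β * P.2))) : ℂ) =
        f.hess P.1 P.2 := by
      rw [map_mul, ← hnorm P]
      linear_combination ((ζ * (P.1 - β * P.2)) * conj (ζ * (P.1 - β * P.2))) * hpow j
    rw [Complex.mul_conj] at h2
    exact_mod_cast h2
  obtain ⟨T, V, hcube, hV⟩ : ∃ T V : ℤ × ℤ → ℤ × ℤ → ℤ, (∀ (j : ℕ) (P Q : ℤ × ℤ),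
      2 * (ω ^ j * (ζ * (P.1 - β * P.2))) ^ 2 * (ω ^ j * (ζ * (Q.1 - β * Q.2))) =
      lam * (T P Q + V P Q * s)) ∧ ∀ P, V P P = 3 * f.val P.1 P.2 := by
    refine ⟨fun P Q => (3 * f.a * B - 2 * A * f.b) * (P.1 ^ 2 * Q.1) +
        (3 * f.a * C - f.c * A) * (P.1 ^ 2 * Q.2 + 2 * P.1 * Q.1 * P.2) +
        (f.b * C - 3 * f.d * A) * (2 * P.1 * P.2 * Q.2 + P.2 ^ 2 * Q.1) +
        (2 * f.c * C - 3 * f.d * B) * (P.2 ^ 2 * Q.2),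
      fun P Q => 3 * f.a * (P.1 ^ 2 * Q.1) + f.b * (P.1 ^ 2 * Q.2 + 2 * P.1 * Q.1 * P.2) +
          f.c * (2 * P.1 * P.2 * Q.2 + P.2 ^ 2 * Q.1) + 3 * f.d * (P.2 ^ 2 * Q.2), ?_, ?_⟩
    · rintro j ⟨x, y⟩ ⟨z, w⟩
      push_cast
      rw [cA, cB] at e0
      rw [cA, cB, cC] at e1 e3
      rw [cA, cC] at e2
      linear_combination (2 * ζ ^ 3 * ((x - β * y) ^ 2 * (z - β * w))) * hpow3 j +
        ((x - β * y) ^ 2 * (z - β * w)) * e0 + e1 * (x ^ 2 * w + 2 * x * z * y) +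
        (-β * e1 + e2) * (2 * x * y * w + y ^ 2 * z) + (β ^ 2 * e1 - β * e2 + e3) * (y ^ 2 * w)
    · rintro ⟨x, y⟩
      simp only [val]; ring
  refine ⟨fun j P => ω ^ (j : ℕ) * (ζ * (P.1 - β * P.2)), ?_, ?_⟩
  · rintro j P Q
    refine ⟨T P P, T Q Q, 2 * A * P.1 * Q.1 + B * (P.1 * Q.2 + Q.1 * P.2) + 2 * C * P.2 * Q.2,
      T P Q, -V P Q, ⟨hN j P, hN j Q, ?_, ?_, ?_, ?_⟩⟩
    · have h1 := hcube j P P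
      rw [hV] at h1
      push_cast at h1
      linear_combination h1
    · have h1 := hcube j Q Q
      rw [hV] at h1
      push_cast at h1
      linear_combination h1
    · rw [cA] at hζ hβ hβ' hββ
      rw [cB] at hβ hβ'
      rw [cC] at hββ
      have h1 := hpow j
      simp only [map_mul, map_sub, map_intCast]
      push_cast
      linear_combination
        (2 * (ζ * conj ζ) * ((P.1 - β * P.2) * (Q.1 - conj β * Q.2))) * h1 +
        2 * ((P.1 - β * P.2) * (Q.1 - conj β * Q.2)) * hζ - Q.1 * P.2 * hβ - P.1 * Q.2 * hβ' +
        2 * P.2 * Q.2 * hββ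
    · have h1 := congrArg conj (hcube j P Q)
      have h4 : conj (2 : ℂ) = 2 := Complex.conj_ofNat 2
      rw [map_mul, map_mul, map_pow, h4] at h1
      rw [h1, map_mul, map_add, map_mul, hsd, conj_sqrtNeg]
      simp
  · intro P
    obtain ⟨j, hj⟩ := exists_rotation hre him (ζ * (P.1 - β * P.2))
    refine ⟨j, hj.trans_eq ?_⟩
    have := hN 0 P
    rwa [pow_zero, one_mul] at this

end BinaryCubic

theorem mul_le_of_cubic_rel {w h L D c κ κ' : ℝ} (hw : 0 ≤ w) (hh : 0 < h)
    (hL2 : L ^ 2 = 3 * D) (hc : 0 < c) (hcD : c * D ≤ h ^ 3) (hrel : w * (3 * h - w ^ 2) = 3 * L)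
    (hκ : w * h ≤ κ * L) (hκ' : c ≤ κ' * (c - κ ^ 2)) (hκ'0 : 0 ≤ κ') :
    w * h ≤ κ' * L := by
  have h1 : (w * h) ^ 2 ≤ κ ^ 2 * (3 * D) := by
    rw [← hL2, ← mul_pow]; gcongr
  have h2 : c * w ^ 2 ≤ 3 * κ ^ 2 * h := by
    have : h ^ 2 * (c * w ^ 2) ≤ h ^ 2 * (3 * κ ^ 2 * h) := by nlinarith [sq_nonneg κ]
    exact le_of_mul_le_mul_left this (by positivity)
  have h3 : w * h * (c - κ ^ 2) ≤ c * L := by nlinarith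
  have h4 : κ' * (w * h * (c - κ ^ 2)) ≤ κ' * (c * L) := by gcongr
  have h5 : 0 ≤ w * h := by positivity
  have : c * (w * h) ≤ c * (κ' * L) := by nlinarith
  exact le_of_mul_le_mul_left this hc


theorem im_cubic_rel {D h G F : ℤ} {ξ : ℂ} (h2 : Complex.normSq ξ = h)
    (hc : 2 * ξ ^ 3 = (1 : ℤ) * (G + 3 * F * sqrtNeg D)) (hF : F = 1 ∨ F = -1)
    (hξ : 4 * ξ.im ^ 2 ≤ h) :
    2 * |ξ.im| * (3 * h - (2 * |ξ.im|) ^ 2) = 3 * Real.sqrt (3 * D) := by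
  have h1 := congrArg Complex.im hc
  rw [Complex.normSq_apply] at h2
  simp only [pow_succ, pow_zero, one_mul, Complex.mul_im, Complex.mul_re, Complex.add_im,
    Complex.add_re, sqrtNeg_re, sqrtNeg_im, Complex.intCast_re, Complex.intCast_im,
    Complex.re_ofNat, Complex.im_ofNat] at h1
  have h3 : 2 * ξ.im * (3 * h - (2 * |ξ.im|) ^ 2) = 3 * F * Real.sqrt (3 * D) := by
    rw [mul_pow, sq_abs]
    push_cast at h1
    linear_combination h1 - 6 * ξ.im * h2
  have h4 := congrArg abs h3
  have h5 : (0 : ℝ) ≤ h := by nlinarith [sq_nonneg ξ.im]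
  have h6 : |(F : ℝ)| = 1 := by rcases hF with rfl | rfl <;> simp
  rw [abs_mul, abs_mul, abs_mul, abs_mul, h6, abs_of_nonneg (Real.sqrt_nonneg _),
    abs_of_nonneg (show (0 : ℝ) ≤ 3 * h - (2 * |ξ.im|) ^ 2 by rw [mul_pow, sq_abs]; linarith)] at h4
  simpa using h4

namespace PadePair

variable {D : ℤ} {ξ η : ℂ} {h k G G₂ F F₂ U m p q : ℤ}

theorem abs_det_mul_le (P : PadePair 1 D ξ η h k G G₂ F F₂ U m p q) :
    |(m : ℝ)| * Real.sqrt (3 * D) ≤ 2 * |ξ.im| * Real.sqrt k + 2 * |η.im| * Real.sqrt h := by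
  have h1 := congrArg Complex.im P.polar
  simp only [Complex.mul_im, Complex.mul_re, Complex.add_im, Complex.add_re, sqrtNeg_re, sqrtNeg_im,
    Complex.intCast_re, Complex.intCast_im, Complex.conj_re, Complex.conj_im,
    Complex.re_ofNat, Complex.im_ofNat] at h1
  have hx : |ξ.re| ≤ Real.sqrt h := by
    rw [← P.normSq_left, Complex.normSq_apply]
    exact Real.abs_le_sqrt (by nlinarith [sq_nonneg ξ.im])
  have hy : |η.re| ≤ Real.sqrt k := by
    rw [← P.normSq_right, Complex.normSq_apply]
    exact Real.abs_le_sqrt (by nlinarith [sq_nonneg η.im])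
  have h3 : m * Real.sqrt (3 * D) = 2 * ξ.im * η.re - 2 * ξ.re * η.im := by
    push_cast at h1
    linarith
  calc |(m : ℝ)| * Real.sqrt (3 * D) = |2 * ξ.im * η.re - 2 * ξ.re * η.im| := by
        rw [← h3, abs_mul, abs_of_nonneg (Real.sqrt_nonneg _)]
    _ ≤ |2 * ξ.im * η.re| + |2 * ξ.re * η.im| := abs_sub _ _
    _ = 2 * |ξ.im| * |η.re| + 2 * |η.im| * |ξ.re| := by
        simp only [abs_mul, abs_two]; ring
    _ ≤ _ := by gcongr

/-- Two solutions attached to the same cube root of unity repel each other. -/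
theorem gap {c κ₀ κ : ℝ} (P : PadePair 1 D ξ η h k G G₂ F F₂ U m p q) (hD : 1 ≤ D)
    (hF : F = 1 ∨ F = -1) (hF₂ : F₂ = 1 ∨ F₂ = -1) (hm : m ≠ 0) (hk : h ≤ k)
    (hξ : 4 * ξ.im ^ 2 ≤ h) (hη : 4 * η.im ^ 2 ≤ k) (hc : 0 < c) (hh : c * D ≤ h ^ 3) (h0 : 0 < h)
    (hκ₀ : 0 ≤ κ₀) (hκ₀' : c ≤ κ₀ * (c - (3 / 2) ^ 2)) (hκ : 0 ≤ κ) (hκ' : c ≤ κ * (c - κ₀ ^ 2)) :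
    Real.sqrt h ^ 2 * Real.sqrt k ^ 2 ≤ κ * (Real.sqrt k ^ 3 + Real.sqrt h ^ 3) := by
  have hD' : (1 : ℝ) ≤ D := by exact_mod_cast hD
  have hL : 0 < Real.sqrt (3 * D) := Real.sqrt_pos.2 (by linarith)
  have hL2 : Real.sqrt (3 * D) ^ 2 = 3 * D := Real.sq_sqrt (by linarith)
  have h0' : (0 : ℝ) < h := by exact_mod_cast h0
  have hk' : (h : ℝ) ≤ k := by exact_mod_cast hk
  have k0 : (0 : ℝ) < k := by linarith
  have key : ∀ {w x : ℝ}, 0 ≤ w → 0 < x → w ^ 2 ≤ x → c * D ≤ x ^ 3 →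
      w * (3 * x - w ^ 2) = 3 * Real.sqrt (3 * D) → w * x ≤ κ * Real.sqrt (3 * D) := by
    intro w x hw hx hwx hcx hrel
    have e1 : w * x ≤ 3 / 2 * Real.sqrt (3 * D) := by nlinarith
    have e2 := mul_le_of_cubic_rel hw hx hL2 hc hcx hrel e1 hκ₀' hκ₀
    exact mul_le_of_cubic_rel hw hx hL2 hc hcx hrel e2 hκ' hκ
  have e1 := key (w := 2 * |ξ.im|) (by positivity) h0' (by rw [mul_pow, sq_abs]; linarith) hh (im_cubic_rel P.normSq_left P.cube_left hF hξ)
  have e2 := key (w := 2 * |η.im|) (by positivity) k0 (by rw [mul_pow, sq_abs]; linarith)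
    (hh.trans (by gcongr)) (im_cubic_rel P.normSq_right P.cube_right hF₂ hη)
  have e3 := P.abs_det_mul_le
  have hm1 : (1 : ℝ) ≤ |(m : ℝ)| := by exact_mod_cast Int.one_le_abs hm
  have e4 : Real.sqrt (3 * D) ≤ 2 * |ξ.im| * Real.sqrt k + 2 * |η.im| * Real.sqrt h := by nlinarith
  have eh : Real.sqrt h ^ 2 = h := Real.sq_sqrt h0'.le
  have ek : Real.sqrt k ^ 2 = k := Real.sq_sqrt k0.le
  have e5 : Real.sqrt (3 * D) * (h * k) ≤
      Real.sqrt (3 * D) * (κ * (Real.sqrt k ^ 3 + Real.sqrt h ^ 3)) := by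
    calc Real.sqrt (3 * D) * (h * k)
        ≤ (2 * |ξ.im| * Real.sqrt k + 2 * |η.im| * Real.sqrt h) * (h * k) := by gcongr
      _ = (2 * |ξ.im| * h) * (Real.sqrt k * k) + (2 * |η.im| * k) * (Real.sqrt h * h) := by ring
      _ ≤ (κ * Real.sqrt (3 * D)) * (Real.sqrt k * k) + (κ * Real.sqrt (3 * D)) * (Real.sqrt h * h) := by
          gcongr
      _ = Real.sqrt (3 * D) * (κ * (Real.sqrt k * Real.sqrt k ^ 2 + Real.sqrt h * Real.sqrt h ^ 2)) := by
          rw [eh, ek]; ring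
      _ = _ := by ring
  rw [eh, ek]
  exact le_of_mul_le_mul_left e5 hL

theorem le_cube_of_le_cube (P : PadePair 1 D ξ η h k G G₂ F F₂ U m p q) (hD : 49 ≤ D)
    (hF : F = 1 ∨ F = -1) (hF₂ : F₂ = 1 ∨ F₂ = -1) (hm : m ≠ 0) (hk : h ≤ k)
    (hξ : 4 * ξ.im ^ 2 ≤ h) (hη : 4 * η.im ^ 2 ≤ k) (h0 : 0 < h) (hh : 32 * D ≤ h ^ 3) :
    621 * D ^ 2 ≤ k ^ 3 := by
  have hh' : (32 : ℝ) * D ≤ h ^ 3 := by exact_mod_cast hh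
  have hD' : (49 : ℝ) ≤ D := by exact_mod_cast hD
  have h0' : (0 : ℝ) < h := by exact_mod_cast h0
  have hk' : (h : ℝ) ≤ k := by exact_mod_cast hk
  have e := P.gap (c := 32) (κ₀ := 10758 / 10000) (κ := 10376 / 10000) (by linarith) hF hF₂ hm hk hξ
    hη (by norm_num) hh' h0 (by norm_num) (by norm_num) (by norm_num) (by norm_num)
  have eh : Real.sqrt h ^ 2 = h := Real.sq_sqrt h0'.le
  have ek : Real.sqrt k ^ 2 = k := Real.sq_sqrt (by linarith)
  have hab : Real.sqrt h ≤ Real.sqrt k := Real.sqrt_le_sqrt hk'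
  have ha : 0 < Real.sqrt h := Real.sqrt_pos.2 h0'
  set a := Real.sqrt h
  set b := Real.sqrt k
  have hb : 0 < b := by linarith
  have ha6 : 32 * D ≤ a ^ 6 := by rw [show a ^ 6 = (a ^ 2) ^ 3 by ring, eh]; exact hh'
  have ha3 : 34 / 10 ≤ a := by
    by_contra hc
    push Not at hc
    have : a ^ 6 ≤ (34 / 10) ^ 6 := by gcongr
    norm_num at this
    linarith
  have step : ∀ t u : ℝ, 0 < t → t * a ≤ b → 1 ≤ u * t ^ 2 → 0 ≤ u →
      a ^ 2 ≤ 10376 / 10000 * (b + u * a) := by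
    intro t u ht htb hu hu0
    have h1 : (t * a) ^ 2 ≤ b ^ 2 := by gcongr
    have h2 : a ^ 3 ≤ b ^ 2 * (u * a) := by
      have h3 : u * (t * a) ^ 2 * a ≤ u * b ^ 2 * a := by gcongr
      have h4 : a ^ 3 * 1 ≤ a ^ 3 * (u * t ^ 2) := by gcongr
      linarith
    have h5 : b ^ 2 * a ^ 2 ≤ b ^ 2 * (10376 / 10000 * (b + u * a)) := by nlinarith
    exact le_of_mul_le_mul_left h5 (by positivity)
  have s1 := step 1 1 (by norm_num) (by linarith) (by norm_num) (by norm_num)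
  have s2 : 227 / 100 * a ≤ b := by nlinarith
  have s3 := step _ (1 / 5) (by norm_num) s2 (by norm_num) (by norm_num)
  have s4 : 307 / 100 * a ≤ b := by nlinarith
  have s5 := step _ (1 / 9) (by norm_num) s4 (by norm_num) (by norm_num)
  have s6 : 9201 / 10000 * a ^ 2 ≤ b := by nlinarith
  have s7 : (9201 / 10000 * a ^ 2) ^ 6 ≤ b ^ 6 := by gcongr
  have s8 : (32 * (D : ℝ)) ^ 2 ≤ (a ^ 6) ^ 2 := by gcongr
  have s9 : (621 : ℝ) * D ^ 2 ≤ k ^ 3 := by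
    rw [← ek]
    nlinarith
  exact_mod_cast s9

theorem le_cube_of_le_cube' (P : PadePair 1 D ξ η h k G G₂ F F₂ U m p q) (hD : 49 ≤ D)
    (hF : F = 1 ∨ F = -1) (hF₂ : F₂ = 1 ∨ F₂ = -1) (hm : m ≠ 0) (hk : h ≤ k)
    (hξ : 4 * ξ.im ^ 2 ≤ h) (hη : 4 * η.im ^ 2 ≤ k) (h0 : 0 < h) (hh : 621 * D ^ 2 ≤ h ^ 3) :
    512 ^ 2 * D ^ 4 ≤ k ^ 3 := by
  have hh' : (621 : ℝ) * D ^ 2 ≤ h ^ 3 := by exact_mod_cast hh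
  have hD' : (49 : ℝ) ≤ D := by exact_mod_cast hD
  have h0' : (0 : ℝ) < h := by exact_mod_cast h0
  have hk' : (h : ℝ) ≤ k := by exact_mod_cast hk
  have e := P.gap (c := 30000) (κ₀ := 2) (κ := 1001 / 1000) (by linarith) hF hF₂ hm hk hξ
    hη (by norm_num) (by nlinarith) h0 (by norm_num) (by norm_num) (by norm_num) (by norm_num)
  have eh : Real.sqrt h ^ 2 = h := Real.sq_sqrt h0'.le
  have ek : Real.sqrt k ^ 2 = k := Real.sq_sqrt (by linarith)
  have hab : Real.sqrt h ≤ Real.sqrt k := Real.sqrt_le_sqrt hk'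
  have ha : 0 < Real.sqrt h := Real.sqrt_pos.2 h0'
  set a := Real.sqrt h
  set b := Real.sqrt k
  have hb : 0 < b := by linarith
  have ha6 : 621 * D ^ 2 ≤ a ^ 6 := by rw [show a ^ 6 = (a ^ 2) ^ 3 by ring, eh]; exact hh'
  have ha3 : 10 ≤ a := by
    by_contra hc
    push Not at hc
    have : a ^ 6 ≤ 10 ^ 6 := by gcongr
    nlinarith
  have step : ∀ t u : ℝ, 0 < t → t * a ≤ b → 1 ≤ u * t ^ 2 → 0 ≤ u →
      a ^ 2 ≤ 1001 / 1000 * (b + u * a) := by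
    intro t u ht htb hu hu0
    have h1 : (t * a) ^ 2 ≤ b ^ 2 := by gcongr
    have h2 : a ^ 3 ≤ b ^ 2 * (u * a) := by
      have h3 : u * (t * a) ^ 2 * a ≤ u * b ^ 2 * a := by gcongr
      have h4 : a ^ 3 * 1 ≤ a ^ 3 * (u * t ^ 2) := by gcongr
      linarith
    have h5 : b ^ 2 * a ^ 2 ≤ b ^ 2 * (1001 / 1000 * (b + u * a)) := by nlinarith
    exact le_of_mul_le_mul_left h5 (by positivity)
  have s1 := step 1 1 (by norm_num) (by linarith) (by norm_num) (by norm_num)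
  have s2 : 8 * a ≤ b := by nlinarith
  have s3 := step _ (1 / 64) (by norm_num) s2 (by norm_num) (by norm_num)
  have s6 : 98 / 100 * a ^ 2 ≤ b := by nlinarith
  have s7 : (98 / 100 * a ^ 2) ^ 6 ≤ b ^ 6 := by gcongr
  have s8 : (621 * (D : ℝ) ^ 2) ^ 2 ≤ (a ^ 6) ^ 2 := by gcongr
  have s9 : (512 : ℝ) ^ 2 * D ^ 4 ≤ k ^ 3 := by
    rw [← ek]
    nlinarith [pow_nonneg (show (0 : ℝ) ≤ D by linarith) 4]
  exact_mod_cast s9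

end PadePair

end

/-- Removing a maximal element from every class leaves elements which are not maximal. -/
theorem exists_subset_not_max {α : Type*} [DecidableEq α] (S : Finset α) (cls : α → Fin 3)
    (h : α → ℤ) : ∃ T ⊆ S, S.card ≤ T.card + 3 ∧
      ∀ x ∈ T, ∃ y ∈ S, y ≠ x ∧ cls y = cls x ∧ h x ≤ h y := by
  rcases S.eq_empty_or_nonempty with rfl | ⟨x₀, -⟩
  · exact ⟨∅, by simp, by simp, by simp⟩
  have : ∀ c : Fin 3, ∃ y : α, ∀ x ∈ S, cls x = c → y ∈ S ∧ cls y = c ∧ h x ≤ h y := by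
    intro c
    rcases (S.filter (cls · = c)).eq_empty_or_nonempty with he | hne
    · refine ⟨x₀, fun x hx hc => ?_⟩
      have : x ∈ S.filter (cls · = c) := by simp [hx, hc]
      rw [he] at this
      simp at this
    · obtain ⟨y, hy, hmax⟩ := Finset.exists_max_image _ h hne
      rw [Finset.mem_filter] at hy
      exact ⟨y, fun x hx hc => ⟨hy.1, hy.2, hmax x (by simp [hx, hc])⟩⟩
  choose g hg using this
  refine ⟨S \ Finset.univ.image g, Finset.sdiff_subset, ?_, ?_⟩
  · have h1 := Finset.le_card_sdiff (Finset.univ.image g) S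
    have h2 : (Finset.univ.image g).card ≤ 3 := Finset.card_image_le
    omega
  · intro x hx
    rw [Finset.mem_sdiff] at hx
    obtain ⟨h1, h2, h3⟩ := hg (cls x) x hx.1 rfl
    refine ⟨_, h1, fun he => hx.2 ?_, h2, h3⟩
    rw [← he]
    simp

namespace BinaryCubic

theorem hess_pos {f : BinaryCubic} (hd : 0 < f.disc) {x y : ℤ} (h : f.val x y = 1 ∨ f.val x y = -1) :
    0 < f.hess x y := by
  have hA := hessA_pos hd
  have h1 : 4 * f.hessA * f.hess x y = (2 * f.hessA * x + f.hessB * y) ^ 2 + 3 * f.disc * y ^ 2 := by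
    rw [← f.hess_disc, hess]; ring
  have h2 : 0 < 4 * f.hessA * f.hess x y := by
    rw [h1]
    rcases eq_or_ne y 0 with rfl | hy
    · have hx : x ≠ 0 := by
        rintro rfl
        simp [val] at h
      have := hA.ne'
      simp only [mul_zero, add_zero, zero_pow two_ne_zero]
      positivity
    · positivity
  exact pos_of_mul_pos_right h2 (by positivity)

theorem disc_emod_four (f : BinaryCubic) : f.disc % 4 = 0 ∨ f.disc % 4 = 1 := by
  have h : f.disc = (f.b * f.c + f.a * f.d) ^ 2 + 4 * (-f.a * f.c ^ 3 - f.b ^ 3 * f.d -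
      7 * f.a ^ 2 * f.d ^ 2 + 4 * f.a * f.b * f.c * f.d) := by rw [disc]; ring
  rw [h]
  obtain ⟨n, hn⟩ : ∃ n, n = f.b * f.c + f.a * f.d := ⟨_, rfl⟩
  rw [← hn]
  rcases Int.even_or_odd' n with ⟨k, rfl | rfl⟩
  · left; ring_nf; omega
  · right; ring_nf; omega

/-- A solution set with all but three of its elements removed in favour of solutions which are
close to a larger one. -/
theorem IsSolSet.exists_subset_pair {f : BinaryCubic} {S : Finset (ℤ × ℤ)} (hS : f.IsSolSet S)
    {lam D : ℤ} (hl : lam ≠ 0) (hD : 0 < D) (hd : f.disc = lam ^ 2 * D) (hA : lam ∣ f.hessA)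
    (hB : lam ∣ f.hessB) (hC : lam ∣ f.hessC) :
    ∃ T ⊆ S, S.card ≤ T.card + 3 ∧ ∀ P ∈ T, ∃ Q ∈ S, ∃ ξ η G G₂ U p q,
      PadePair lam D ξ η (f.hess P.1 P.2) (f.hess Q.1 Q.2) G G₂ (f.val P.1 P.2)
        (f.val Q.1 Q.2) U (P.1 * Q.2 - P.2 * Q.1) p q ∧ P.1 * Q.2 - P.2 * Q.1 ≠ 0 ∧
      f.hess P.1 P.2 ≤ f.hess Q.1 Q.2 ∧
      4 * ξ.im ^ 2 ≤ f.hess P.1 P.2 ∧ 4 * η.im ^ 2 ≤ f.hess Q.1 Q.2 := by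
  obtain ⟨ξ, hξ, hcls⟩ := exists_classes hl hD hd hA hB hC
  choose cls hcls using hcls
  obtain ⟨T, hTS, hcard, hT⟩ := exists_subset_not_max S cls fun P => f.hess P.1 P.2
  refine ⟨T, hTS, hcard, fun P hP => ?_⟩
  obtain ⟨Q, hQ, hne, hc, hle⟩ := hT P hP
  obtain ⟨G, G₂, U, p, q, hpair⟩ := hξ (cls P) P Q
  refine ⟨Q, hQ, _, _, G, G₂, U, p, q, hpair, hS.2 P (hTS hP) Q hQ hne.symm, hle, hcls P, ?_⟩
  rw [← hc]
  exact hcls Q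

theorem IsSolSet.exists_subset_lt {f : BinaryCubic} {S : Finset (ℤ × ℤ)} (hS : f.IsSolSet S)
    {lam D : ℤ} (hlam : lam = 1 ∨ lam = 7 ∧ D = 1) (hD : 0 < D) (hd : f.disc = lam ^ 2 * D)
    (hD4 : D % 4 = 0 ∨ D % 4 = 1)
    (hA : lam ∣ f.hessA) (hB : lam ∣ f.hessB) (hC : lam ∣ f.hessC) :
    ∃ T ⊆ S, S.card ≤ T.card + 3 ∧ ∀ P ∈ T, f.hess P.1 P.2 ^ 3 < 512 ^ 2 * D ^ 4 * lam ^ 2 := by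
  obtain ⟨T, hTS, hcard, hT⟩ := hS.exists_subset_pair
    (by rcases hlam with rfl | ⟨rfl, -⟩ <;> norm_num) hD hd hA hB hC
  refine ⟨T, hTS, hcard, fun P hP => ?_⟩
  obtain ⟨Q, hQ, ξ, η, G, G₂, U, p, q, hp, hm, hle, h1, h2⟩ := hT P hP
  by_contra hc
  push Not at hc
  exact hp.false hlam hD hD4 (hS.1 P (hTS hP)) (hS.1 Q hQ) hm hc hle h1 h2

theorem IsSolSet.exists_subset_lt_mid {f : BinaryCubic} {S : Finset (ℤ × ℤ)} (hS : f.IsSolSet S)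
    (hd : 49 ≤ f.disc) (hb : ∀ P ∈ S, f.hess P.1 P.2 ^ 3 < 512 ^ 2 * f.disc ^ 4) :
    ∃ T ⊆ S, S.card ≤ T.card + 3 ∧ ∀ P ∈ T, f.hess P.1 P.2 ^ 3 < 621 * f.disc ^ 2 := by
  obtain ⟨T, hTS, hcard, hT⟩ := hS.exists_subset_pair one_ne_zero (D := f.disc) (by linarith)
    (by ring) (one_dvd _) (one_dvd _) (one_dvd _)
  refine ⟨T, hTS, hcard, fun P hP => ?_⟩
  obtain ⟨Q, hQ, ξ, η, G, G₂, U, p, q, hp, hm, hle, h1, h2⟩ := hT P hP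
  by_contra hc
  push Not at hc
  have h3 := hp.le_cube_of_le_cube' hd (hS.1 P (hTS hP)) (hS.1 Q hQ) hm hle h1 h2
    (hess_pos (by linarith) (hS.1 P (hTS hP))) hc
  have h4 := hb Q hQ
  linarith

theorem IsSolSet.exists_subset_lt_small {f : BinaryCubic} {S : Finset (ℤ × ℤ)} (hS : f.IsSolSet S)
    (hd : 49 ≤ f.disc) (hb : ∀ P ∈ S, f.hess P.1 P.2 ^ 3 < 621 * f.disc ^ 2) :
    ∃ T ⊆ S, S.card ≤ T.card + 3 ∧ ∀ P ∈ T, f.hess P.1 P.2 ^ 3 < 32 * f.disc := by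
  obtain ⟨T, hTS, hcard, hT⟩ := hS.exists_subset_pair one_ne_zero (D := f.disc) (by linarith)
    (by ring) (one_dvd _) (one_dvd _) (one_dvd _)
  refine ⟨T, hTS, hcard, fun P hP => ?_⟩
  obtain ⟨Q, hQ, ξ, η, G, G₂, U, p, q, hp, hm, hle, h1, h2⟩ := hT P hP
  by_contra hc
  push Not at hc
  have h3 := hp.le_cube_of_le_cube hd (hS.1 P (hTS hP)) (hS.1 Q hQ) hm hle h1 h2
    (hess_pos (by linarith) (hS.1 P (hTS hP))) hc
  have h4 := hb Q hQ
  linarith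

/-- The discriminant of a totally real cubic form without rational zeros is at least `49`. -/
theorem le_disc {f : BinaryCubic} (hf : f.Anisotropic) (hd : 0 < f.disc) : 49 ≤ f.disc := by
  induction hn : f.hessA.toNat using Nat.strong_induction_on generalizing f with
  | _ n ih =>
    have hA := hessA_pos hd
    obtain ⟨t, ht1, ht2⟩ : ∃ t : ℤ, -f.hessA ≤ f.hessB + 2 * f.hessA * t ∧
        f.hessB + 2 * f.hessA * t ≤ f.hessA := by
      refine ⟨-((f.hessB + f.hessA) / (2 * f.hessA)), ?_⟩
      have h1 := Int.emod_nonneg (f.hessB + f.hessA) (show 2 * f.hessA ≠ 0 by omega)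
      have h2 := Int.emod_lt_of_pos (f.hessB + f.hessA) (show 0 < 2 * f.hessA by omega)
      have h3 := Int.mul_ediv_add_emod (f.hessB + f.hessA) (2 * f.hessA)
      constructor <;> linarith
    have hgf := hf.subst (p := 1) (q := t) (r := 0) (s := 1) (by norm_num)
    have hgd := f.disc_subst 1 t 0 1
    have hgA : (f.subst 1 t 0 1).hessA = f.hessA := by simp only [hessA, subst]; ring
    have hgB : (f.subst 1 t 0 1).hessB = f.hessB + 2 * f.hessA * t := by
      simp only [hessA, hessB, subst]; ring
    have hga := (f.subst 1 t 0 1).four_mul_hessA_cube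
    have hgh := (f.subst 1 t 0 1).hess_disc
    rw [hgd, hgA] at hga hgh
    norm_num at hgd hga hgh
    set g := f.subst 1 t 0 1 with hg
    rcases lt_or_ge g.hessC f.hessA with hlt | hge
    · have hd' : (g.subst 0 1 1 0).disc = f.disc := by rw [disc_subst, hgd]; norm_num
      have hsA : (g.subst 0 1 1 0).hessA = g.hessC := by
        simp only [hessA, hessC, subst]; ring
      have := ih _ (by rw [hsA]; omega) (hgf.subst (by norm_num)) (by rw [hd']; exact hd) rfl
      rwa [hd'] at this
    · have ha : g.a ≠ 0 := by
        intro h0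
        have := hgf 1 0 (by simp [val, h0])
        simp at this
      rw [hgB] at hgh
      have h1 : (f.hessB + 2 * f.hessA * t) ^ 2 ≤ f.hessA ^ 2 := sq_le_sq' ht1 ht2
      have h2 : f.hessA ^ 2 ≤ f.disc := by nlinarith
      have h3 : f.disc * (27 * g.a ^ 2) ≤ f.disc * (4 * f.hessA) := by
        nlinarith [sq_nonneg (3 * g.a * g.hessB - 2 * f.hessA * g.b)]
      have h4 := le_of_mul_le_mul_left h3 hd
      have h5 : 1 ≤ g.a ^ 2 := by
        have := sq_pos_of_ne_zero ha
        omega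
      have h6 : 7 ≤ f.hessA := by omega
      nlinarith

/-- With eleven solutions, at least eight, five and two of them are bounded. -/
theorem IsSolSet.exists_chain {f : BinaryCubic} {S : Finset (ℤ × ℤ)} (hS : f.IsSolSet S)
    (hd : 49 ≤ f.disc) (hcard : 11 ≤ S.card) : ∃ S₁ S₂ S₃ : Finset (ℤ × ℤ),
    S₁ ⊆ S ∧ S₂ ⊆ S₁ ∧ S₃ ⊆ S₂ ∧ 8 ≤ S₁.card ∧ 5 ≤ S₂.card ∧ 2 ≤ S₃.card ∧
    (∀ P ∈ S₁, f.hess P.1 P.2 ^ 3 < 512 ^ 2 * f.disc ^ 4) ∧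
    (∀ P ∈ S₂, f.hess P.1 P.2 ^ 3 < 621 * f.disc ^ 2) ∧
    ∀ P ∈ S₃, f.hess P.1 P.2 ^ 3 < 32 * f.disc := by
  obtain ⟨S₁, h1, c1, b1⟩ := hS.exists_subset_lt (Or.inl rfl) (D := f.disc) (by linarith)
    (by ring) f.disc_emod_four (one_dvd _) (one_dvd _) (one_dvd _)
  have b1' : ∀ P ∈ S₁, f.hess P.1 P.2 ^ 3 < 512 ^ 2 * f.disc ^ 4 := by simpa using b1
  obtain ⟨S₂, h2, c2, b2⟩ := (hS.mono h1).exists_subset_lt_mid hd b1'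
  obtain ⟨S₃, h3, c3, b3⟩ := (hS.mono (h2.trans h1)).exists_subset_lt_small hd b2
  exact ⟨S₁, S₂, S₃, h1, h2, h3, by omega, by omega, by omega, b1', b2, b3⟩

/-- The solutions of `f(x, y) = ±1` in a box with `y ≥ 0` and with bounded value of the Hessian,
up to sign. -/
def boxSols (f : BinaryCubic) (R : ℕ) (K : ℤ) : List (ℤ × ℤ) :=
  ((List.range (2 * R + 1)).flatMap fun i : ℕ => (List.range (R + 1)).map fun j : ℕ =>
    ((i : ℤ) - R, (j : ℤ))).filter fun v =>
      (f.val v.1 v.2 == 1 || f.val v.1 v.2 == -1) && (f.hess v.1 v.2 ^ 3 < K : Bool) &&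
        ((0 < v.2 : Bool) || (0 < v.1 : Bool))

theorem mem_boxSols {f : BinaryCubic} {R : ℕ} {K x y : ℤ} (h : f.val x y = 1 ∨ f.val x y = -1)
    (hK : f.hess x y ^ 3 < K) (hx : |x| ≤ R) (hy : y ≤ R) (hy0 : 0 ≤ y) (hxy : 0 < y ∨ 0 < x) :
    (x, y) ∈ f.boxSols R K := by
  rw [abs_le] at hx
  simp only [boxSols, List.mem_filter, List.mem_flatMap, List.mem_map,
    Prod.mk.injEq, Bool.and_eq_true, Bool.or_eq_true, beq_iff_eq, decide_eq_true_eq]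
  refine ⟨⟨(x + R).toNat, List.mem_range.2 ?_, y.toNat, List.mem_range.2 ?_, by omega, by omega⟩,
    ⟨h, hK⟩, hxy⟩ <;> omega

theorem IsSolSet.card_le_length {f : BinaryCubic} {S : Finset (ℤ × ℤ)} (hS : f.IsSolSet S) {R : ℕ}
    {K : ℤ} (hK : ∀ P ∈ S, f.hess P.1 P.2 ^ 3 < K) (hR : ∀ P ∈ S, |P.1| ≤ R ∧ |P.2| ≤ R) :
    S.card ≤ (f.boxSols R K).length := by
  set φ : ℤ × ℤ → ℤ × ℤ := fun P => if 0 < P.2 ∨ P.2 = 0 ∧ 0 < P.1 then P else -P with hφ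
  have hφ' : ∀ P, φ P = P ∨ φ P = -P := fun P => by
    simp only [hφ]; split_ifs <;> simp
  have h1 : S.image φ ⊆ (f.boxSols R K).toFinset := by
    intro v hv
    obtain ⟨P, hP, rfl⟩ := Finset.mem_image.1 hv
    rw [List.mem_toFinset]
    have h2 := hS.1 P hP
    have h3 := hK P hP
    obtain ⟨h4, h5⟩ := hR P hP
    simp only [hφ]
    split_ifs with hc
    · exact mem_boxSols h2 h3 h4 (by rw [abs_le] at h5; omega) (by omega) (by omega)
    · have e1 : f.val (-P.1) (-P.2) = -f.val P.1 P.2 := by simp only [val]; ring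
      have e2 : f.hess (-P.1) (-P.2) = f.hess P.1 P.2 := by simp only [hess]; ring
      have hne : ¬ (P.1 = 0 ∧ P.2 = 0) := by
        rintro ⟨ha, hb⟩
        rw [ha, hb] at h2
        simp [val] at h2
      refine mem_boxSols (by rw [e1]; omega) (by rw [e2]; exact h3) (by rwa [abs_neg]) ?_ ?_ ?_
      · rw [abs_le] at h5; omega
      · omega
      · omega
  have h2 : (S.image φ).card = S.card := by
    apply Finset.card_image_of_injOn
    intro P hP Q hQ hPQ
    by_contra hne
    apply hS.2 P hP Q hQ hne
    rcases hφ' P with h | h <;> rcases hφ' Q with h' | h' <;> rw [h, h'] at hPQ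
    · exact absurd hPQ hne
    · rw [hPQ]; simp; ring
    · rw [← neg_eq_iff_eq_neg.2 hPQ.symm]; simp; ring
    · exact absurd (neg_injective hPQ) hne
  rw [← h2]
  exact (Finset.card_le_card h1).trans (List.toFinset_card_le _)

theorem finite_check : ((List.range 17).all fun i => (List.range 17).all fun j =>
    (fun b c : ℤ => let f : BinaryCubic := ⟨1, b, c, 1⟩
      !((49 ≤ f.disc : Bool) && (f.disc ≤ 2427 : Bool) && b + c + 2 != 0 && b != c &&
        (f.hessA ^ 3 < 32 * f.disc : Bool) && (f.hessC ^ 3 < 32 * f.disc : Bool)) ||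
      ((f.boxSols 6 (621 * f.disc ^ 2)).length ≤ 4 : Bool) ||
      (b == -4 && c == 0) || (b == 0 && c == -4) || (b == -3 && c == 0) || (b == 0 && c == -3) ||
      (b == -2 && c == -1) || (b == -1 && c == -2)) (i - 8) (j - 8)) = true := by
  decide +kernel

/-- Bounded universal quantification, evaluated by primitive recursion. -/
def natAll (n : ℕ) (p : ℕ → Bool) : Bool := Nat.rec true (fun i ih => p i && ih) n

theorem of_natAll {n : ℕ} {p : ℕ → Bool} (h : natAll n p = true) {i : ℕ} (hi : i < n) :
    p i = true := by
  induction n with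
  | zero => omega
  | succ n ih =>
    have h' : (p n && natAll n p) = true := h
    rw [Bool.and_eq_true] at h'
    rcases Nat.lt_succ_iff_lt_or_eq.1 hi with h1 | rfl
    · exact ih h'.2 h1
    · exact h'.1

/-- Two natural numbers differ by one. -/
def natNear (u v : ℕ) : Bool := Nat.beq u (Nat.succ v) || Nat.beq v (Nat.succ u)

/-- The pair `(x, y)` is small unless the given polynomials differ from `±1` there. -/
def natTest (k x y : ℕ) : Bool :=
  !(natNear (Nat.add (Nat.mul x (Nat.mul x x)) (Nat.mul y (Nat.mul y y)))
      (Nat.mul k (Nat.mul y (Nat.mul x x))) ||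
    natNear (Nat.add (Nat.mul x (Nat.mul x x)) (Nat.mul k (Nat.mul y (Nat.mul x x))))
      (Nat.mul y (Nat.mul y y))) ||
  (Nat.ble x 4 && Nat.ble y 4)

theorem natTest_three : natAll 92 (fun y => natAll 92 fun x => natTest 3 x y) = true := by
  decide +kernel

theorem natTest_four : natAll 92 (fun y => natAll 92 fun x => natTest 4 x y) = true := by
  decide +kernel

theorem natNear_iff {u v : ℕ} : natNear u v = true ↔ (u : ℤ) - v = 1 ∨ (u : ℤ) - v = -1 := by
  simp only [natNear, Bool.or_eq_true, Nat.beq_eq]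
  omega

theorem abs_le_four {k : ℕ} (hk : k = 3 ∨ k = 4) {x y : ℤ}
    (h : x ^ 3 - k * x ^ 2 * y + y ^ 3 = 1 ∨ x ^ 3 - k * x ^ 2 * y + y ^ 3 = -1)
    (hx : |x| ≤ 91) (hy : |y| ≤ 91) : |x| ≤ 4 ∧ |y| ≤ 4 := by
  have key : natAll 92 (fun y => natAll 92 fun x => natTest k x y) = true := by
    rcases hk with rfl | rfl
    exacts [natTest_three, natTest_four]
  rw [Int.abs_eq_natAbs] at *
  rw [Int.abs_eq_natAbs] at *
  have h1 := of_natAll (of_natAll key (show y.natAbs < 92 by omega)) (show x.natAbs < 92 by omega)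
  rw [natTest, Bool.or_eq_true, Bool.and_eq_true, Nat.ble_eq, Nat.ble_eq] at h1
  rcases h1 with h1 | h1
  · exfalso
    rw [Bool.not_eq_true', Bool.or_eq_false_iff, ← Bool.not_eq_true, ← Bool.not_eq_true,
      natNear_iff, natNear_iff] at h1
    simp only [Nat.mul_eq, Nat.add_eq, Nat.cast_add, Nat.cast_mul] at h1
    obtain ⟨h1, h2⟩ := h1
    rcases Int.natAbs_eq x with hx' | hx' <;> rcases Int.natAbs_eq y with hy' | hy' <;>
      rw [hx', hy'] at h <;> generalize (x.natAbs : ℤ) = m at * <;>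
      generalize (y.natAbs : ℤ) = n at *
    · apply h1; rcases h with h | h <;> [left; right] <;> linarith
    · apply h2; rcases h with h | h <;> [left; right] <;> linarith
    · apply h2; rcases h with h | h <;> [right; left] <;> linarith
    · apply h1; rcases h with h | h <;> [right; left] <;> linarith
  · omega

theorem length_boxSols_le :
    ((⟨1, -4, 0, 1⟩ : BinaryCubic).boxSols 4 (512 ^ 2 * 229 ^ 4)).length ≤ 7 ∧
    ((⟨1, 0, -4, 1⟩ : BinaryCubic).boxSols 4 (512 ^ 2 * 229 ^ 4)).length ≤ 7 ∧
    ((⟨1, -3, 0, 1⟩ : BinaryCubic).boxSols 4 (512 ^ 2 * 81 ^ 4)).length ≤ 7 ∧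
    ((⟨1, 0, -3, 1⟩ : BinaryCubic).boxSols 4 (512 ^ 2 * 81 ^ 4)).length ≤ 7 ∧
    ((⟨1, -2, -1, 1⟩ : BinaryCubic).boxSols 6 (512 ^ 2 * 49)).length ≤ 7 ∧
    ((⟨1, -1, -2, 1⟩ : BinaryCubic).boxSols 6 (512 ^ 2 * 49)).length ≤ 7 := by
  refine ⟨?_, ?_, ?_, ?_, ?_, ?_⟩ <;> decide +kernel

theorem abs_le_of_cube_bound {D A H K X : ℤ} {R : ℕ} (hD : 0 < D) (hA : 0 < A)
    (h : 3 * D * X ^ 2 ≤ 4 * (A * H)) (hK : H ^ 3 < K)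
    (hR : 64 * A ^ 3 * K ≤ 27 * D ^ 3 * (R + 1) ^ 6) : |X| ≤ R := by
  by_contra hc
  have h1 : (R : ℤ) + 1 ≤ |X| := by omega
  have h2 : ((R : ℤ) + 1) ^ 6 ≤ X ^ 6 := by
    calc ((R : ℤ) + 1) ^ 6 ≤ |X| ^ 6 := by gcongr
      _ = X ^ 6 := by rw [← abs_pow, abs_of_nonneg (by positivity)]
  have h3 : (3 * D * X ^ 2) ^ 3 ≤ (4 * (A * H)) ^ 3 := by gcongr
  have h4 : 27 * D ^ 3 * ((R : ℤ) + 1) ^ 6 ≤ 27 * D ^ 3 * X ^ 6 := by gcongr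
  have h5 : 64 * A ^ 3 * H ^ 3 < 64 * A ^ 3 * K := by gcongr
  have h6 : 27 * D ^ 3 * X ^ 6 = (3 * D * X ^ 2) ^ 3 := by ring
  have h7 : 64 * A ^ 3 * H ^ 3 = (4 * (A * H)) ^ 3 := by ring
  linarith

theorem hessC_pos {f : BinaryCubic} (h : 0 < f.disc) : 0 < f.hessC := by
  have h1 := f.hess_disc
  have hA := hessA_pos h
  by_contra hc
  nlinarith [sq_nonneg f.hessB]

theorem abs_le_of_hess {f : BinaryCubic} {S : Finset (ℤ × ℤ)}
    (hd : 0 < f.disc) {R : ℕ} {K : ℤ} (hK : ∀ P ∈ S, f.hess P.1 P.2 ^ 3 < K)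
    (hA : 64 * f.hessA ^ 3 * K ≤ 27 * f.disc ^ 3 * (R + 1) ^ 6)
    (hC : 64 * f.hessC ^ 3 * K ≤ 27 * f.disc ^ 3 * (R + 1) ^ 6) :
    ∀ P ∈ S, |P.1| ≤ R ∧ |P.2| ≤ R := by
  intro P hP
  constructor
  · refine abs_le_of_cube_bound hd (hessC_pos hd) ?_ (hK P hP) hC
    have : 4 * (f.hessC * f.hess P.1 P.2) = (2 * f.hessC * P.2 + f.hessB * P.1) ^ 2 +
        3 * f.disc * P.1 ^ 2 := by
      rw [← f.hess_disc, hess]; ring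
    nlinarith [sq_nonneg (2 * f.hessC * P.2 + f.hessB * P.1)]
  · refine abs_le_of_cube_bound hd (hessA_pos hd) ?_ (hK P hP) hA
    have : 4 * (f.hessA * f.hess P.1 P.2) = (2 * f.hessA * P.1 + f.hessB * P.2) ^ 2 +
        3 * f.disc * P.2 ^ 2 := by
      rw [← f.hess_disc, hess]; ring
    nlinarith [sq_nonneg (2 * f.hessA * P.1 + f.hessB * P.2)]

theorem finite_check' {b c : ℤ} (hb : -8 ≤ b ∧ b ≤ 8) (hc : -8 ≤ c ∧ c ≤ 8)
    (h1 : 49 ≤ (⟨1, b, c, 1⟩ : BinaryCubic).disc) (h2 : (⟨1, b, c, 1⟩ : BinaryCubic).disc ≤ 2427)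
    (h3 : b + c + 2 ≠ 0) (h4 : b ≠ c)
    (h5 : (⟨1, b, c, 1⟩ : BinaryCubic).hessA ^ 3 < 32 * (⟨1, b, c, 1⟩ : BinaryCubic).disc)
    (h6 : (⟨1, b, c, 1⟩ : BinaryCubic).hessC ^ 3 < 32 * (⟨1, b, c, 1⟩ : BinaryCubic).disc) :
    ((⟨1, b, c, 1⟩ : BinaryCubic).boxSols 6
      (621 * (⟨1, b, c, 1⟩ : BinaryCubic).disc ^ 2)).length ≤ 4 ∨
    b = -4 ∧ c = 0 ∨ b = 0 ∧ c = -4 ∨ b = -3 ∧ c = 0 ∨ b = 0 ∧ c = -3 ∨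
    b = -2 ∧ c = -1 ∨ b = -1 ∧ c = -2 := by
  have h := List.all_eq_true.1 finite_check (b + 8).toNat (List.mem_range.2 (by omega))
  have h' := List.all_eq_true.1 h (c + 8).toNat (List.mem_range.2 (by omega))
  rw [show (((b + 8).toNat : ℕ) : ℤ) - 8 = b by omega,
    show (((c + 8).toNat : ℕ) : ℤ) - 8 = c by omega] at h'
  simp only [Bool.or_eq_true, Bool.and_eq_true, Bool.not_eq_true', beq_iff_eq,
    decide_eq_true_eq, Bool.and_eq_false_iff, decide_eq_false_iff_not, bne_eq_false_iff_eq] at h'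
  tauto

theorem not_isSolSet_of_chain {b c : ℤ} {f : BinaryCubic} (hf : f = ⟨1, b, c, 1⟩)
    (hfa : f.Anisotropic) (hd : 49 ≤ f.disc) (hA : f.hessA ^ 3 < 32 * f.disc)
    (hC : f.hessC ^ 3 < 32 * f.disc) {S S₁ S₂ : Finset (ℤ × ℤ)} (hS : f.IsSolSet S)
    (h₁ : f.IsSolSet S₁) (h₂ : f.IsSolSet S₂) (hcard : 11 ≤ S.card) (hcard₁ : 8 ≤ S₁.card)
    (hcard₂ : 5 ≤ S₂.card)
    (hK₁ : ∀ P ∈ S₁, f.hess P.1 P.2 ^ 3 < 512 ^ 2 * f.disc ^ 4)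
    (hK₂ : ∀ P ∈ S₂, f.hess P.1 P.2 ^ 3 < 621 * f.disc ^ 2) : False := by
  have hd0 : 0 < f.disc := by linarith
  have hA0 := hessA_pos hd0
  have hC0 := hessC_pos hd0
  have hD : f.disc ≤ 2427 := by
    have e1 : 3 * f.disc ≤ 4 * (f.hessA * f.hessC) := by
      nlinarith [f.hess_disc, sq_nonneg f.hessB]
    have e2 : (3 * f.disc) ^ 3 ≤ (4 * (f.hessA * f.hessC)) ^ 3 := by gcongr
    have e3 : f.hessA ^ 3 * f.hessC ^ 3 ≤ (32 * f.disc) * (32 * f.disc) := by gcongr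
    have e4 : f.disc ^ 2 * (27 * f.disc) ≤ f.disc ^ 2 * 65536 := by nlinarith
    have := le_of_mul_le_mul_left e4 (by positivity)
    omega
  have hA42 : f.hessA ≤ 42 := by
    by_contra hc
    have : 43 ^ 3 ≤ f.hessA ^ 3 := by gcongr; omega
    omega
  have hC42 : f.hessC ≤ 42 := by
    by_contra hc
    have : 43 ^ 3 ≤ f.hessC ^ 3 := by gcongr; omega
    omega
  have eA : f.hessA = b ^ 2 - 3 * c := by rw [hf]; simp [hessA]
  have eC : f.hessC = c ^ 2 - 3 * b := by rw [hf]; simp [hessC]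
  have hc10 : c ≤ 10 := by nlinarith [sq_nonneg (b - c), sq_nonneg (b - 1)]
  have hb8 : b ≤ 8 := by nlinarith
  have hb8' : -8 ≤ b := by nlinarith
  have hc8 : c ≤ 8 := by nlinarith
  have hc8' : -8 ≤ c := by nlinarith
  have n1 : b + c + 2 ≠ 0 := by
    intro h
    have := hfa 1 1 (by rw [hf]; simp only [val]; linarith)
    simp at this
  have n2 : b ≠ c := by
    intro h
    have := hfa 1 (-1) (by rw [hf]; simp only [val]; linarith)
    simp at this
  have hbox₂ : ∀ P ∈ S₂, |P.1| ≤ (6 : ℕ) ∧ |P.2| ≤ (6 : ℕ) := by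
    refine abs_le_of_hess hd0 hK₂ ?_ ?_
    · push_cast
      calc 64 * f.hessA ^ 3 * (621 * f.disc ^ 2) ≤ 64 * (32 * f.disc) * (621 * f.disc ^ 2) := by
            gcongr
        _ = 1271808 * f.disc ^ 3 := by ring
        _ ≤ _ := by nlinarith [pow_pos hd0 3]
    · push_cast
      calc 64 * f.hessC ^ 3 * (621 * f.disc ^ 2) ≤ 64 * (32 * f.disc) * (621 * f.disc ^ 2) := by
            gcongr
        _ = 1271808 * f.disc ^ 3 := by ring
        _ ≤ _ := by nlinarith [pow_pos hd0 3]
  have hlen₂ := h₂.card_le_length hK₂ hbox₂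
  have l1 := length_boxSols_le
  have four : ∀ k : ℕ, k = 3 ∨ k = 4 → (∀ x y, f.val x y = x ^ 3 - k * x ^ 2 * y + y ^ 3) ∨
      (∀ x y, f.val x y = y ^ 3 - k * y ^ 2 * x + x ^ 3) →
      (∀ P ∈ S₁, |P.1| ≤ (91 : ℕ) ∧ |P.2| ≤ (91 : ℕ)) →
      ∀ P ∈ S₁, |P.1| ≤ (4 : ℕ) ∧ |P.2| ≤ (4 : ℕ) := by
    intro k hk hv hP91 P hP
    have e1 := h₁.1 P hP
    obtain ⟨e2, e3⟩ := hP91 P hP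
    rcases hv with hv | hv <;> rw [hv] at e1
    · exact abs_le_four hk e1 e2 e3
    · exact (abs_le_four hk e1 e3 e2).symm
  have seven : 7 ∣ f.hessA → 7 ∣ f.hessB → 7 ∣ f.hessC → f.disc = 7 ^ 2 * 1 → f.hessA = 7 →
      f.hessC = 7 → (f.boxSols 6 (512 ^ 2 * 49)).length ≤ 7 → False := by
    intro a1 a2 a3 a4 a5 a6 a7
    obtain ⟨T, hT, hTc, hK⟩ := hS.exists_subset_lt (Or.inr ⟨rfl, rfl⟩) one_pos a4 (by norm_num)
      a1 a2 a3
    norm_num at hK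
    have hTS := hS.mono hT
    have := hTS.card_le_length (K := 512 ^ 2 * 49) (by simpa using hK)
      (abs_le_of_hess hd0 (R := 6) (by simpa using hK) (by rw [a5, a4]; norm_num)
        (by rw [a6, a4]; norm_num))
    omega
  have hfin := finite_check' ⟨hb8', hb8⟩ ⟨hc8', hc8⟩ (hf ▸ hd) (hf ▸ hD) n1 n2 (hf ▸ hA) (hf ▸ hC)
  rcases hfin with h | ⟨rfl, rfl⟩ | ⟨rfl, rfl⟩ | ⟨rfl, rfl⟩ | ⟨rfl, rfl⟩ | ⟨rfl, rfl⟩ | ⟨rfl, rfl⟩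
  · rw [← hf] at h
    omega
  · have e : f.disc = 229 := by rw [hf]; simp [disc]
    have b1 := four 4 (Or.inr rfl) (Or.inl fun x y => by rw [hf]; simp only [val]; push_cast; ring)
      (abs_le_of_hess hd0 hK₁ (by rw [e, eA]; norm_num) (by rw [e, eC]; norm_num))
    have := h₁.card_le_length hK₁ b1
    rw [e, hf] at this
    omega
  · have e : f.disc = 229 := by rw [hf]; simp [disc]
    have b1 := four 4 (Or.inr rfl) (Or.inr fun x y => by rw [hf]; simp only [val]; push_cast; ring)
      (abs_le_of_hess hd0 hK₁ (by rw [e, eA]; norm_num) (by rw [e, eC]; norm_num))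
    have := h₁.card_le_length hK₁ b1
    rw [e, hf] at this
    omega
  · have e : f.disc = 81 := by rw [hf]; simp [disc]
    have b1 := four 3 (Or.inl rfl) (Or.inl fun x y => by rw [hf]; simp only [val]; push_cast; ring)
      (abs_le_of_hess hd0 hK₁ (by rw [e, eA]; norm_num) (by rw [e, eC]; norm_num))
    have := h₁.card_le_length hK₁ b1
    rw [e, hf] at this
    omega
  · have e : f.disc = 81 := by rw [hf]; simp [disc]
    have b1 := four 3 (Or.inl rfl) (Or.inr fun x y => by rw [hf]; simp only [val]; push_cast; ring)
      (abs_le_of_hess hd0 hK₁ (by rw [e, eA]; norm_num) (by rw [e, eC]; norm_num))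
    have := h₁.card_le_length hK₁ b1
    rw [e, hf] at this
    omega
  · refine seven ?_ ?_ ?_ ?_ ?_ ?_ (by rw [hf]; exact l1.2.2.2.2.1) <;> rw [hf] <;>
      norm_num [hessA, hessB, hessC, disc]
  · refine seven ?_ ?_ ?_ ?_ ?_ ?_ (by rw [hf]; exact l1.2.2.2.2.2) <;> rw [hf] <;>
      norm_num [hessA, hessB, hessC, disc]

theorem solBound_of_disc_pos {f : BinaryCubic} (hf : f.Anisotropic) (hd : 0 < f.disc) :
    f.SolBound 10 := by
  intro S hS
  by_contra hc
  have h49 := le_disc hf hd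
  obtain ⟨S₁, S₂, S₃, h1, h2, h3, c1, c2, c3, b1, b2, b3⟩ := hS.exists_chain h49 (by omega)
  obtain ⟨P, hP, Q, hQ, hPQ⟩ := Finset.one_lt_card.1 (show 1 < S₃.card by omega)
  have hP' := h1 (h2 (h3 hP))
  have hQ' := h1 (h2 (h3 hQ))
  have hdet := hS.2 P hP' Q hQ' hPQ
  have hp := hess_pos hd (hS.1 P hP')
  have hq := hess_pos hd (hS.1 Q hQ')
  have hm : (P.1 * Q.2 - P.2 * Q.1) ^ 2 = 1 := by
    set m := P.1 * Q.2 - P.2 * Q.1 with hm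
    have e1 : 3 * f.disc * m ^ 2 ≤ 4 * (f.hess P.1 P.2 * f.hess Q.1 Q.2) := by
      have : 4 * (f.hess P.1 P.2 * f.hess Q.1 Q.2) = (2 * f.hessA * P.1 * Q.1 +
          f.hessB * (P.1 * Q.2 + P.2 * Q.1) + 2 * f.hessC * P.2 * Q.2) ^ 2 +
          3 * f.disc * m ^ 2 := by
        rw [← f.hess_disc, hess, hess]; ring
      rw [this]
      nlinarith [sq_nonneg (2 * f.hessA * P.1 * Q.1 +
          f.hessB * (P.1 * Q.2 + P.2 * Q.1) + 2 * f.hessC * P.2 * Q.2)]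
    by_contra hne
    have hm4 : 4 ≤ m ^ 2 := by
      have : 2 ≤ |m| := by
        have h0 : 0 < |m| := abs_pos.2 hdet
        have h1 : |m| ≠ 1 := fun h => hne (by rw [← sq_abs, h]; rfl)
        omega
      rw [← sq_abs]
      nlinarith
    have e2 : (3 * f.disc * 4) ^ 3 ≤ (4 * (f.hess P.1 P.2 * f.hess Q.1 Q.2)) ^ 3 := by
      refine pow_le_pow_left₀ (by positivity) ?_ 3
      nlinarith
    have e3 : f.hess P.1 P.2 ^ 3 * f.hess Q.1 Q.2 ^ 3 ≤ (32 * f.disc) * (32 * f.disc) := by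
      gcongr
      · exact (b3 P hP).le
      · exact (b3 Q hQ).le
    have e4 : f.disc ^ 2 * (1728 * f.disc) ≤ f.disc ^ 2 * 65536 := by nlinarith
    have := le_of_mul_le_mul_left e4 (by positivity)
    omega
  set ε := f.val P.1 P.2 with hε
  set δ := f.val Q.1 Q.2 with hδ
  have hε2 : ε ^ 2 = 1 := by rcases hS.1 P hP' with h | h <;> rw [← hε] at h <;> rw [h] <;> rfl
  have hδ2 : δ ^ 2 = 1 := by rcases hS.1 Q hQ' with h | h <;> rw [← hδ] at h <;> rw [h] <;> rfl
  have hdet' : (ε * P.1) * (δ * Q.2) - (δ * Q.1) * (ε * P.2) = 1 ∨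
      (ε * P.1) * (δ * Q.2) - (δ * Q.1) * (ε * P.2) = -1 := by
    refine sq_eq_one_iff.1 ?_
    linear_combination ε ^ 2 * δ ^ 2 * hm + δ ^ 2 * hε2 + hδ2
  set p := ε * P.1 with hp1
  set r := ε * P.2 with hr1
  set q := δ * Q.1 with hq1
  set s := δ * Q.2 with hs1
  have hsq : (p * s - q * r) ^ 2 = 1 := by rcases hdet' with h | h <;> rw [h] <;> norm_num
  have hgd : (f.subst p q r s).disc = f.disc := by
    rw [disc_subst]
    linear_combination f.disc * ((p * s - q * r) ^ 4 + (p * s - q * r) ^ 2 + 1) * hsq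
  have hga : (f.subst p q r s).a = 1 := by
    have : (f.subst p q r s).a = ε ^ 3 * ε := by
      rw [hε]; simp only [subst, val, hp1, hr1, hε]; ring
    rw [this]; linear_combination (ε ^ 2 + 1) * hε2
  have hgdd : (f.subst p q r s).d = 1 := by
    have : (f.subst p q r s).d = δ ^ 3 * δ := by
      rw [hδ]; simp only [subst, val, hq1, hs1, hδ]; ring
    rw [this]; linear_combination (δ ^ 2 + 1) * hδ2
  have hgA : (f.subst p q r s).hessA = f.hess P.1 P.2 := by
    have := f.hess_subst p q r s 1 0
    rw [hsq] at this
    have e : f.hess (p * 1 + q * 0) (r * 1 + s * 0) = ε ^ 2 * f.hess P.1 P.2 := by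
      simp only [hess, hp1, hr1]; ring
    rw [e, hε2] at this
    simpa [hess] using this
  have hgC : (f.subst p q r s).hessC = f.hess Q.1 Q.2 := by
    have := f.hess_subst p q r s 0 1
    rw [hsq] at this
    have e : f.hess (p * 0 + q * 1) (r * 0 + s * 1) = δ ^ 2 * f.hess Q.1 Q.2 := by
      simp only [hess, hq1, hs1]; ring
    rw [e, hδ2] at this
    simpa [hess] using this
  have hh : ∀ v : ℤ × ℤ, (f.subst p q r s).hess ((p * s - q * r) * (s * v.1 - q * v.2))
      ((p * s - q * r) * (p * v.2 - r * v.1)) = f.hess v.1 v.2 := by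
    intro v
    rw [hess_subst, hsq, one_mul]
    congr 1
    · linear_combination v.1 * hsq
    · linear_combination v.2 * hsq
  have hS₁ := hS.mono h1
  have hS₂ := hS₁.mono h2
  obtain ⟨t, k⟩ := hS.exists_subst hdet'
  obtain ⟨t₁, k₁⟩ := hS₁.exists_subst hdet'
  obtain ⟨t₂, k₂⟩ := hS₂.exists_subst hdet'
  refine not_isSolSet_of_chain (f := f.subst p q r s) (b := (f.subst p q r s).b)
    (c := (f.subst p q r s).c) ?_ (hf.subst fun h => ?_) (hgd ▸ h49) ?_ ?_ t t₁ t₂ (by omega)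
    (by omega) (by omega) ?_ ?_
  · calc f.subst p q r s = ⟨(f.subst p q r s).a, (f.subst p q r s).b, (f.subst p q r s).c,
          (f.subst p q r s).d⟩ := rfl
      _ = _ := by rw [hga, hgdd]
  · rw [h] at hsq; norm_num at hsq
  · rw [hgA, hgd]; exact b3 P hP
  · rw [hgC, hgd]; exact b3 Q hQ
  · intro v hv
    obtain ⟨w, hw, rfl⟩ := Finset.mem_image.1 hv
    rw [hh, hgd]; exact b1 w hw
  · intro v hv
    obtain ⟨w, hw, rfl⟩ := Finset.mem_image.1 hv
    rw [hh, hgd]; exact b2 w hw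

end BinaryCubic

theorem three_pow_dvd_of_dvd_mul {v L : ℕ} {l z : ℤ} (h : 3 ^ v ∣ l * z) (hl : ¬ 3 ^ (L + 1) ∣ l) :
    3 ^ v ∣ 3 ^ L * z := by
  have hl0 : l ≠ 0 := by rintro rfl; simp at hl
  obtain ⟨u, l', hl', rfl⟩ : ∃ (u : ℕ) (l' : ℤ), ¬ 3 ∣ l' ∧ l = 3 ^ u * l' := by
    obtain ⟨c, h1, h2⟩ := (Int.finiteMultiplicity_iff.2 ⟨by norm_num, hl0⟩ :
      FiniteMultiplicity (3 : ℤ) l).exists_eq_pow_mul_and_not_dvd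
    exact ⟨_, c, h2, h1⟩
  have hu : u ≤ L := by
    by_contra hc
    exact hl (Dvd.dvd.mul_right (pow_dvd_pow 3 (by omega)) _)
  have hcop : IsCoprime ((3 : ℤ) ^ v) l' :=
    ((Prime.coprime_iff_not_dvd Int.prime_three).2 hl').pow_left
  have h1 : (3 : ℤ) ^ v ∣ 3 ^ u * z := hcop.dvd_of_dvd_mul_left (by
    rw [show l' * (3 ^ u * z) = 3 ^ u * l' * z by ring]; exact h)
  exact h1.trans (mul_dvd_mul_right (pow_dvd_pow 3 hu) z)

theorem three_pow_dvd_choose {v L n l : ℕ} (h : (3 : ℤ) ^ v ∣ n) (hl0 : l ≠ 0)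
    (hl : ¬ (3 : ℤ) ^ (L + 1) ∣ l) : (3 : ℤ) ^ v ∣ 3 ^ L * (n.choose l : ℤ) := by
  refine three_pow_dvd_of_dvd_mul ?_ hl
  obtain ⟨l, rfl⟩ := Nat.exists_eq_succ_of_ne_zero hl0
  rcases n with _ | n
  · simp
  · have := Nat.add_one_mul_choose_eq n l
    have h' : ((l.succ : ℕ) : ℤ) * ((n + 1).choose l.succ : ℕ) = ((n + 1 : ℕ) : ℤ) * n.choose l := by
      rw [mul_comm]; exact_mod_cast this.symm
    rw [h']
    exact h.mul_right _

theorem three_pow_dvd_choose_sub {v L n h i : ℕ} (hh : (3 : ℤ) ^ v ∣ h)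
    (hl : ∀ l : ℕ, l ≠ 0 → l ≤ i → ¬ (3 : ℤ) ^ (L + 1) ∣ l) :
    (3 : ℤ) ^ v ∣ 3 ^ L * (((h + n).choose i : ℤ) - n.choose i) := by
  rw [Nat.add_choose_eq, Finset.Nat.sum_antidiagonal_eq_sum_range_succ_mk, Finset.sum_range_succ']
  simp only [Nat.choose_zero_right, one_mul, Nat.sub_zero]
  push_cast
  rw [add_sub_cancel_right, Finset.mul_sum]
  refine Finset.dvd_sum fun l hlr => ?_
  rw [← mul_assoc]
  refine Dvd.dvd.mul_right (three_pow_dvd_choose hh (by omega) (hl _ (by omega) ?_)) _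
  have := Finset.mem_range.1 hlr
  omega

theorem not_three_pow_dvd {L l : ℕ} (h0 : l ≠ 0) (h : l < 3 ^ (L + 1)) :
    ¬ (3 : ℤ) ^ (L + 1) ∣ l := by
  intro hd
  have : 3 ^ (L + 1) ∣ l := by exact_mod_cast hd
  exact absurd (Nat.le_of_dvd (Nat.pos_of_ne_zero h0) this) (by omega)

theorem exists_three_pow_gt {j : ℕ} (hj : 5 ≤ j) : ∃ L, 2 * L ≤ j - 3 ∧ j < 3 ^ (L + 1) := by
  refine ⟨Nat.log 3 j, ?_, Nat.lt_pow_succ_log_self (by norm_num) j⟩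
  have h := Nat.pow_log_le_self 3 (show j ≠ 0 by omega)
  generalize Nat.log 3 j = L at h ⊢
  rcases Nat.lt_or_ge L 2 with h2 | h2
  · omega
  · have : 2 * L + 3 ≤ 3 ^ L := by
      obtain ⟨m, rfl⟩ := Nat.exists_eq_add_of_le h2
      clear h h2
      induction m with
      | zero => norm_num
      | succ m ih => rw [← add_assoc, pow_succ]; omega
    omega

/-- The combination `k₁ * C(k₂, j) - k₂ * C(k₁, j)` in which the linear term cancels. -/
theorem three_pow_dvd_cross {w v n h j e : ℕ} (hk : (3 : ℤ) ^ w ∣ (n + 1) * (h + n + 1))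
    (hh : (3 : ℤ) ^ v ∣ h) (hj : j = 3 ∧ e = 1 ∨ 4 ≤ j ∧ e = j - 3) :
    (3 : ℤ) ^ (w + v) ∣
      3 ^ e * ((n + 1) * ((h + n + 1).choose j : ℤ) - (h + n + 1) * ((n + 1).choose j : ℤ)) := by
  obtain ⟨i, rfl⟩ : ∃ i, j = i + 1 := ⟨j - 1, by omega⟩
  have key : ((i + 1 : ℕ) : ℤ) * ((n + 1) * ((h + n + 1).choose (i + 1) : ℤ) -
      (h + n + 1) * ((n + 1).choose (i + 1) : ℤ)) =
      (n + 1) * (h + n + 1) * (((h + n).choose i : ℤ) - n.choose i) := by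
    have h1 : ((h + n : ℤ) + 1) * (h + n).choose i = (h + n + 1).choose (i + 1) * (i + 1) := by
      exact_mod_cast Nat.add_one_mul_choose_eq (h + n) i
    have h2 : ((n : ℤ) + 1) * n.choose i = (n + 1).choose (i + 1) * (i + 1) := by
      exact_mod_cast Nat.add_one_mul_choose_eq n i
    push_cast
    linear_combination (-(n + 1 : ℤ)) * h1 + (h + n + 1 : ℤ) * h2
  have main : ∀ L L', L + L' ≤ e → ¬ (3 : ℤ) ^ (L' + 1) ∣ ((i + 1 : ℕ) : ℤ) → i < 3 ^ (L + 1) →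
      (3 : ℤ) ^ (w + v) ∣
        3 ^ e * ((n + 1) * ((h + n + 1).choose (i + 1) : ℤ) -
          (h + n + 1) * ((n + 1).choose (i + 1) : ℤ)) := by
    intro L L' hL hL' hi
    have d1 := three_pow_dvd_choose_sub (n := n) (i := i) (L := L) hh
      fun l hl hli => not_three_pow_dvd hl (by omega)
    have d2 := mul_dvd_mul hk d1
    rw [← pow_add] at d2
    have d3 : (3 : ℤ) ^ (w + v) ∣ ((i + 1 : ℕ) : ℤ) * (3 ^ L * ((n + 1) *
        ((h + n + 1).choose (i + 1) : ℤ) - (h + n + 1) * ((n + 1).choose (i + 1) : ℤ))) := by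
      refine d2.trans (dvd_of_eq ?_)
      linear_combination (-(3 : ℤ) ^ L) * key
    have d4 := three_pow_dvd_of_dvd_mul d3 hL'
    rw [← mul_assoc, ← pow_add] at d4
    exact d4.trans (mul_dvd_mul_right (pow_dvd_pow 3 (by omega)) _)
  rcases hj with ⟨h3, rfl⟩ | ⟨h4, rfl⟩
  · obtain rfl : i = 2 := by omega
    exact main 0 1 (by norm_num) (by norm_num) (by norm_num)
  · rcases Nat.eq_or_lt_of_le h4 with h4 | h5
    · obtain rfl : i = 3 := by omega
      exact main 1 0 (by norm_num) (by norm_num) (by norm_num)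
    · obtain ⟨L, hL, hj⟩ := exists_three_pow_gt (show 5 ≤ i + 1 by omega)
      exact main L L (by omega) (not_three_pow_dvd (by omega) hj) (by omega)

/-- If `c` is the sequence of coefficients of the powers of an integral element, this bounds the
number of vanishing coefficients of the powers of `a + 3 ^ t * γ`. -/
theorem not_two_zeros_of_three_adic {a : ℤ} {t n h : ℕ} {c : ℕ → ℤ} (ha : ¬ 3 ∣ a) (ht : 1 ≤ t)
    (hh : h ≠ 0) (hc0 : c 0 = 0) (hc2 : ¬ 3 ∣ c 2) (hc3 : (3 : ℤ) ^ 2 ∣ 3 ^ t * c 3)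
    (hz : ∀ k, k = n + 1 ∨ k = h + n + 1 →
      ∑ j ∈ Finset.range (k + 1), (k.choose j : ℤ) * a ^ (k - j) * 3 ^ (t * j) * c j = 0) :
    False := by
  have fac : ∀ x : ℤ, x ≠ 0 → ∃ (u : ℕ) (l' : ℤ), ¬ 3 ∣ l' ∧ x = 3 ^ u * l' := by
    intro x hx
    obtain ⟨c, h1, h2⟩ := (Int.finiteMultiplicity_iff.2 ⟨by norm_num, hx⟩ :
      FiniteMultiplicity (3 : ℤ) x).exists_eq_pow_mul_and_not_dvd
    exact ⟨_, c, h2, h1⟩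
  obtain ⟨w, e, he, hwe⟩ := fac ((n + 1) * (h + n + 1)) (by positivity)
  obtain ⟨v, g, hg, hvg⟩ := fac h (by exact_mod_cast hh)
  set M := w + v + 2 * t + 1 with hM
  obtain ⟨b, z, hb⟩ : ∃ b z : ℤ, b * a + z * 3 ^ M = 1 :=
    ((Prime.coprime_iff_not_dvd Int.prime_three).2 ha).symm.pow_right
  have hb3 : ¬ 3 ∣ b := by
    intro h3
    have : (3 : ℤ) ∣ 1 := by
      rw [← hb]
      exact dvd_add (h3.mul_right _) ((dvd_pow_self 3 (by omega)).mul_left _)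
    norm_num at this
  have hE : ∀ k, k = n + 1 ∨ k = h + n + 1 → (3 : ℤ) ^ M ∣
      ∑ j ∈ Finset.range (h + n + 1 + 1), (k.choose j : ℤ) * (3 ^ (t * j) * b ^ j * c j) := by
    intro k hk
    have hkle : k + 1 ≤ h + n + 1 + 1 := by omega
    have hsub : ∑ j ∈ Finset.range (h + n + 1 + 1), (k.choose j : ℤ) * (3 ^ (t * j) * b ^ j * c j)
        = ∑ j ∈ Finset.range (k + 1), (k.choose j : ℤ) * (3 ^ (t * j) * b ^ j * c j) := by
      symm
      refine Finset.sum_subset (Finset.range_subset_range.2 hkle) fun j _ hj => ?_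
      rw [Finset.mem_range, not_lt] at hj
      rw [Nat.choose_eq_zero_of_lt (by omega)]
      simp
    have hz' := congrArg (b ^ k * ·) (hz k hk)
    simp only [mul_zero] at hz'
    rw [hsub, ← sub_zero (∑ j ∈ _, _), ← hz', Finset.mul_sum, ← Finset.sum_sub_distrib]
    refine Finset.dvd_sum fun j hj => ?_
    have hjk : j ≤ k := by have := Finset.mem_range.1 hj; omega
    have e1 : b ^ k = b ^ (k - j) * b ^ j := by rw [← pow_add, Nat.sub_add_cancel hjk]
    have e2 : (k.choose j : ℤ) * (3 ^ (t * j) * b ^ j * c j) -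
        b ^ k * ((k.choose j : ℤ) * a ^ (k - j) * 3 ^ (t * j) * c j) =
        (1 - (b * a) ^ (k - j)) * ((k.choose j : ℤ) * (3 ^ (t * j) * b ^ j * c j)) := by
      rw [e1, mul_pow]; ring
    rw [e2]
    refine Dvd.dvd.mul_right ?_ _
    have e3 := sub_dvd_pow_sub_pow 1 (b * a) (k - j)
    rw [one_pow] at e3
    exact Dvd.dvd.trans ⟨z, by linear_combination -hb⟩ e3
  have hcross : (3 : ℤ) ^ M ∣ ∑ j ∈ Finset.range (h + n + 1 + 1),
      ((n + 1) * ((h + n + 1).choose j : ℤ) - (h + n + 1) * ((n + 1).choose j : ℤ)) *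
        (3 ^ (t * j) * b ^ j * c j) := by
    have := dvd_sub ((hE (h + n + 1) (Or.inr rfl)).mul_left ((n : ℤ) + 1))
      ((hE (n + 1) (Or.inl rfl)).mul_left ((h : ℤ) + n + 1))
    rw [Finset.mul_sum, Finset.mul_sum, ← Finset.sum_sub_distrib] at this
    refine this.trans (dvd_of_eq (Finset.sum_congr rfl fun j _ => ?_))
    ring
  obtain ⟨m, hm⟩ : ∃ m, h + n + 1 + 1 = m + 3 := ⟨h + n - 1, by omega⟩
  rw [hm, Finset.sum_range_succ', Finset.sum_range_succ', Finset.sum_range_succ'] at hcross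
  have hT : ∀ j : ℕ, (3 : ℤ) ^ M ∣
      ((n + 1) * ((h + n + 1).choose (j + 3) : ℤ) - (h + n + 1) * ((n + 1).choose (j + 3) : ℤ)) *
        (3 ^ (t * (j + 3)) * b ^ (j + 3) * c (j + 3)) := by
    intro j
    obtain ⟨e', he', hdv⟩ : ∃ e', ((j + 3 = 3 ∧ e' = 1) ∨ (4 ≤ j + 3 ∧ e' = j + 3 - 3)) ∧
        (3 : ℤ) ^ (2 * t + 1 + e') ∣ 3 ^ (t * (j + 3)) * c (j + 3) := by
      rcases j with _ | j
      · refine ⟨1, Or.inl ⟨rfl, rfl⟩, ?_⟩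
        have := mul_dvd_mul (dvd_refl ((3 : ℤ) ^ (2 * t))) hc3
        refine Dvd.dvd.trans (dvd_of_eq ?_) (this.trans (dvd_of_eq ?_))
        · ring
        · simp only [zero_add]; ring
      · refine ⟨j + 1, Or.inr ⟨by omega, by omega⟩, Dvd.dvd.mul_right (pow_dvd_pow 3 ?_) _⟩
        nlinarith
    have d1 := three_pow_dvd_cross (w := w) (v := v) (n := n) (h := h) ⟨e, hwe⟩ ⟨g, hvg⟩ he'
    have d2 := mul_dvd_mul d1 hdv
    rw [← pow_add, show w + v + (2 * t + 1 + e') = M + e' by omega, pow_add] at d2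
    have d3 : (3 : ℤ) ^ e' ≠ 0 := by positivity
    refine (mul_dvd_mul_iff_left d3).1 ?_
    refine Dvd.dvd.trans (dvd_of_eq (mul_comm _ _)) ((d2.mul_right (b ^ (j + 3))).trans
      (dvd_of_eq ?_))
    ring
  have hF1 : ((n + 1) * ((h + n + 1).choose (0 + 1) : ℤ) -
      (h + n + 1) * ((n + 1).choose (0 + 1) : ℤ)) = 0 := by
    simp only [zero_add, Nat.choose_one_right]; push_cast; ring
  rw [hF1, hc0, mul_zero, mul_zero, add_zero, zero_mul, add_zero] at hcross
  have hT2 := (dvd_add_right (Finset.dvd_sum fun j (_ : j ∈ Finset.range m) => hT j)).1 hcross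
  simp only [zero_add, one_add_one_eq_two] at hT2
  have hfin : (3 : ℤ) ^ M ∣ 3 ^ (w + v + 2 * t) * (e * g * b ^ 2 * c 2) := by
    refine (hT2.mul_left 2).trans (dvd_of_eq ?_)
    have c1 : ((h + n + 1 : ℕ).choose 2 : ℤ) * 2 = (h + n + 1) * (h + n) := by
      have := Nat.add_one_mul_choose_eq (h + n) 1
      rw [Nat.choose_one_right] at this
      exact_mod_cast this.symm
    have c2 : ((n + 1 : ℕ).choose 2 : ℤ) * 2 = (n + 1) * n := by
      have := Nat.add_one_mul_choose_eq n 1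
      rw [Nat.choose_one_right] at this
      exact_mod_cast this.symm
    have c3 : (3 : ℤ) ^ (w + v + 2 * t) = 3 ^ w * 3 ^ v * 3 ^ (t * 2) := by
      rw [pow_add, pow_add, mul_comm t 2]
    rw [c3]
    linear_combination ((n + 1) * c1 - (h + n + 1) * c2 + h * hwe + 3 ^ w * e * hvg) *
      (3 ^ (t * 2) * b ^ 2 * c 2)
  rw [hM, pow_succ] at hfin
  have h3 := (mul_dvd_mul_iff_left (by positivity)).1 hfin
  have p3 := Int.prime_three
  rcases p3.dvd_or_dvd h3 with h | h
  · rcases p3.dvd_or_dvd h with h | h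
    · rcases p3.dvd_or_dvd h with h | h
      · exact he h
      · exact hg h
    · exact hb3 (p3.dvd_of_dvd_pow h)
  · exact hc2 h

theorem add_two_lt_three_pow (j : ℕ) : j + 2 < 3 ^ (j + 1) := by
  induction j with
  | zero => norm_num
  | succ j ih => rw [pow_succ]; omega

theorem not_zero_of_three_adic {a : ℤ} {t k : ℕ} {c : ℕ → ℤ} (ha : ¬ 3 ∣ a) (ht : 1 ≤ t)
    (hk : k ≠ 0) (hc0 : c 0 = 0) (hc1 : ¬ 3 ∣ c 1)
    (hz : ∑ j ∈ Finset.range (k + 1), (k.choose j : ℤ) * a ^ (k - j) * 3 ^ (t * j) * c j = 0) :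
    False := by
  obtain ⟨v, g, hg, hvg⟩ : ∃ (u : ℕ) (l' : ℤ), ¬ 3 ∣ l' ∧ (k : ℤ) = 3 ^ u * l' := by
    obtain ⟨c, h1, h2⟩ := (Int.finiteMultiplicity_iff.2 ⟨by norm_num, by exact_mod_cast hk⟩ :
      FiniteMultiplicity (3 : ℤ) k).exists_eq_pow_mul_and_not_dvd
    exact ⟨_, c, h2, h1⟩
  obtain ⟨m, rfl⟩ := Nat.exists_eq_succ_of_ne_zero hk
  rw [Nat.succ_eq_add_one, Finset.sum_range_succ', Finset.sum_range_succ', hc0, mul_zero,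
    add_zero] at hz
  have hT : (3 : ℤ) ^ (v + t + 1) ∣ ∑ j ∈ Finset.range m, (((m + 1).choose (j + 1 + 1) : ℤ) *
      a ^ (m + 1 - (j + 1 + 1)) * 3 ^ (t * (j + 1 + 1)) * c (j + 1 + 1)) := by
    refine Finset.dvd_sum fun j _ => ?_
    have hj := add_two_lt_three_pow j
    have d1 := three_pow_dvd_choose (n := m + 1) (l := j + 2) ⟨g, hvg⟩ (by omega)
      (not_three_pow_dvd (by omega) hj)
    have d2 : (3 : ℤ) ^ (t + 1 + j) ∣ 3 ^ (t * (j + 1 + 1)) := pow_dvd_pow 3 (by nlinarith)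
    have d3 := mul_dvd_mul d1 d2
    rw [← pow_add, show v + (t + 1 + j) = j + (v + t + 1) by omega, pow_add, mul_assoc] at d3
    have d4 := (mul_dvd_mul_iff_left (by positivity)).1 d3
    refine (d4.mul_right (a ^ (m + 1 - (j + 1 + 1)) * c (j + 1 + 1))).trans (dvd_of_eq ?_)
    ring
  have h1 := (dvd_add_right hT).1 (hz ▸ dvd_zero _)
  rw [zero_add, Nat.choose_one_right, mul_one, hvg, show v + t + 1 = v + (t + 1) by omega,
    pow_add] at h1
  have h2 : (3 : ℤ) ^ v * 3 ^ (t + 1) ∣ 3 ^ v * (3 ^ t * (g * a ^ (m + 1 - 1) * c 1)) :=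
    h1.trans (dvd_of_eq (by ring))
  have h3 := (mul_dvd_mul_iff_left (by positivity)).1 h2
  rw [pow_succ] at h3
  have h4 := (mul_dvd_mul_iff_left (by positivity)).1 h3
  have p3 := Int.prime_three
  rcases p3.dvd_or_dvd h4 with h | h
  · rcases p3.dvd_or_dvd h with h | h
    · exact hg h
    · exact ha (p3.dvd_of_dvd_pow h)
  · exact hc1 h

/-- The ring `ℤ[θ]`, where `θ` is a root of `t³ + b t² + c t + d`; the element `⟨x, y, z⟩` is
`x + y θ + z θ²`. -/
@[ext]
structure CubicRing (f : BinaryCubic) where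
  /-- coefficient of `1` -/
  x : ℤ
  /-- coefficient of `θ` -/
  y : ℤ
  /-- coefficient of `θ²` -/
  z : ℤ

namespace CubicRing

variable {f : BinaryCubic}

instance : Zero (CubicRing f) := ⟨⟨0, 0, 0⟩⟩
instance : One (CubicRing f) := ⟨⟨1, 0, 0⟩⟩
instance : Add (CubicRing f) := ⟨fun u v => ⟨u.x + v.x, u.y + v.y, u.z + v.z⟩⟩
instance : Neg (CubicRing f) := ⟨fun u => ⟨-u.x, -u.y, -u.z⟩⟩
instance : Mul (CubicRing f) := ⟨fun u v =>
  ⟨u.x * v.x - f.d * (u.y * v.z + u.z * v.y) + f.b * f.d * (u.z * v.z),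
    u.x * v.y + u.y * v.x - f.c * (u.y * v.z + u.z * v.y) + (f.b * f.c - f.d) * (u.z * v.z),
    u.x * v.z + u.y * v.y + u.z * v.x - f.b * (u.y * v.z + u.z * v.y) +
      (f.b ^ 2 - f.c) * (u.z * v.z)⟩⟩

theorem zero_def : (0 : CubicRing f) = ⟨0, 0, 0⟩ := rfl
theorem one_def : (1 : CubicRing f) = ⟨1, 0, 0⟩ := rfl
theorem add_def (u v : CubicRing f) : u + v = ⟨u.x + v.x, u.y + v.y, u.z + v.z⟩ := rfl
theorem neg_def (u : CubicRing f) : -u = ⟨-u.x, -u.y, -u.z⟩ := rfl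
theorem mul_def (u v : CubicRing f) : u * v =
  ⟨u.x * v.x - f.d * (u.y * v.z + u.z * v.y) + f.b * f.d * (u.z * v.z),
    u.x * v.y + u.y * v.x - f.c * (u.y * v.z + u.z * v.y) + (f.b * f.c - f.d) * (u.z * v.z),
    u.x * v.z + u.y * v.y + u.z * v.x - f.b * (u.y * v.z + u.z * v.y) +
      (f.b ^ 2 - f.c) * (u.z * v.z)⟩ := rfl

instance : CommRing (CubicRing f) := CommRing.ofMinimalAxioms
  (fun u v w => by simp only [add_def]; ext <;> ring)
  (fun u => by simp only [add_def, zero_def]; ext <;> ring)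
  (fun u => by simp only [add_def, zero_def, neg_def]; ext <;> ring)
  (fun u v w => by simp only [mul_def]; ext <;> ring)
  (fun u v => by simp only [mul_def]; ext <;> ring)
  (fun u => by simp only [mul_def, one_def]; ext <;> ring)
  (fun u v w => by simp only [mul_def, add_def]; ext <;> ring)

/-- The embedding of the integers. -/
def C : ℤ →+* CubicRing f where
  toFun a := ⟨a, 0, 0⟩
  map_one' := rfl
  map_zero' := rfl
  map_mul' a b := by rw [mul_def]; ext <;> ring
  map_add' a b := by rw [add_def]; ext <;> ring

theorem C_def (a : ℤ) : (C a : CubicRing f) = ⟨a, 0, 0⟩ := rfl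

/-- The coefficient of `θ²`, as an additive map. -/
def zHom : CubicRing f →+ ℤ where
  toFun u := u.z
  map_zero' := rfl
  map_add' _ _ := rfl

theorem zHom_apply (u : CubicRing f) : zHom u = u.z := rfl

theorem C_mul_z (a : ℤ) (u : CubicRing f) : (C a * u).z = a * u.z := by
  rw [mul_def, C_def]; ring

theorem z_pow (a s : ℤ) (γ : CubicRing f) (k : ℕ) : ((C a + C s * γ) ^ k).z =
    ∑ j ∈ Finset.range (k + 1), (k.choose j : ℤ) * a ^ (k - j) * s ^ j * (γ ^ j).z := by
  rw [add_comm, add_pow, ← zHom_apply, map_sum]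
  refine Finset.sum_congr rfl fun j _ => ?_
  have : (C s * γ) ^ j * C a ^ (k - j) * (k.choose j : CubicRing f) =
      C ((k.choose j : ℤ) * a ^ (k - j) * s ^ j) * γ ^ j := by
    rw [mul_pow, ← map_pow, ← map_pow, map_mul, map_mul, map_natCast]
    ring
  rw [this, zHom_apply, C_mul_z]

/-- The element with `u * adj u = norm u`. -/
def adj (u : CubicRing f) : CubicRing f :=
  ⟨(u.x - f.c * u.z) * (u.x - f.c * u.z - f.b * (u.y - f.b * u.z)) +
      (f.d * u.z + f.c * (u.y - f.b * u.z)) * (u.y - f.b * u.z),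
    -(u.y * (u.x - f.c * u.z - f.b * (u.y - f.b * u.z)) +
      (f.d * u.z + f.c * (u.y - f.b * u.z)) * u.z),
    u.y * (u.y - f.b * u.z) - (u.x - f.c * u.z) * u.z⟩

/-- The norm form. -/
def norm (u : CubicRing f) : ℤ :=
  u.x * u.adj.x - f.d * (u.z * u.adj.y + (u.y - f.b * u.z) * u.adj.z)

theorem mul_adj (u : CubicRing f) : u * u.adj = C u.norm := by
  rw [mul_def, C_def, norm, adj]; ext <;> ring

theorem norm_mul (u v : CubicRing f) : (u * v).norm = u.norm * v.norm := by
  simp only [norm, adj, mul_def]; ring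

theorem norm_linear (hf : f.a = 1) (x y : ℤ) : (⟨x, -y, 0⟩ : CubicRing f).norm = f.val x y := by
  simp only [norm, adj, BinaryCubic.val, hf]; ring

/-- The real embedding attached to a real root. -/
def real {θ : ℝ} (hθ : θ ^ 3 + f.b * θ ^ 2 + f.c * θ + f.d = 0) : CubicRing f →+* ℝ where
  toFun u := u.x + u.y * θ + u.z * θ ^ 2
  map_one' := by rw [one_def]; simp
  map_zero' := by rw [zero_def]; simp
  map_add' u v := by rw [add_def]; push_cast; ring
  map_mul' u v := by
    rw [mul_def]; push_cast
    linear_combination (-(u.y * v.z + u.z * v.y : ℝ) - u.z * v.z * (θ - f.b)) * hθ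

variable {θ : ℝ}

theorem real_apply (hθ : θ ^ 3 + f.b * θ ^ 2 + f.c * θ + f.d = 0) (u : CubicRing f) :
    real hθ u = u.x + u.y * θ + u.z * θ ^ 2 := rfl

theorem eq_zero_of_linear (hf : f.Anisotropic) (ha : f.a = 1)
    (hθ : θ ^ 3 + f.b * θ ^ 2 + f.c * θ + f.d = 0) {x y : ℤ} (h : (x : ℝ) + y * θ = 0) :
    x = 0 ∧ y = 0 := by
  have h1 : f.val (-x) y = 0 := by
    have : ((f.val (-x) y : ℤ) : ℝ) = 0 := by
      simp only [BinaryCubic.val, ha]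
      push_cast
      have hx : (x : ℝ) = -(y * θ) := by linarith
      rw [hx]
      linear_combination (y : ℝ) ^ 3 * hθ
    exact_mod_cast this
  obtain ⟨h2, h3⟩ := hf _ _ h1
  exact ⟨by linarith, h3⟩

theorem eq_zero_of_real (hf : f.Anisotropic) (ha : f.a = 1)
    (hθ : θ ^ 3 + f.b * θ ^ 2 + f.c * θ + f.d = 0) {u : CubicRing f} (h : real hθ u = 0) :
    u = 0 := by
  rw [real_apply] at h
  have h1 : ((u.z ^ 2 * f.d - (f.b * u.z - u.y) * u.x : ℤ) : ℝ) +
      (u.z ^ 2 * f.c - u.z * u.x - (f.b * u.z - u.y) * u.y : ℤ) * θ = 0 := by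
    push_cast
    linear_combination (u.z : ℝ) ^ 2 * hθ - (u.z * θ + (f.b * u.z - u.y)) * h
  obtain ⟨h2, h3⟩ := eq_zero_of_linear hf ha hθ h1
  have hz : u.z = 0 := by
    refine (hf (u.y - f.b * u.z) u.z ?_).2
    simp only [BinaryCubic.val, ha]
    linear_combination u.z * h2 + (u.y - f.b * u.z) * h3
  rw [hz, Int.cast_zero, zero_mul, add_zero] at h
  obtain ⟨hx, hy⟩ := eq_zero_of_linear hf ha hθ h
  ext <;> assumption

theorem real_C (hθ : θ ^ 3 + f.b * θ ^ 2 + f.c * θ + f.d = 0) (a : ℤ) : real hθ (C a) = a := by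
  rw [real_apply, C_def]; simp

theorem norm_C (a : ℤ) : (C a : CubicRing f).norm = a ^ 3 := by
  simp only [norm, adj, C_def]; ring

/-- Units that are congruent to integers modulo `3`. -/
def IsThreeUnit (u : CubicRing f) : Prop := (u.norm = 1 ∨ u.norm = -1) ∧ 3 ∣ u.y ∧ 3 ∣ u.z

theorem IsThreeUnit.mul {u v : CubicRing f} (hu : u.IsThreeUnit) (hv : v.IsThreeUnit) :
    (u * v).IsThreeUnit := by
  obtain ⟨h1, ⟨y, hy⟩, ⟨z, hz⟩⟩ := hu
  obtain ⟨h2, ⟨y', hy'⟩, ⟨z', hz'⟩⟩ := hv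
  refine ⟨?_, ?_, ?_⟩
  · rw [norm_mul]
    rcases h1 with h1 | h1 <;> rcases h2 with h2 | h2 <;> rw [h1, h2] <;> simp
  · exact ⟨u.x * y' + y * v.x - f.c * (y * v.z + z * v.y) + (f.b * f.c - f.d) * (z * v.z), by
      rw [mul_def]; simp only; rw [hy, hz, hy', hz']; ring⟩
  · exact ⟨u.x * z' + y * v.y + z * v.x - f.b * (y * v.z + z * v.y) + (f.b ^ 2 - f.c) * (z * v.z),
      by rw [mul_def]; simp only; rw [hy, hz, hy', hz']; ring⟩

theorem IsThreeUnit.adj {u : CubicRing f} (hu : u.IsThreeUnit) : u.adj.IsThreeUnit := by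
  obtain ⟨h1, hy, hz⟩ := hu
  refine ⟨?_, ?_, ?_⟩
  · have h2 := norm_mul u u.adj
    rw [mul_adj, norm_C] at h2
    left
    rcases h1 with h1 | h1 <;> rw [h1] at h2 <;> linarith
  · exact (dvd_add (hy.mul_right _) (hz.mul_left _)).neg_right
  · exact dvd_sub (hy.mul_right _) (hz.mul_left _)

theorem IsThreeUnit.pow {u : CubicRing f} (hu : u.IsThreeUnit) (k : ℕ) : (u ^ k).IsThreeUnit := by
  induction k with
  | zero => rw [pow_zero]; exact ⟨Or.inl (by simp [norm, CubicRing.adj, one_def]), by simp [one_def],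
      by simp [one_def]⟩
  | succ k ih => rw [pow_succ]; exact ih.mul hu

theorem disc_eq (ha : f.a = 1) (hθ : θ ^ 3 + f.b * θ ^ 2 + f.c * θ + f.d = 0) :
    (f.disc : ℝ) = ((f.b + θ) ^ 2 - 4 * (f.c + θ * (f.b + θ))) *
      (θ ^ 2 + (f.b + θ) * θ + (f.c + θ * (f.b + θ))) ^ 2 := by
  have hd : (f.d : ℝ) = -(θ ^ 3 + f.b * θ ^ 2 + f.c * θ) := by linarith
  simp only [BinaryCubic.disc, ha]
  push_cast
  rw [hd]; ring

theorem real_adj (hθ : θ ^ 3 + f.b * θ ^ 2 + f.c * θ + f.d = 0) (u : CubicRing f) :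
    real hθ u.adj = (u.x - u.z * (f.c + θ * (f.b + θ))) ^ 2 -
      (f.b + θ) * (u.x - u.z * (f.c + θ * (f.b + θ))) * (u.y - u.z * (f.b + θ)) +
      (f.c + θ * (f.b + θ)) * (u.y - u.z * (f.b + θ)) ^ 2 := by
  rw [real_apply]
  simp only [adj]
  push_cast
  linear_combination ((u.z : ℝ) * (u.y - f.b * u.z - u.z * θ)) * hθ

theorem real_mul_real_adj (hθ : θ ^ 3 + f.b * θ ^ 2 + f.c * θ + f.d = 0) (u : CubicRing f) :
    real hθ u * real hθ u.adj = u.norm := by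
  rw [← map_mul, mul_adj, real_C]

theorem abs_real_mul_abs_real_adj (hθ : θ ^ 3 + f.b * θ ^ 2 + f.c * θ + f.d = 0) {u : CubicRing f}
    (hu : u.norm = 1 ∨ u.norm = -1) : |real hθ u| * |real hθ u.adj| = 1 := by
  rw [← abs_mul, real_mul_real_adj]
  rcases hu with h | h <;> rw [h] <;> simp

theorem abs_le_sqrt_of_sum {c₀ Δ p n : ℝ} (hc₀ : 0 < c₀) (hΔ : 0 < Δ)
    (h : c₀ * (p ^ 2 + Δ * n ^ 2) ≤ 4) : |n| ≤ √(4 / (c₀ * Δ)) ∧ |p| ≤ √(4 / c₀) := by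
  constructor <;> apply Real.abs_le_sqrt <;> rw [le_div_iff₀ (by positivity)]
  · nlinarith [mul_nonneg hc₀.le (sq_nonneg p)]
  · nlinarith [mul_nonneg hc₀.le (mul_nonneg hΔ.le (sq_nonneg n))]

theorem exists_coord_bound (ha : f.a = 1) (hd : f.disc < 0)
    (hθ : θ ^ 3 + f.b * θ ^ 2 + f.c * θ + f.d = 0) {c₀ : ℝ} (hc₀ : 0 < c₀) :
    ∃ K : ℤ, ∀ u : CubicRing f, (u.norm = 1 ∨ u.norm = -1) → c₀ ≤ |real hθ u| →
      |real hθ u| ≤ 1 → |u.x| ≤ K ∧ |u.y| ≤ K ∧ |u.z| ≤ K := by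
  have hdisc := disc_eq ha hθ
  have hd' : (f.disc : ℝ) < 0 := by exact_mod_cast hd
  set B : ℝ := f.b + θ with hB
  set E : ℝ := f.c + θ * B with hE
  have hΔ : 0 < 4 * E - B ^ 2 := by
    by_contra hc
    have : 0 ≤ (f.disc : ℝ) := by rw [hdisc]; exact mul_nonneg (by linarith) (sq_nonneg _)
    linarith
  have hG : 0 < θ ^ 2 + B * θ + E := by nlinarith [sq_nonneg (2 * θ + B)]
  set Δ := 4 * E - B ^ 2 with hΔ'
  set G := θ ^ 2 + B * θ + E with hG'
  obtain ⟨K₁, hK₁⟩ : ∃ K₁ : ℝ, √(4 / (c₀ * Δ)) = K₁ ∧ 0 ≤ K₁ := ⟨_, rfl, Real.sqrt_nonneg _⟩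
  obtain ⟨K₂, hK₂⟩ : ∃ K₂ : ℝ, √(4 / c₀) = K₂ ∧ 0 ≤ K₂ := ⟨_, rfl, Real.sqrt_nonneg _⟩
  set M := K₂ + |B| * K₁ with hM
  set Z := (1 + M + K₁ * |θ|) / G with hZ
  obtain ⟨K, hK⟩ := exists_nat_ge (Z + (K₁ + Z * |B|) + (M + Z * |E|))
  have hM0 : 0 ≤ M := add_nonneg hK₂.2 (mul_nonneg (abs_nonneg _) hK₁.2)
  have hZ0 : 0 ≤ Z := div_nonneg
    (add_nonneg (add_nonneg zero_le_one hM0) (mul_nonneg hK₁.2 (abs_nonneg _))) hG.le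
  refine ⟨K, fun u hu h1 h2 => ?_⟩
  have hadj := real_adj hθ u
  have hprod := abs_real_mul_abs_real_adj hθ hu
  rw [← hB, ← hE] at hadj
  set m := (u.x : ℝ) - u.z * E with hm
  set n := (u.y : ℝ) - u.z * B with hn
  have hQ : 4 * real hθ u.adj = (2 * m - B * n) ^ 2 + Δ * n ^ 2 := by rw [hadj]; ring
  have hQ1 : c₀ * |real hθ u.adj| ≤ 1 := by
    rw [← hprod]; exact mul_le_mul_of_nonneg_right h1 (abs_nonneg _)
  have hQ2 : c₀ * ((2 * m - B * n) ^ 2 + Δ * n ^ 2) ≤ 4 := by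
    rw [← hQ]; nlinarith [le_abs_self (real hθ u.adj)]
  obtain ⟨hn1, hm1⟩ := abs_le_sqrt_of_sum hc₀ hΔ hQ2
  rw [hK₁.1] at hn1
  rw [hK₂.1] at hm1
  have hBn : |B * n| ≤ |B| * K₁ := by
    rw [abs_mul]; exact mul_le_mul_of_nonneg_left hn1 (abs_nonneg _)
  have hm2 : |m| ≤ M := by
    have : |2 * m| ≤ |2 * m - B * n| + |B * n| := by
      have := abs_add_le (2 * m - B * n) (B * n)
      rwa [sub_add_cancel] at this
    rw [abs_mul, abs_two] at this
    linarith [abs_nonneg m]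
  have hz : |(u.z : ℝ)| ≤ Z := by
    rw [hZ, le_div_iff₀ hG]
    have e1 : (u.z : ℝ) * G = real hθ u - m - n * θ := by rw [real_apply]; ring
    have e2 : |(u.z : ℝ)| * G = |(u.z : ℝ) * G| := by rw [abs_mul, abs_of_pos hG]
    rw [e2, e1]
    have e3 := abs_sub (real hθ u - m) (n * θ)
    have e4 := abs_sub (real hθ u) m
    have e5 : |n * θ| ≤ K₁ * |θ| := by
      rw [abs_mul]; exact mul_le_mul_of_nonneg_right hn1 (abs_nonneg _)
    linarith
  have hzB : |(u.z : ℝ) * B| ≤ Z * |B| := by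
    rw [abs_mul]; exact mul_le_mul_of_nonneg_right hz (abs_nonneg _)
  have hzE : |(u.z : ℝ) * E| ≤ Z * |E| := by
    rw [abs_mul]; exact mul_le_mul_of_nonneg_right hz (abs_nonneg _)
  have hx : |(u.x : ℝ)| ≤ M + Z * |E| := by
    have := abs_add_le m (u.z * E)
    rw [hm, sub_add_cancel, ← hm] at this
    linarith
  have hy : |(u.y : ℝ)| ≤ K₁ + Z * |B| := by
    have := abs_add_le n (u.z * B)
    rw [hn, sub_add_cancel, ← hn] at this
    linarith
  have hZB := mul_nonneg hZ0 (abs_nonneg B)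
  have hZE := mul_nonneg hZ0 (abs_nonneg E)
  refine ⟨?_, ?_, ?_⟩
  · have : |(u.x : ℝ)| ≤ K := by linarith [hK₁.2]
    exact_mod_cast this
  · have : |(u.y : ℝ)| ≤ K := by linarith
    exact_mod_cast this
  · have : |(u.z : ℝ)| ≤ K := by linarith [hK₁.2]
    exact_mod_cast this

theorem eq_or_eq_neg_of_abs_real_eq (hf : f.Anisotropic) (ha : f.a = 1)
    (hθ : θ ^ 3 + f.b * θ ^ 2 + f.c * θ + f.d = 0) {u v : CubicRing f}
    (h : |real hθ u| = |real hθ v|) : u = v ∨ u = -v := by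
  rcases abs_eq_abs.1 h with h | h
  · left
    exact sub_eq_zero.1 (eq_zero_of_real hf ha hθ (by rw [map_sub, h, sub_self]))
  · right
    exact eq_neg_of_add_eq_zero_left (eq_zero_of_real hf ha hθ (by rw [map_add, h]; ring))

theorem IsThreeUnit.exists_generator (hf : f.Anisotropic) (ha : f.a = 1) (hd : f.disc < 0)
    (hθ : θ ^ 3 + f.b * θ ^ 2 + f.c * θ + f.d = 0) {u₀ : CubicRing f} (hu₀ : u₀.IsThreeUnit)
    (h₀ : |real hθ u₀| < 1) :
    ∃ η : CubicRing f, η.IsThreeUnit ∧ |real hθ η| < 1 ∧ ∀ u : CubicRing f, u.IsThreeUnit →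
      |real hθ u| < 1 → ∃ k : ℕ, k ≠ 0 ∧ (u = η ^ k ∨ u = -η ^ k) := by
  have hpos : ∀ u : CubicRing f, u.IsThreeUnit → 0 < |real hθ u| := fun u hu =>
    (abs_nonneg _).lt_of_ne fun h => by
      have := abs_real_mul_abs_real_adj hθ hu.1
      rw [← h] at this; simp at this
  obtain ⟨K, hK⟩ := exists_coord_bound ha hd hθ (hpos u₀ hu₀)
  set T : Set (CubicRing f) :=
    {u | u.IsThreeUnit ∧ |real hθ u₀| ≤ |real hθ u| ∧ |real hθ u| < 1} with hT
  have hfin : T.Finite := by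
    refine Set.Finite.subset (Set.Finite.image (fun p : ℤ × ℤ × ℤ => (⟨p.1, p.2.1, p.2.2⟩ :
      CubicRing f)) ((Set.finite_Icc (-K) K).prod ((Set.finite_Icc (-K) K).prod
        (Set.finite_Icc (-K) K)))) ?_
    rintro u ⟨h1, h2, h3⟩
    obtain ⟨e1, e2, e3⟩ := hK u h1.1 h2 h3.le
    exact ⟨(u.x, u.y, u.z), ⟨abs_le.1 e1, abs_le.1 e2, abs_le.1 e3⟩, rfl⟩
  obtain ⟨η, ⟨hη, hη0, hη1⟩, hmax⟩ := Set.exists_max_image T (fun u => |real hθ u|) hfin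
    ⟨u₀, hu₀, le_rfl, h₀⟩
  refine ⟨η, hη, hη1, fun u hu hu1 => ?_⟩
  obtain ⟨k, hk1, hk2⟩ := exists_nat_pow_near_of_lt_one (hpos u hu) hu1.le (hpos η hη) hη1
  have hadj := abs_real_mul_abs_real_adj hθ (hη.pow k).1
  have hv := hu.mul (hη.pow k).adj
  have hpk : 0 < |real hθ η| ^ k := pow_pos (hpos η hη) k
  rw [map_pow, abs_pow] at hadj
  have e1 : |real hθ (u * (η ^ k).adj)| * |real hθ η| ^ k = |real hθ u| := by
    rw [map_mul, abs_mul]; linear_combination |real hθ u| * hadj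
  have e2 : |real hθ η| < |real hθ (u * (η ^ k).adj)| := by
    refine lt_of_mul_lt_mul_right ?_ hpk.le
    rw [e1, ← pow_succ']; exact hk1
  have e3 : |real hθ (u * (η ^ k).adj)| = 1 := by
    refine le_antisymm (le_of_mul_le_mul_right (by rw [e1, one_mul]; exact hk2) hpk) ?_
    by_contra hc
    exact absurd (hmax _ ⟨hv, hη0.trans e2.le, not_le.1 hc⟩) (not_le.2 e2)
  rw [e3, one_mul] at e1
  refine ⟨k, ?_, eq_or_eq_neg_of_abs_real_eq hf ha hθ (by rw [← e1, map_pow, abs_pow])⟩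
  rintro rfl
  rw [pow_zero] at e1
  linarith

theorem norm_eq (u : CubicRing f) : u.norm = u.x ^ 3 - f.b * u.x ^ 2 * u.y +
    (f.b ^ 2 - 2 * f.c) * u.x ^ 2 * u.z + f.c * u.x * u.y ^ 2 +
    (3 * f.d - f.b * f.c) * u.x * u.y * u.z + (f.c ^ 2 - 2 * f.b * f.d) * u.x * u.z ^ 2 -
    f.d * u.y ^ 3 + f.b * f.d * u.y ^ 2 * u.z - f.c * f.d * u.y * u.z ^ 2 + f.d ^ 2 * u.z ^ 3 := by
  simp only [norm, adj]; ring

theorem IsThreeUnit.not_three_dvd {u : CubicRing f} (hu : u.IsThreeUnit) : ¬ 3 ∣ u.x := by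
  intro h
  obtain ⟨h1, ⟨y, hy⟩, ⟨z, hz⟩⟩ := hu
  obtain ⟨x, hx⟩ := h
  have : u.norm = 27 * (⟨x, y, z⟩ : CubicRing f).norm := by
    rw [norm_eq, norm_eq, hx, hy, hz]; ring
  omega

theorem IsThreeUnit.exists_eq {u : CubicRing f} (hu : u.IsThreeUnit) (h : u.y ≠ 0 ∨ u.z ≠ 0) :
    ∃ (t : ℕ) (s q : ℤ), 1 ≤ t ∧ ¬ (3 ∣ s ∧ 3 ∣ q) ∧ u.y = 3 ^ t * s ∧ u.z = 3 ^ t * q := by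
  have hg : (Int.gcd u.y u.z : ℤ) ≠ 0 := by
    rw [Int.ofNat_ne_zero, Ne, Int.gcd_eq_zero_iff]
    tauto
  obtain ⟨g', h1, h2⟩ := (Int.finiteMultiplicity_iff.2 ⟨by norm_num, hg⟩ :
    FiniteMultiplicity (3 : ℤ) (Int.gcd u.y u.z)).exists_eq_pow_mul_and_not_dvd
  set t := multiplicity (3 : ℤ) (Int.gcd u.y u.z)
  obtain ⟨y', hy'⟩ : (Int.gcd u.y u.z : ℤ) ∣ u.y := Int.gcd_dvd_left ..
  obtain ⟨z', hz'⟩ : (Int.gcd u.y u.z : ℤ) ∣ u.z := Int.gcd_dvd_right ..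
  have hy : u.y = 3 ^ t * (g' * y') := by rw [← mul_assoc, ← h1]; exact hy'
  have hz : u.z = 3 ^ t * (g' * z') := by rw [← mul_assoc, ← h1]; exact hz'
  have hnot : ¬ (3 ∣ g' * y' ∧ 3 ∣ g' * z') := by
    rintro ⟨⟨y₁, hy₁⟩, ⟨z₁, hz₁⟩⟩
    have : (3 : ℤ) ^ (t + 1) ∣ Int.gcd u.y u.z := by
      refine Int.dvd_coe_gcd ⟨y₁, ?_⟩ ⟨z₁, ?_⟩
      · rw [hy, hy₁]; ring
      · rw [hz, hz₁]; ring
    rw [h1, pow_succ] at this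
    exact h2 ((mul_dvd_mul_iff_left (by positivity)).1 this)
  refine ⟨t, g' * y', g' * z', ?_, hnot, hy, hz⟩
  by_contra ht
  obtain ht : t = 0 := by omega
  rw [ht, pow_zero, one_mul] at hy hz
  exact hnot ⟨hy ▸ hu.2.1, hz ▸ hu.2.2⟩

/-- At most one power of a `3`-adically small unit has no `θ²` term. -/
theorem IsThreeUnit.eq_of_z_pow_eq_zero {η : CubicRing f} (hη : η.IsThreeUnit)
    (h0 : η.y ≠ 0 ∨ η.z ≠ 0) {n h : ℕ} (hh : h ≠ 0)
    (hz : ∀ k, k = n + 1 ∨ k = h + n + 1 → (η ^ k).z = 0) : False := by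
  obtain ⟨t, s, q, ht, hsq, hy, hz'⟩ := hη.exists_eq h0
  have ha := hη.not_three_dvd
  set γ : CubicRing f := ⟨0, s, q⟩ with hγ
  have hηγ : η = C η.x + C (3 ^ t) * γ := by
    rw [add_def, mul_def, C_def, C_def]
    ext
    · simp [hγ]
    · simp [hγ, hy]
    · simp [hγ, hz']
  have hsum : ∀ k, k = n + 1 ∨ k = h + n + 1 → ∑ j ∈ Finset.range (k + 1),
      (k.choose j : ℤ) * η.x ^ (k - j) * 3 ^ (t * j) * (γ ^ j).z = 0 := by
    intro k hk
    have := hz k hk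
    rw [hηγ, z_pow] at this
    rw [← this]
    simp only [pow_mul]
  have c0 : (γ ^ 0).z = 0 := by rw [pow_zero, one_def]
  have c1 : (γ ^ 1).z = q := by rw [pow_one]
  have c2 : (γ ^ 2).z = s ^ 2 + q * (-2 * f.b * s + (f.b ^ 2 - f.c) * q) := by
    rw [pow_two, mul_def, hγ]; ring
  by_cases hq : 3 ∣ q
  · have hs : ¬ 3 ∣ s := fun hs => hsq ⟨hs, hq⟩
    obtain ⟨q', rfl⟩ := hq
    refine not_two_zeros_of_three_adic (c := fun j => (γ ^ j).z) ha ht hh c0 ?_ ?_ hsum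
    · intro h3
      simp only [c2] at h3
      have : (3 : ℤ) ∣ s ^ 2 := (dvd_add_left ⟨q' * (-2 * f.b * s + (f.b ^ 2 - f.c) * (3 * q')),
        by ring⟩).1 h3
      exact hs (Int.prime_three.dvd_of_dvd_pow this)
    · rcases Nat.eq_or_lt_of_le ht with h1 | h2
      · rw [← h1] at hy hz' ⊢
        have hb : 3 ∣ f.b := by
          have hN : η.norm = η.x ^ 3 - 3 * (η.x ^ 2 * s * f.b) + 9 * (
              (f.b ^ 2 - 2 * f.c) * η.x ^ 2 * q' + f.c * η.x * s ^ 2 +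
              (3 * f.d - f.b * f.c) * η.x * 3 * s * q' +
              (f.c ^ 2 - 2 * f.b * f.d) * η.x * 9 * q' ^ 2 - 3 * f.d * s ^ 3 +
              9 * f.b * f.d * s ^ 2 * q' - 27 * f.c * f.d * s * q' ^ 2 +
              81 * f.d ^ 2 * q' ^ 3) := by
            rw [norm_eq, hy, hz']; ring
          have hcube : ∃ k, η.x ^ 3 = 9 * k + 1 ∨ η.x ^ 3 = 9 * k - 1 := by
            obtain ⟨m, hm | hm⟩ : ∃ m, η.x = 3 * m + 1 ∨ η.x = 3 * m - 1 :=
              ⟨(η.x + 1) / 3, by omega⟩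
            · exact ⟨3 * m ^ 3 + 3 * m ^ 2 + m, Or.inl (by rw [hm]; ring)⟩
            · exact ⟨3 * m ^ 3 - 3 * m ^ 2 + m, Or.inr (by rw [hm]; ring)⟩
          obtain ⟨k, hk⟩ := hcube
          have h1 := hη.1
          have h3 : 3 ∣ η.x ^ 2 * s * f.b := by
            generalize η.x ^ 2 * s * f.b = B at hN ⊢
            generalize η.x ^ 3 = A at hN hk
            omega
          rcases Int.prime_three.dvd_or_dvd h3 with h | h
          · rcases Int.prime_three.dvd_or_dvd h with h | h
            · exact absurd (Int.prime_three.dvd_of_dvd_pow h) ha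
            · exact absurd h hs
          · exact h
        obtain ⟨b', hb'⟩ := hb
        have c3 : 3 ∣ (γ ^ 3).z := by
          rw [pow_succ, pow_two, mul_def, mul_def, hγ, hb']
          simp only
          ring_nf
          omega
        rw [pow_two, pow_one]
        exact mul_dvd_mul_left 3 c3
      · exact Dvd.dvd.mul_right (pow_dvd_pow 3 h2) _
  · exact not_zero_of_three_adic (c := fun j => (γ ^ j).z) ha ht (Nat.succ_ne_zero n) c0
      (by simpa [c1] using hq) (hsum _ (Or.inl rfl))

theorem false_of_two_small (hf : f.Anisotropic) (ha : f.a = 1) (hd : f.disc < 0)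
    (hθ : θ ^ 3 + f.b * θ ^ 2 + f.c * θ + f.d = 0) {X Y X' Y' : ℤ}
    (h : f.val X Y = 1 ∨ f.val X Y = -1) (h' : f.val X' Y' = 1 ∨ f.val X' Y' = -1)
    (hY : 3 ∣ Y) (hY' : 3 ∣ Y') (hY0 : Y ≠ 0) (hY0' : Y' ≠ 0) (hs : |X - θ * Y| ≤ 1)
    (hs' : |X' - θ * Y'| ≤ 1) (hdet : X * Y' - Y * X' ≠ 0) : False := by
  have key : ∀ x y : ℤ, (f.val x y = 1 ∨ f.val x y = -1) → 3 ∣ y → y ≠ 0 → |x - θ * y| ≤ 1 →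
      (⟨x, -y, 0⟩ : CubicRing f).IsThreeUnit ∧ |real hθ ⟨x, -y, 0⟩| < 1 := by
    intro x y h1 h2 h3 h4
    refine ⟨⟨by rwa [norm_linear ha], h2.neg_right, dvd_zero 3⟩, ?_⟩
    have e : real hθ ⟨x, -y, 0⟩ = x - θ * y := by rw [real_apply]; push_cast; ring
    refine lt_of_le_of_ne (by rwa [e]) fun h5 => ?_
    rcases eq_or_eq_neg_of_abs_real_eq hf ha hθ (v := 1) (by rw [h5, map_one, abs_one])
      with h6 | h6
    · exact h3 (neg_eq_zero.1 (congrArg CubicRing.y h6))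
    · have := congrArg CubicRing.y h6
      rw [neg_def, one_def] at this
      simp only at this
      omega
  obtain ⟨h1, h2⟩ := key X Y h hY hY0 hs
  obtain ⟨h1', h2'⟩ := key X' Y' h' hY' hY0' hs'
  obtain ⟨η, hη, hη1, hgen⟩ := h1.exists_generator hf ha hd hθ h2
  obtain ⟨k, hk, hku⟩ := hgen _ h1 h2
  obtain ⟨k', hk', hku'⟩ := hgen _ h1' h2'
  have hz : ∀ {u : CubicRing f} {m : ℕ}, u.z = 0 → (u = η ^ m ∨ u = -η ^ m) → (η ^ m).z = 0 := by
    rintro u m hu (rfl | rfl)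
    · exact hu
    · exact neg_eq_zero.1 hu
  have h0 : η.y ≠ 0 ∨ η.z ≠ 0 := by
    by_contra hc
    push Not at hc
    have hηC : η = C η.x := CubicRing.ext rfl hc.1 hc.2
    rw [hηC, ← map_pow] at hku
    rcases hku with hku | hku
    · exact hY0 (neg_eq_zero.1 (congrArg CubicRing.y hku))
    · have := congrArg CubicRing.y hku
      rw [neg_def, C_def] at this
      simp only at this
      omega
  rcases lt_trichotomy k k' with hlt | rfl | hlt
  · refine hη.eq_of_z_pow_eq_zero h0 (n := k - 1) (h := k' - k) (by omega) ?_
    rintro m (hm | hm)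
    · rw [show m = k by omega]; exact hz rfl hku
    · rw [show m = k' by omega]; exact hz rfl hku'
  · have : (⟨X, -Y, 0⟩ : CubicRing f) = ⟨X', -Y', 0⟩ ∨ (⟨X, -Y, 0⟩ : CubicRing f) = -⟨X', -Y', 0⟩ := by
      rcases hku with e | e <;> rcases hku' with e' | e' <;> rw [e, e'] <;> simp
    rw [neg_def] at this
    simp only [CubicRing.mk.injEq] at this
    apply hdet
    rcases this with ⟨e1, e2, -⟩ | ⟨e1, e2, -⟩
    · rw [e1, show Y = Y' by linarith]; ring
    · rw [e1, show Y = -Y' by linarith]; ring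
  · refine hη.eq_of_z_pow_eq_zero h0 (n := k' - 1) (h := k - k') (by omega) ?_
    rintro m (hm | hm)
    · rw [show m = k' by omega]; exact hz rfl hku'
    · rw [show m = k by omega]; exact hz rfl hku

end CubicRing

/-- A real cubic polynomial has a real root. -/
theorem exists_root_cubic {a : ℝ} (b c d : ℝ) (ha : a ≠ 0) :
    ∃ θ : ℝ, a * θ ^ 3 + b * θ ^ 2 + c * θ + d = 0 := by
  set u := b / a
  set v := c / a
  set w := d / a
  have hb : b = a * u := by simp only [u]; field_simp
  have hc : c = a * v := by simp only [v]; field_simp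
  have hd : d = a * w := by simp only [w]; field_simp
  set M := 1 + |u| + |v| + |w| with hM
  have hM1 : 1 ≤ M := by rw [hM]; linarith [abs_nonneg u, abs_nonneg v, abs_nonneg w]
  have hM2 : M ≤ M ^ 2 := by nlinarith
  have hM3 : 1 ≤ M ^ 2 := by nlinarith
  have hsum : |u| * M ^ 2 + |v| * M + |w| ≤ M ^ 3 := by
    have h1 := mul_le_mul_of_nonneg_left hM2 (abs_nonneg v)
    have h2 := mul_le_mul_of_nonneg_left hM3 (abs_nonneg w)
    have : M ^ 3 = (1 + |u| + |v| + |w|) * M ^ 2 := by rw [← hM]; ring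
    nlinarith
  have hu1 := mul_le_mul_of_nonneg_right (neg_abs_le u) (sq_nonneg M)
  have hu2 := mul_le_mul_of_nonneg_right (le_abs_self u) (sq_nonneg M)
  have hv1 := mul_le_mul_of_nonneg_right (neg_abs_le v) (by linarith : 0 ≤ M)
  have hv2 := mul_le_mul_of_nonneg_right (le_abs_self v) (by linarith : 0 ≤ M)
  have hw1 := neg_abs_le w
  have hw2 := le_abs_self w
  obtain ⟨θ, -, hθ⟩ := intermediate_value_Icc (f := fun t : ℝ => t ^ 3 + u * t ^ 2 + v * t + w)
    (by linarith : -M ≤ M) (by fun_prop) (show (0 : ℝ) ∈ _ by constructor <;> nlinarith)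
  refine ⟨θ, ?_⟩
  simp only at hθ
  rw [hb, hc, hd]
  linear_combination a * hθ

namespace BinaryCubic

/-- Residue class invariant: two coprime pairs with the same value are parallel modulo `3`. -/
def slopeMod (P : ℤ × ℤ) : ℤ := if 3 ∣ P.2 then 3 else P.1 * P.2 % 3

theorem dvd_det_of_slopeMod_eq {P Q : ℤ × ℤ} (h : slopeMod P = slopeMod Q) :
    3 ∣ P.1 * Q.2 - P.2 * Q.1 := by
  obtain ⟨x, y⟩ := P
  obtain ⟨x', y'⟩ := Q
  simp only [slopeMod] at h ⊢
  split_ifs at h with h1 h2 h2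
  · exact dvd_sub (h2.mul_left _) (h1.mul_right _)
  · omega
  · omega
  · have hxy : (x * y - x' * y') % 3 = 0 := by omega
    have key : ∀ z : ℤ, ¬ 3 ∣ z → 3 ∣ z ^ 2 - 1 := by
      intro z hz
      have : z % 3 = 1 ∨ z % 3 = 2 := by omega
      apply Int.dvd_of_emod_eq_zero
      rcases this with h | h <;> simp [Int.sub_emod, pow_two, Int.mul_emod, h]
    obtain ⟨k, hk⟩ := Int.dvd_of_emod_eq_zero hxy
    obtain ⟨l, hl⟩ := key y h1
    obtain ⟨l', hl'⟩ := key y' h2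
    exact ⟨k * y * y' - l * x * y' + l' * x' * y, by
      linear_combination y * y' * hk - x * y' * hl + y * x' * hl'⟩

theorem solBound_of_disc_neg {f : BinaryCubic} (hf : f.Anisotropic) (hd : f.disc < 0) :
    f.SolBound 10 := by
  intro S hS
  by_contra! hcard
  have ha : f.a ≠ 0 := fun h => by
    have := (hf 1 0 (by simp [val, h])).1
    omega
  obtain ⟨θ, hθ⟩ := exists_root_cubic (a := f.a) f.b f.c f.d (by exact_mod_cast ha)
  obtain ⟨k, -, hk⟩ := Finset.exists_lt_card_fiber_of_mul_lt_card_of_maps_to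
    (s := S) (t := Finset.Icc 0 3) (f := slopeMod) (n := 2) (fun P _ => by
      rw [Finset.mem_Icc, slopeMod]; split_ifs <;> omega) (by simp; omega)
  set T := S.filter fun P => slopeMod P = k with hT
  have hTS : ∀ P ∈ T, P ∈ S ∧ slopeMod P = k := fun P hP => Finset.mem_filter.1 hP
  obtain ⟨P, hP, hmax⟩ := T.exists_max_image (fun P => |(P.1 : ℝ) - θ * P.2|)
    (Finset.card_pos.1 (by omega))
  obtain ⟨Q, hQ, R, hR, hQR⟩ := Finset.one_lt_card.1
    (by rw [Finset.card_erase_of_mem hP]; omega : 1 < (T.erase P).card)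
  obtain ⟨hQP, hQ⟩ := Finset.mem_erase.1 hQ
  obtain ⟨hRP, hR⟩ := Finset.mem_erase.1 hR
  set ε := f.val P.1 P.2 with hε
  have hε' : ε = 1 ∨ ε = -1 := hS.1 P (hTS P hP).1
  have hε2 : ε ^ 2 = 1 := by rcases hε' with h | h <;> rw [h] <;> norm_num
  set p := ε * P.1 with hp
  set r := ε * P.2 with hr
  have hpr : f.val p r = 1 := by
    have : f.val p r = ε ^ 3 * ε := by rw [hε]; simp only [val, hp, hr, hε]; ring
    rw [this]; linear_combination (ε ^ 2 + 1) * hε2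
  obtain ⟨q, s, hqs⟩ := exists_unimodular (Or.inl hpr)
  have hqsR : (p : ℝ) * s - q * r = 1 := by exact_mod_cast hqs
  have hm : (p : ℝ) - θ * r ≠ 0 := by
    intro h
    have h1 : ((f.val p r : ℤ) : ℝ) = 0 := by
      have h2 : (p : ℝ) = θ * r := by linarith
      simp only [val]
      push_cast
      rw [h2]
      linear_combination (r : ℝ) ^ 3 * hθ
    rw [hpr] at h1
    norm_num at h1
  have hmabs : |(p : ℝ) - θ * r| = |(P.1 : ℝ) - θ * P.2| := by
    have : (p : ℝ) - θ * r = ε * (P.1 - θ * P.2) := by simp only [hp, hr]; push_cast; ring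
    rw [this, abs_mul]
    rcases hε' with h | h <;> rw [h] <;> simp
  set m := (p : ℝ) - θ * r with hmdef
  set θ' := (s * θ - q) / m with hθ'
  have hθm : θ' * m = s * θ - q := by rw [hθ']; field_simp
  have key : ∀ A ∈ T, A ≠ P →
      ((f.subst p q r s).val (s * A.1 - q * A.2) (p * A.2 - r * A.1) = 1 ∨
        (f.subst p q r s).val (s * A.1 - q * A.2) (p * A.2 - r * A.1) = -1) ∧
      3 ∣ p * A.2 - r * A.1 ∧ p * A.2 - r * A.1 ≠ 0 ∧
      |((s * A.1 - q * A.2 : ℤ) : ℝ) - θ' * (p * A.2 - r * A.1 : ℤ)| ≤ 1 := by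
    intro A hA hAP
    have e : p * A.2 - r * A.1 = ε * (P.1 * A.2 - P.2 * A.1) := by rw [hp, hr]; ring
    refine ⟨?_, ?_, ?_, ?_⟩
    · rw [val_subst, show p * (s * A.1 - q * A.2) + q * (p * A.2 - r * A.1) = A.1 by
        linear_combination A.1 * hqs, show r * (s * A.1 - q * A.2) + s * (p * A.2 - r * A.1) = A.2
        by linear_combination A.2 * hqs]
      exact hS.1 A (hTS A hA).1
    · rw [e]
      exact (dvd_det_of_slopeMod_eq ((hTS P hP).2.trans (hTS A hA).2.symm)).mul_left _
    · rw [e]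
      refine mul_ne_zero (fun h => ?_) (hS.2 P (hTS P hP).1 A (hTS A hA).1 hAP.symm)
      rw [h] at hε2
      norm_num at hε2
    · have h1 := hmax A hA
      rw [← hmabs] at h1
      have h2 : (A.1 : ℝ) - θ * A.2 =
          m * (((s * A.1 - q * A.2 : ℤ) : ℝ) - θ' * (p * A.2 - r * A.1 : ℤ)) := by
        push_cast
        linear_combination (p * A.2 - r * A.1 : ℝ) * hθm + (-(A.1 : ℝ) + θ * A.2) * hqsR +
          (s * A.1 - q * A.2 : ℝ) * (-hmdef)
      rw [h2, abs_mul] at h1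
      exact le_of_mul_le_mul_left (by linarith) (abs_pos.2 hm)
  obtain ⟨hQ1, hQ2, hQ3, hQ4⟩ := key Q hQ hQP
  obtain ⟨hR1, hR2, hR3, hR4⟩ := key R hR hRP
  have hθ'' : θ' ^ 3 + (f.subst p q r s).b * θ' ^ 2 + (f.subst p q r s).c * θ' +
      (f.subst p q r s).d = 0 := by
    have h1 : p * (θ' * m) + q * m = θ := by
      rw [hθm, hmdef]; linear_combination θ * hqsR
    have h2 : r * (θ' * m) + s * m = 1 := by
      rw [hθm, hmdef]; linear_combination hqsR
    have hga : ((f.subst p q r s).a : ℝ) = 1 := by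
      have : (f.subst p q r s).a = 1 := by rw [← hpr]; simp only [subst, val]
      exact_mod_cast this
    have h3 : ((f.subst p q r s).a * θ' ^ 3 + (f.subst p q r s).b * θ' ^ 2 +
        (f.subst p q r s).c * θ' + (f.subst p q r s).d) * m ^ 3 =
        f.a * (p * (θ' * m) + q * m) ^ 3 +
        f.b * (p * (θ' * m) + q * m) ^ 2 * (r * (θ' * m) + s * m) +
        f.c * (p * (θ' * m) + q * m) * (r * (θ' * m) + s * m) ^ 2 +
        f.d * (r * (θ' * m) + s * m) ^ 3 := by
      simp only [subst]; push_cast; ring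
    rw [h1, h2, hga] at h3
    refine (mul_eq_zero.1 ?_).resolve_right (pow_ne_zero 3 hm)
    linear_combination h3 + hθ
  refine CubicRing.false_of_two_small (f := f.subst p q r s) (hf.subst (by omega)) ?_ ?_ hθ''
    hQ1 hR1 hQ2 hR2 hQ3 hR3 hQ4 hR4 ?_
  · rw [← hpr]; simp only [subst, val]
  · rw [disc_subst, hqs]; omega
  · have := hS.2 Q (hTS Q hQ).1 R (hTS R hR).1 hQR
    intro h
    apply this
    linear_combination h - (Q.1 * R.2 - Q.2 * R.1) * hqs

end BinaryCubic

/-- A cubic Thue equation `F(U,V) = ±1`, with `F` irreducible over `ℚ`, has at most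
`10` integer solutions (counting `(u,v)` and `(-u,-v)` as one solution). -/
theorem cubic_thue_eq_at_most_ten_solutions (a b c d : ℤ)
    (hirr : Irreducible
      (MvPolynomial.C (a : ℚ) * MvPolynomial.X 0 ^ 3 +
        MvPolynomial.C (b : ℚ) * MvPolynomial.X 0 ^ 2 * MvPolynomial.X 1 +
        MvPolynomial.C (c : ℚ) * MvPolynomial.X 0 * MvPolynomial.X 1 ^ 2 +
        MvPolynomial.C (d : ℚ) * MvPolynomial.X 1 ^ 3 : MvPolynomial (Fin 2) ℚ)) :
    Finite (Quot (pmRelCubic a b c d)) ∧ Nat.card (Quot (pmRelCubic a b c d)) ≤ 10 := by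
  have hf := anisotropic_of_irreducible hirr
  apply card_quot_le_of_solBound
  rcases lt_or_gt_of_ne hf.disc_ne_zero with hd | hd
  · exact BinaryCubic.solBound_of_disc_neg hf hd
  · exact BinaryCubic.solBound_of_disc_pos hf hd
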